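/- (Conjecture.) Fix an integer k > 1. Then lim_{n→∞} (α_{k,n} − n) = frac((k+4)/8) + k/(8(2k+1)), and this value is a sharp lower bound for α_{k,n} − n over the range of n on which α_{k,n} − n is decreasing. Equivalently, the difference between the mean α_{k,n} and the median ν_k = n − ⌊(k+4)/8⌋ satisfies lim_{n→∞} (α_{k,n} − ν_k(n/κ)) = (2k+9)/16 − 1/(16(2k+1)), and this is a sharp lower bound for α_{k,n} − ν_k(n/κ). -/

import Mathlib

open scoped BigOperators

/-- The pmf of the Poisson distribution of order `k` with parameter `lam`:
`f_k(n;λ) = e^{-kλ} Σ_{n₁+2n₂+⋯+k n_k = n} λ^{n₁+⋯+n_k}/(n₁!⋯n_k!)`. -/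
noncomputable def poissonOrderKPmf (k : ℕ) (lam : ℝ) (n : ℕ) : ℝ :=
  Real.exp (-(k * lam)) *
    ∑' v : Fin k → ℕ,
      if (∑ i : Fin k, ((i : ℕ) + 1) * v i) = n then
        lam ^ (∑ i : Fin k, v i) / ((∏ i : Fin k, Nat.factorial (v i) : ℕ) : ℝ)
      else 0

/-- The median of the Poisson distribution of order `k` with parameter `lam`:
the least integer `n` such that `P(X ≤ n) ≥ 1/2`. -/
noncomputable def poissonOrderKMedian (k : ℕ) (lam : ℝ) : ℕ :=
  sInf {n : ℕ | (1 : ℝ) / 2 ≤ ∑ j ∈ Finset.range (n + 1), poissonOrderKPmf k lam j}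

/-- α_(k,n): the value of the mean κλ at the (unique) λ > 0 for which
Σ_{j=0}^{n−⌊(k+4)/8⌋} f_k(j;λ) = 1/2 exactly. -/
noncomputable def poissonOrderKAlpha (k n : ℕ) : ℝ :=
  ((k * (k + 1) / 2 : ℕ) : ℝ) *
    sInf {lam : ℝ | 0 < lam ∧
      ∑ j ∈ Finset.range ((n - (k + 4) / 8) + 1), poissonOrderKPmf k lam j = 1 / 2}

namespace PoissonOrderK

open Finset Filter Topology MeasureTheory

/-- The pmf of the Poisson distribution of order `k` without its factor `exp (-(k * lam))`. -/
noncomputable def mass (k : ℕ) (lam : ℝ) (n : ℕ) : ℝ :=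
  ∑' v : Fin k → ℕ,
    if (∑ i : Fin k, ((i : ℕ) + 1) * v i) = n then
      lam ^ (∑ i : Fin k, v i) / ((∏ i : Fin k, Nat.factorial (v i) : ℕ) : ℝ)
    else 0

lemma pmf_eq (k : ℕ) (lam : ℝ) (n : ℕ) :
    poissonOrderKPmf k lam n = Real.exp (-(k * lam)) * mass k lam n := rfl

lemma finite_weight_eq (k n : ℕ) :
    {v : Fin k → ℕ | (∑ i : Fin k, ((i : ℕ) + 1) * v i) = n}.Finite := by
  refine (Set.finite_Iic (fun _ : Fin k => n)).subset fun v hv i => ?_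
  have h := single_le_sum (f := fun i : Fin k => ((i : ℕ) + 1) * v i)
    (fun _ _ => Nat.zero_le _) (mem_univ i)
  simp only [Set.mem_ofPred_eq] at hv
  rw [hv] at h
  exact (Nat.le_mul_of_pos_left (v i) (Nat.succ_pos i)).trans h

lemma summable_weight (k n : ℕ) (F : (Fin k → ℕ) → ℝ) :
    Summable fun v : Fin k → ℕ =>
      if (∑ i : Fin k, ((i : ℕ) + 1) * v i) = n then F v else 0 := by
  refine summable_of_hasFiniteSupport ((finite_weight_eq k n).subset fun v hv => ?_)
  by_contra h
  exact hv (if_neg h)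

lemma mass_nonneg {k : ℕ} {lam : ℝ} (h : 0 ≤ lam) (n : ℕ) : 0 ≤ mass k lam n :=
  tsum_nonneg fun v => by split_ifs <;> positivity

lemma mass_zero (k : ℕ) (lam : ℝ) : mass k lam 0 = 1 := by
  rw [mass, tsum_eq_single 0]
  · simp
  · intro v hv
    rw [if_neg]
    contrapose! hv
    rw [sum_eq_zero_iff] at hv
    ext i
    simpa using hv i (mem_univ i)

lemma tsum_coord_mul (k n : ℕ) (lam : ℝ) (i : Fin k) :
    (∑' v : Fin k → ℕ, if (∑ i : Fin k, ((i : ℕ) + 1) * v i) = n then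
      (v i : ℝ) * (lam ^ (∑ i : Fin k, v i) / ((∏ i : Fin k, Nat.factorial (v i) : ℕ) : ℝ))
      else 0) = if (i : ℕ) + 1 ≤ n then lam * mass k lam (n - (i + 1)) else 0 := by
  have hinj : Function.Injective fun v : Fin k → ℕ => v + Pi.single i 1 :=
    fun a b h => add_right_cancel h
  rw [← hinj.tsum_eq]
  · have hw : ∀ v : Fin k → ℕ, (∑ j : Fin k, ((j : ℕ) + 1) * (v + Pi.single i 1 : Fin k → ℕ) j) =
        (∑ j : Fin k, ((j : ℕ) + 1) * v j) + (i + 1) := by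
      intro v
      simp [mul_add, sum_add_distrib, Pi.single_apply]
    have hs : ∀ v : Fin k → ℕ, (∑ j : Fin k, (v + Pi.single i 1 : Fin k → ℕ) j) =
        (∑ j : Fin k, v j) + 1 := by
      intro v
      simp [sum_add_distrib, Pi.single_apply]
    have hp : ∀ v : Fin k → ℕ, (∏ j : Fin k, Nat.factorial ((v + Pi.single i 1 : Fin k → ℕ) j)) =
        (v i + 1) * ∏ j : Fin k, Nat.factorial (v j) := by
      intro v
      rw [← mul_prod_erase _ _ (mem_univ i), ← mul_prod_erase univ (fun j => (v j).factorial)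
        (mem_univ i), ← mul_assoc]
      congr 1
      · simp [Nat.factorial_succ]
      · refine prod_congr rfl fun j hj => ?_
        simp [Pi.single_eq_of_ne (ne_of_mem_erase hj)]
    split_ifs with hn
    · rw [mass, ← tsum_mul_left]
      refine tsum_congr fun v => ?_
      rw [hw, hs, hp]
      by_cases h : (∑ j : Fin k, ((j : ℕ) + 1) * v j) = n - (i + 1)
      · rw [if_pos (by omega), if_pos h]
        have : ((∏ j : Fin k, Nat.factorial (v j) : ℕ) : ℝ) ≠ 0 := by positivity
        push_cast at this ⊢
        simp only [Pi.add_apply, Pi.single_eq_same]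
        push_cast
        field_simp
        ring
      · rw [if_neg (by omega), if_neg h, mul_zero]
    · convert tsum_zero with v
      rw [hw, if_neg (by omega)]
  · intro v hv
    have hvi : v i ≠ 0 := by
      intro h
      simp [h] at hv
    refine ⟨v - Pi.single i 1, ?_⟩
    ext j
    by_cases hj : j = i
    · subst hj
      simp
      omega
    · simp [Pi.single_eq_of_ne hj]

lemma mass_rec (k : ℕ) (lam : ℝ) (n : ℕ) :
    (n : ℝ) * mass k lam n =
      lam * ∑ i ∈ range k, if i + 1 ≤ n then ((i : ℝ) + 1) * mass k lam (n - (i + 1)) else 0 := by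
  have h1 : (n : ℝ) * mass k lam n = ∑ i : Fin k, ((i : ℝ) + 1) *
      (∑' v : Fin k → ℕ, if (∑ i : Fin k, ((i : ℕ) + 1) * v i) = n then
      (v i : ℝ) * (lam ^ (∑ i : Fin k, v i) / ((∏ i : Fin k, Nat.factorial (v i) : ℕ) : ℝ))
      else 0) := by
    simp_rw [← tsum_mul_left]
    rw [mass, ← tsum_mul_left, ← Summable.tsum_finsetSum
      (fun i _ => (summable_weight k n _).mul_left _)]
    refine tsum_congr fun v => ?_
    split_ifs with h
    · rw [← h]
      push_cast
      rw [sum_mul]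
      refine sum_congr rfl fun i _ => ?_
      ring
    · simp
  rw [h1, ← Fin.sum_univ_eq_sum_range
    (fun i => if i + 1 ≤ n then ((i : ℝ) + 1) * mass k lam (n - (i + 1)) else 0), mul_sum]
  refine sum_congr rfl fun i _ => ?_
  rw [tsum_coord_mul]
  split_ifs <;> ring

lemma hasDerivAt_mass (k : ℕ) (lam : ℝ) (n : ℕ) :
    HasDerivAt (fun x => mass k x n)
      (∑ i ∈ range k, if i + 1 ≤ n then mass k lam (n - (i + 1)) else 0) lam := by
  induction n using Nat.strong_induction_on with
  | _ n ih =>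
  rcases Nat.eq_zero_or_pos n with rfl | hn
  · simp only [mass_zero]
    simpa using hasDerivAt_const lam (1 : ℝ)
  have hn' : (n : ℝ) ≠ 0 := by positivity
  have hfun : (fun x => mass k x n) = fun x => x * (∑ i ∈ range k,
      if i + 1 ≤ n then ((i : ℝ) + 1) * mass k x (n - (i + 1)) else 0) / n := by
    funext x
    rw [eq_div_iff hn', mul_comm, mass_rec]
  have hsum : HasDerivAt (fun x => ∑ i ∈ range k,
      if i + 1 ≤ n then ((i : ℝ) + 1) * mass k x (n - (i + 1)) else 0)
      (∑ i ∈ range k, if i + 1 ≤ n then ((i : ℝ) + 1) * (∑ j ∈ range k,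
        if j + 1 ≤ n - (i + 1) then mass k lam (n - (i + 1) - (j + 1)) else 0) else 0) lam := by
    refine HasDerivAt.fun_sum fun i _ => ?_
    split_ifs with h
    · exact (ih _ (by omega)).const_mul _
    · exact hasDerivAt_const _ _
  rw [hfun]
  refine (((hasDerivAt_id lam).fun_mul hsum).div_const (n : ℝ)).congr_deriv ?_
  symm
  rw [eq_div_iff hn', sum_mul]
  have hswap : (∑ i ∈ range k, if i + 1 ≤ n then ((i : ℝ) + 1) * (∑ j ∈ range k,
        if j + 1 ≤ n - (i + 1) then mass k lam (n - (i + 1) - (j + 1)) else 0) else 0) =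
      ∑ j ∈ range k, if j + 1 ≤ n then (∑ i ∈ range k,
        if i + 1 ≤ n - (j + 1) then
          ((i : ℝ) + 1) * mass k lam (n - (j + 1) - (i + 1)) else 0) else 0 := by
    have h1 : ∀ i j : ℕ, (if i + 1 ≤ n then (if j + 1 ≤ n - (i + 1) then
        ((i : ℝ) + 1) * mass k lam (n - (i + 1) - (j + 1)) else 0) else 0) =
        if j + 1 ≤ n then (if i + 1 ≤ n - (j + 1) then
          ((i : ℝ) + 1) * mass k lam (n - (j + 1) - (i + 1)) else 0) else 0 := by
      intro i j
      rw [show n - (i + 1) - (j + 1) = n - (j + 1) - (i + 1) by omega]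
      split_ifs <;> first | rfl | omega
    calc _ = ∑ i ∈ range k, ∑ j ∈ range k, (if i + 1 ≤ n then (if j + 1 ≤ n - (i + 1) then
        ((i : ℝ) + 1) * mass k lam (n - (i + 1) - (j + 1)) else 0) else 0) := by
          refine sum_congr rfl fun i _ => ?_
          split_ifs
          · rw [mul_sum]
            exact sum_congr rfl fun j _ => by split_ifs <;> simp
          · simp
      _ = _ := by
          rw [sum_comm]
          refine sum_congr rfl fun j _ => ?_
          simp_rw [h1]
          split_ifs <;> simp
  rw [hswap]
  simp only [id, one_mul]
  rw [mul_sum, ← sum_add_distrib]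
  refine sum_congr rfl fun i _ => ?_
  split_ifs with h
  · rw [← mass_rec, Nat.cast_sub h]
    push_cast
    ring
  · simp

lemma sum_range_shift (f : ℕ → ℝ) (c R : ℕ) :
    (∑ n ∈ range R, if c ≤ n then f (n - c) else 0) = ∑ n ∈ range (R - c), f n := by
  induction R with
  | zero => simp
  | succ R ih =>
    rw [sum_range_succ, ih]
    split_ifs with h
    · rw [Nat.succ_sub h, sum_range_succ]
    · rw [show R + 1 - c = 0 by omega, show R - c = 0 by omega, add_zero]

lemma antitoneOn_cdf (k R : ℕ) :
    AntitoneOn (fun x => ∑ j ∈ range R, poissonOrderKPmf k x j) (Set.Ici 0) := by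
  have hd : ∀ x : ℝ, HasDerivAt (fun x => ∑ j ∈ range R, poissonOrderKPmf k x j)
      (∑ j ∈ range R, (Real.exp (-(k * x)) * (-(k * 1)) * mass k x j + Real.exp (-(k * x)) *
        ∑ i ∈ range k, if i + 1 ≤ j then mass k x (j - (i + 1)) else 0)) x := fun x =>
    HasDerivAt.fun_sum fun j _ =>
      (((hasDerivAt_id x).const_mul (k : ℝ)).neg.exp).mul (hasDerivAt_mass k x j)
  refine antitoneOn_of_deriv_nonpos (convex_Ici 0)
    (fun x _ => (hd x).continuousAt.continuousWithinAt)
    (fun x _ => (hd x).differentiableAt.differentiableWithinAt) fun x hx => ?_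
  rw [interior_Ici] at hx
  have hx0 : (0 : ℝ) ≤ x := le_of_lt hx
  rw [(hd x).deriv, sum_add_distrib, ← mul_sum, ← mul_sum, sum_comm]
  have h1 : ∀ i ∈ range k, (∑ j ∈ range R, if i + 1 ≤ j then mass k x (j - (i + 1)) else 0) ≤
      ∑ j ∈ range R, mass k x j := fun i _ => by
    rw [sum_range_shift]
    exact sum_le_sum_of_subset_of_nonneg (range_subset_range.2 (Nat.sub_le _ _))
      fun _ _ _ => mass_nonneg hx0 _
  have h2 := sum_le_sum h1
  rw [sum_const, card_range, nsmul_eq_mul] at h2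
  nlinarith [Real.exp_pos (-(k * x))]

lemma continuous_cdf (k R : ℕ) :
    Continuous (fun x => ∑ j ∈ range R, poissonOrderKPmf k x j) := by
  refine continuous_finsetSum _ fun j _ => ?_
  simp_rw [pmf_eq]
  have : Continuous fun x => mass k x j :=
    continuous_iff_continuousAt.2 fun x => (hasDerivAt_mass k x j).continuousAt
  fun_prop

/-- `∑ cos (j t)` over `1 ≤ j ≤ k`. -/
noncomputable def cosSum (k : ℕ) (t : ℝ) : ℝ := ∑ j ∈ range k, Real.cos ((j + 1) * t)

/-- `∑ sin (j t)` over `1 ≤ j ≤ k`. -/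
noncomputable def sinSum (k : ℕ) (t : ℝ) : ℝ := ∑ j ∈ range k, Real.sin ((j + 1) * t)

/-- The generating function of `mass`. -/
noncomputable def genFun (k : ℕ) (lam : ℝ) (z : ℂ) : ℂ :=
  Complex.exp (lam * ∑ j ∈ range k, z ^ (j + 1))

@[fun_prop]
lemma continuous_cosSum (k : ℕ) : Continuous (cosSum k) := by
  unfold cosSum; fun_prop

@[fun_prop]
lemma continuous_sinSum (k : ℕ) : Continuous (sinSum k) := by
  unfold sinSum; fun_prop

lemma differentiable_genFun (k : ℕ) (lam : ℝ) : Differentiable ℂ (genFun k lam) := by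
  unfold genFun; fun_prop

lemma conj_genFun (k : ℕ) (lam : ℝ) (z : ℂ) :
    genFun k lam (starRingEnd ℂ z) = starRingEnd ℂ (genFun k lam z) := by
  simp [genFun, ← Complex.exp_conj]

lemma genFun_circleMap (k : ℕ) (lam t : ℝ) :
    genFun k lam (circleMap 0 1 t) = Real.exp (lam * cosSum k t) *
      (Real.cos (lam * sinSum k t) + Real.sin (lam * sinSum k t) * Complex.I) := by
  have h : (∑ j ∈ range k, (circleMap 0 1 t) ^ (j + 1)) =
      cosSum k t + sinSum k t * Complex.I := by
    simp only [cosSum, sinSum]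
    push_cast
    rw [sum_mul, ← sum_add_distrib]
    refine sum_congr rfl fun j _ => ?_
    rw [← Complex.exp_mul_I, circleMap_zero, Complex.ofReal_one, one_mul, ← Complex.exp_nat_mul]
    congr 1
    push_cast
    ring
  rw [genFun, h, mul_add, Complex.exp_add]
  push_cast
  rw [← Complex.exp_mul_I, mul_assoc]

lemma circleMap_pow (t : ℝ) (n : ℕ) : (circleMap 0 1 t) ^ n =
    Real.cos (n * t) + Real.sin (n * t) * Complex.I := by
  rw [circleMap_zero, Complex.ofReal_one, one_mul, ← Complex.exp_nat_mul]
  push_cast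
  rw [← Complex.exp_mul_I]
  congr 1
  ring

lemma circleMap_two_pi_sub (t : ℝ) :
    circleMap 0 1 (2 * Real.pi - t) = starRingEnd ℂ (circleMap 0 1 t) := by
  simp only [circleMap_zero, Complex.ofReal_one, one_mul, ← Complex.exp_conj, map_mul,
    Complex.conj_ofReal, Complex.conj_I]
  rw [← Complex.exp_periodic.sub_eq]
  congr 1
  push_cast
  ring

lemma integral_re_half_circle {G : ℂ → ℂ} (hd : Differentiable ℂ G)
    (hG : ∀ t ∈ Set.Ioo (0 : ℝ) Real.pi,
      G (starRingEnd ℂ (circleMap 0 1 t)) = starRingEnd ℂ (G (circleMap 0 1 t))) :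
    ∫ t in (0 : ℝ)..Real.pi, (G (circleMap 0 1 t)).re = Real.pi * (G 0).re := by
  have hc : Continuous fun t : ℝ => G (circleMap 0 1 t) :=
    hd.continuous.comp (continuous_circleMap 0 1)
  have hcr : Continuous fun t : ℝ => (G (circleMap 0 1 t)).re := Complex.continuous_re.comp hc
  have h1 := (hd.diffContOnCl (s := Metric.ball 0 |1|)).circleAverage
  rw [Real.circleAverage_def] at h1
  have h2 : ∫ t in (0 : ℝ)..2 * Real.pi, (G (circleMap 0 1 t)).re = 2 * Real.pi * (G 0).re := by
    have h3 := congrArg Complex.re h1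
    have h4 : ∫ t in (0 : ℝ)..2 * Real.pi, (G (circleMap 0 1 t)).re =
        (∫ t in (0 : ℝ)..2 * Real.pi, G (circleMap 0 1 t)).re := by
      have := Complex.reCLM.intervalIntegral_comp_comm
        (hc.intervalIntegrable (μ := MeasureTheory.volume) 0 (2 * Real.pi))
      simpa using this
    rw [h4, ← h3, Complex.real_smul, Complex.re_ofReal_mul]
    field_simp
  have h5 : ∫ t in Real.pi..2 * Real.pi, (G (circleMap 0 1 t)).re =
      ∫ t in (0 : ℝ)..Real.pi, (G (circleMap 0 1 t)).re := by
    have := intervalIntegral.integral_comp_sub_left (a := 0) (b := Real.pi)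
      (fun t => (G (circleMap 0 1 t)).re) (2 * Real.pi)
    rw [sub_zero, show 2 * Real.pi - Real.pi = Real.pi by ring] at this
    rw [← this]
    refine intervalIntegral.integral_congr_Ioo_of_le Real.pi_pos.le fun t ht => ?_
    simp only [circleMap_two_pi_sub]
    rw [hG t ht, Complex.conj_re]
  have h6 := intervalIntegral.integral_add_adjacent_intervals
    (hcr.intervalIntegrable (μ := MeasureTheory.volume) 0 Real.pi)
    (hcr.intervalIntegrable Real.pi (2 * Real.pi))
  linarith

lemma integral_cos_add (k : ℕ) (lam : ℝ) (n : ℕ) :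
    ∫ t in (0 : ℝ)..Real.pi, Real.exp (lam * cosSum k t) * Real.cos (n * t + lam * sinSum k t) =
      if n = 0 then Real.pi else 0 := by
  have h := integral_re_half_circle (G := fun z => genFun k lam z * z ^ n)
    ((differentiable_genFun k lam).mul (differentiable_id.pow n))
    (fun t _ => by simp [conj_genFun])
  have h0 : (genFun k lam 0 * 0 ^ n).re = if n = 0 then 1 else 0 := by
    split_ifs with hn
    · simp [genFun, hn]
    · simp [hn]
  rw [h0] at h
  rw [show (if n = 0 then Real.pi else 0) = Real.pi * (if n = 0 then 1 else 0) by simp, ← h]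
  refine intervalIntegral.integral_congr fun t _ => ?_
  rw [genFun_circleMap, circleMap_pow, Real.cos_add]
  simp only [Complex.mul_re, Complex.mul_im, Complex.add_re,
    Complex.add_im, Complex.ofReal_re, Complex.ofReal_im, Complex.I_re, Complex.I_im]
  ring

lemma integral_sin_half (k : ℕ) (lam : ℝ) :
    IntervalIntegrable (fun t => Real.exp (lam * cosSum k t) *
      Real.sin (t / 2 + lam * sinSum k t) / Real.sin (t / 2)) MeasureTheory.volume 0 Real.pi ∧
    ∫ t in (0 : ℝ)..Real.pi, Real.exp (lam * cosSum k t) *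
      Real.sin (t / 2 + lam * sinSum k t) / Real.sin (t / 2) = Real.pi * Real.exp (k * lam) := by
  have hd : Differentiable ℂ fun z => z * dslope (genFun k lam) 1 z := by
    have : DifferentiableOn ℂ (dslope (genFun k lam) 1) Set.univ :=
      (Complex.differentiableOn_dslope Filter.univ_mem).2
        (differentiable_genFun k lam).differentiableOn
    exact differentiable_id.mul (differentiableOn_univ.1 this)
  have hne : ∀ t ∈ Set.Ioo (0 : ℝ) Real.pi, circleMap 0 1 t ≠ 1 := by
    intro t ht h
    have := congrArg Complex.im h
    rw [← pow_one (circleMap 0 1 t), circleMap_pow] at this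
    simp at this
    exact (Real.sin_pos_of_mem_Ioo ht).ne' this
  have h := integral_re_half_circle hd (fun t ht => by
    have h1 := hne t ht
    have h2 : starRingEnd ℂ (circleMap 0 1 t) ≠ 1 := fun h => h1 (by
      simpa using congrArg (starRingEnd ℂ) h)
    have h3 : starRingEnd ℂ (genFun k lam 1) = genFun k lam 1 := by
      rw [← conj_genFun, map_one]
    simp [dslope_of_ne _ h1, dslope_of_ne _ h2, slope, conj_genFun, h3])
  have hc : Continuous fun t : ℝ => (circleMap 0 1 t * dslope (genFun k lam) 1 (circleMap 0 1 t)).re :=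
    Complex.continuous_re.comp (hd.continuous.comp (continuous_circleMap 0 1))
  have h1 : genFun k lam 1 = (Real.exp (k * lam) : ℝ) := by
    simp [genFun, mul_comm]
  have heq : Set.EqOn (fun t => Real.exp (k * lam) +
      2 * (circleMap 0 1 t * dslope (genFun k lam) 1 (circleMap 0 1 t)).re)
      (fun t => Real.exp (lam * cosSum k t) *
        Real.sin (t / 2 + lam * sinSum k t) / Real.sin (t / 2)) (Set.Ioo 0 Real.pi) := by
    intro t ht
    have hs : 0 < Real.sin (t / 2) :=
      Real.sin_pos_of_pos_of_lt_pi (by linarith [ht.1]) (by linarith [ht.2, ht.1])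
    simp only
    rw [eq_div_iff hs.ne', dslope_of_ne _ (hne t ht), slope_def_field, div_eq_mul_inv,
      h1, genFun_circleMap]
    have hz : circleMap 0 1 t = Real.cos t + Real.sin t * Complex.I := by
      simpa using circleMap_pow t 1
    have hc2 : Real.cos t = 1 - 2 * Real.sin (t / 2) ^ 2 := by
      have := Real.cos_sq_add_sin_sq (t / 2)
      have h2 := Real.cos_two_mul (t / 2)
      rw [show 2 * (t / 2) = t by ring] at h2
      linarith
    have hs2 : Real.sin t = 2 * Real.sin (t / 2) * Real.cos (t / 2) := by
      rw [← Real.sin_two_mul]; congr 1; ring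
    have key : circleMap 0 1 t * (circleMap 0 1 t - 1)⁻¹ =
        1 / 2 - (Real.cos (t / 2) / (2 * Real.sin (t / 2)) : ℝ) * Complex.I := by
      rw [mul_inv_eq_iff_eq_mul₀ (sub_ne_zero.2 (hne t ht)), hz, hc2, hs2]
      have hs' : (Real.sin (t / 2) : ℂ) ≠ 0 := by exact_mod_cast hs.ne'
      have hcs : (Real.cos (t / 2) : ℂ) ^ 2 = 1 - (Real.sin (t / 2) : ℂ) ^ 2 := by
        have := Real.cos_sq' (t / 2)
        exact_mod_cast this
      apply Complex.ext
      · simp only [Complex.mul_re, Complex.mul_im, Complex.add_re, Complex.sub_re, Complex.sub_im,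
          Complex.add_im, Complex.ofReal_re, Complex.ofReal_im, Complex.I_re, Complex.I_im,
          Complex.one_re, Complex.one_im, Complex.div_ofNat_re, Complex.div_ofNat_im]
        field_simp
        have := Real.cos_sq' (t / 2)
        nlinarith
      · simp only [Complex.mul_re, Complex.mul_im, Complex.add_re, Complex.sub_re, Complex.sub_im,
          Complex.add_im, Complex.ofReal_re, Complex.ofReal_im, Complex.I_re, Complex.I_im,
          Complex.one_re, Complex.one_im, Complex.div_ofNat_re, Complex.div_ofNat_im]
        field_simp
        ring
    rw [← mul_assoc, mul_right_comm (circleMap 0 1 t), key, Real.sin_add]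
    simp only [Complex.mul_re, Complex.mul_im, Complex.add_re, Complex.sub_re, Complex.sub_im,
          Complex.add_im, Complex.ofReal_re, Complex.ofReal_im, Complex.I_re, Complex.I_im,
          Complex.one_re, Complex.one_im, Complex.div_ofNat_re, Complex.div_ofNat_im]
    field_simp
    ring
  have hc' : Continuous fun t : ℝ => Real.exp (k * lam) +
      2 * (circleMap 0 1 t * dslope (genFun k lam) 1 (circleMap 0 1 t)).re := by fun_prop
  constructor
  · refine (hc'.intervalIntegrable 0 Real.pi).congr_uIoo ?_
    rwa [Set.uIoo_of_le Real.pi_pos.le]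
  · rw [← intervalIntegral.integral_congr_Ioo_of_le Real.pi_pos.le heq,
      intervalIntegral.integral_add (by simp) ((hc.intervalIntegrable _ _).const_mul 2),
      intervalIntegral.integral_const_mul, h]
    simp

lemma hasDerivAt_cosSum (k : ℕ) (t : ℝ) :
    HasDerivAt (cosSum k) (-∑ j ∈ range k, ((j : ℝ) + 1) * Real.sin ((j + 1) * t)) t := by
  unfold cosSum
  rw [← sum_neg_distrib]
  refine HasDerivAt.fun_sum fun j _ => ?_
  exact (((hasDerivAt_id t).const_mul ((j : ℝ) + 1)).cos).congr_deriv (by simp; ring)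

lemma hasDerivAt_sinSum (k : ℕ) (t : ℝ) :
    HasDerivAt (sinSum k) (∑ j ∈ range k, ((j : ℝ) + 1) * Real.cos ((j + 1) * t)) t := by
  unfold sinSum
  refine HasDerivAt.fun_sum fun j _ => ?_
  exact (((hasDerivAt_id t).const_mul ((j : ℝ) + 1)).sin).congr_deriv (by simp; ring)

lemma sinSum_pi (k : ℕ) : sinSum k Real.pi = 0 := by
  refine sum_eq_zero fun j _ => ?_
  exact_mod_cast Real.sin_nat_mul_pi (j + 1)

lemma sinSum_zero (k : ℕ) : sinSum k 0 = 0 := by simp [sinSum]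

/-- Fourier coefficients of the generating function, integrated over half a period. -/
noncomputable def halfCos (k : ℕ) (lam : ℝ) (m : ℤ) : ℝ :=
  ∫ t in (0 : ℝ)..Real.pi, Real.exp (lam * cosSum k t) * Real.cos (m * t - lam * sinSum k t)

lemma halfCos_rec (k : ℕ) (lam : ℝ) (m : ℤ) :
    m * halfCos k lam m = lam * ∑ j ∈ range k, ((j : ℝ) + 1) * halfCos k lam (m - (j + 1)) := by
  have hd : ∀ t : ℝ, HasDerivAt
      (fun t => Real.exp (lam * cosSum k t) * Real.sin (m * t - lam * sinSum k t))
      (m * (Real.exp (lam * cosSum k t) * Real.cos (m * t - lam * sinSum k t)) -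
        lam * ∑ j ∈ range k, ((j : ℝ) + 1) * (Real.exp (lam * cosSum k t) *
          Real.cos ((m - (j + 1) : ℤ) * t - lam * sinSum k t))) t := by
    intro t
    refine ((((hasDerivAt_cosSum k t).const_mul lam).exp).fun_mul
      ((((hasDerivAt_id t).const_mul (m : ℝ)).sub
        ((hasDerivAt_sinSum k t).const_mul lam)).sin)).congr_deriv ?_
    have h : ∀ j : ℕ, Real.cos ((m - (j + 1) : ℤ) * t - lam * sinSum k t) =
        Real.cos (m * t - lam * sinSum k t) * Real.cos ((j + 1) * t) +
        Real.sin (m * t - lam * sinSum k t) * Real.sin ((j + 1) * t) := by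
      intro j
      rw [← Real.cos_sub]
      push_cast
      congr 1
      ring
    simp_rw [h, mul_add, sum_add_distrib]
    simp only [id, Pi.sub_apply]
    have h1 : ∑ j ∈ range k, ((j : ℝ) + 1) * (Real.exp (lam * cosSum k t) *
        (Real.cos (m * t - lam * sinSum k t) * Real.cos ((j + 1) * t))) =
        Real.exp (lam * cosSum k t) * Real.cos (m * t - lam * sinSum k t) *
          ∑ j ∈ range k, ((j : ℝ) + 1) * Real.cos ((j + 1) * t) := by
      rw [mul_sum]; exact sum_congr rfl fun _ _ => by ring
    have h2 : ∑ j ∈ range k, ((j : ℝ) + 1) * (Real.exp (lam * cosSum k t) *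
        (Real.sin (m * t - lam * sinSum k t) * Real.sin ((j + 1) * t))) =
        Real.exp (lam * cosSum k t) * Real.sin (m * t - lam * sinSum k t) *
          ∑ j ∈ range k, ((j : ℝ) + 1) * Real.sin ((j + 1) * t) := by
      rw [mul_sum]; exact sum_congr rfl fun _ _ => by ring
    rw [h1, h2]
    ring
  have hc : ∀ m : ℤ, Continuous fun t => Real.exp (lam * cosSum k t) *
      Real.cos (m * t - lam * sinSum k t) := fun m => by fun_prop
  have hi := intervalIntegral.integral_eq_sub_of_hasDerivAt (a := 0) (b := Real.pi)
    (fun t _ => hd t) (Continuous.intervalIntegrable (by fun_prop) _ _)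
  rw [sinSum_pi, sinSum_zero, intervalIntegral.integral_sub
    (((hc m).const_mul _).intervalIntegrable _ _)
    (Continuous.intervalIntegrable (by fun_prop) _ _),
    intervalIntegral.integral_const_mul, intervalIntegral.integral_const_mul,
    intervalIntegral.integral_finsetSum
      (fun j _ => (((hc _).const_mul _).intervalIntegrable _ _))] at hi
  simp_rw [intervalIntegral.integral_const_mul] at hi
  simp only [mul_zero, sub_zero, Real.sin_zero, Real.sin_int_mul_pi] at hi
  unfold halfCos
  linarith

lemma halfCos_neg (k : ℕ) (lam : ℝ) (n : ℕ) :
    halfCos k lam (-n) = if n = 0 then Real.pi else 0 := by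
  rw [← integral_cos_add k lam n, halfCos]
  refine intervalIntegral.integral_congr fun t _ => ?_
  rw [← Real.cos_neg]
  push_cast
  congr 2
  ring

lemma halfCos_eq_mass (k : ℕ) (lam : ℝ) (n : ℕ) :
    halfCos k lam n = Real.pi * mass k lam n := by
  induction n using Nat.strong_induction_on with
  | _ n ih =>
  rcases Nat.eq_zero_or_pos n with rfl | hn
  · simpa [mass_zero] using halfCos_neg k lam 0
  have hn' : (n : ℝ) ≠ 0 := by positivity
  have h := halfCos_rec k lam n
  have h2 := mass_rec k lam n
  have h3 : ∀ j ∈ range k, ((j : ℝ) + 1) * halfCos k lam ((n : ℤ) - (j + 1)) = Real.pi *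
      (if j + 1 ≤ n then ((j : ℝ) + 1) * mass k lam (n - (j + 1)) else 0) := by
    intro j _
    split_ifs with hj
    · rw [show (n : ℤ) - (j + 1) = ((n - (j + 1) : ℕ) : ℤ) by omega, ih _ (by omega)]
      ring
    · rw [show (n : ℤ) - (j + 1) = -((j + 1 - n : ℕ) : ℤ) by omega, halfCos_neg,
        if_neg (by omega)]
      ring
  rw [sum_congr rfl h3, ← mul_sum] at h
  apply mul_left_cancel₀ hn'
  push_cast at h
  rw [h, mul_left_comm, ← h2]
  ring

lemma integral_sin_div (k : ℕ) (lam : ℝ) (R : ℕ) :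
    IntervalIntegrable (fun t => Real.exp (lam * cosSum k t) *
      Real.sin ((R - 1 / 2) * t - lam * sinSum k t) / Real.sin (t / 2))
      MeasureTheory.volume 0 Real.pi ∧
    ∫ t in (0 : ℝ)..Real.pi, Real.exp (lam * cosSum k t) *
      Real.sin ((R - 1 / 2) * t - lam * sinSum k t) / Real.sin (t / 2) =
      2 * Real.pi * ∑ j ∈ range R, mass k lam j - Real.pi * Real.exp (k * lam) := by
  induction R with
  | zero =>
    have h := integral_sin_half k lam
    have heq : (fun t => Real.exp (lam * cosSum k t) *
        Real.sin (((0 : ℕ) - 1 / 2) * t - lam * sinSum k t) / Real.sin (t / 2)) =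
        fun t => -(Real.exp (lam * cosSum k t) *
          Real.sin (t / 2 + lam * sinSum k t) / Real.sin (t / 2)) := by
      funext t
      rw [← neg_div, ← mul_neg, ← Real.sin_neg]
      push_cast
      congr 3
      ring
    rw [heq, intervalIntegral.integral_neg, h.2]
    exact ⟨h.1.neg, by simp⟩
  | succ R ih =>
    have hc : Continuous fun t => 2 * (Real.exp (lam * cosSum k t) *
      Real.cos ((R : ℤ) * t - lam * sinSum k t)) := by fun_prop
    have heq : Set.EqOn (fun t => Real.exp (lam * cosSum k t) *
        Real.sin ((R - 1 / 2) * t - lam * sinSum k t) / Real.sin (t / 2) +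
        2 * (Real.exp (lam * cosSum k t) * Real.cos ((R : ℤ) * t - lam * sinSum k t)))
        (fun t => Real.exp (lam * cosSum k t) *
          Real.sin (((R + 1 : ℕ) - 1 / 2) * t - lam * sinSum k t) / Real.sin (t / 2))
        (Set.Ioo 0 Real.pi) := by
      intro t ht
      have hs : 0 < Real.sin (t / 2) :=
        Real.sin_pos_of_pos_of_lt_pi (by linarith [ht.1]) (by linarith [ht.2, ht.1])
      simp only
      rw [show (((R + 1 : ℕ) : ℝ) - 1 / 2) * t - lam * sinSum k t =
          (R * t - lam * sinSum k t) + t / 2 by push_cast; ring,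
        show ((R : ℝ) - 1 / 2) * t - lam * sinSum k t =
          (R * t - lam * sinSum k t) - t / 2 by ring, Real.sin_add, Real.sin_sub]
      push_cast
      field_simp
      ring
    have hi := ih.1.add (hc.intervalIntegrable 0 Real.pi)
    constructor
    · refine hi.congr_uIoo ?_
      rwa [Set.uIoo_of_le Real.pi_pos.le]
    · rw [← intervalIntegral.integral_congr_Ioo_of_le Real.pi_pos.le heq,
        intervalIntegral.integral_add ih.1 (hc.intervalIntegrable _ _), ih.2,
        intervalIntegral.integral_const_mul, ← halfCos, halfCos_eq_mass, sum_range_succ]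
      ring

/-- `∑ (1 - cos (j t))` over `1 ≤ j ≤ k`. -/
noncomputable def cosDef (k : ℕ) (t : ℝ) : ℝ := ∑ j ∈ range k, (1 - Real.cos ((j + 1) * t))

/-- `∑ (j t - sin (j t))` over `1 ≤ j ≤ k`. -/
noncomputable def sinDef (k : ℕ) (t : ℝ) : ℝ :=
  ∑ j ∈ range k, ((j + 1) * t - Real.sin ((j + 1) * t))

/-- The integrand representing the deviation of the distribution function from `1 / 2`. -/
noncomputable def devFun (k : ℕ) (d lam t : ℝ) : ℝ :=
  Real.exp (-lam * cosDef k t) * Real.sin (lam * sinDef k t - d * t) / Real.sin (t / 2)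

lemma cosDef_eq (k : ℕ) (t : ℝ) : cosDef k t = k - cosSum k t := by
  simp [cosDef, cosSum]

lemma sinDef_eq (k : ℕ) (t : ℝ) : sinDef k t = k * (k + 1) / 2 * t - sinSum k t := by
  have h : ∑ j ∈ range k, ((j : ℝ) + 1) = k * (k + 1) / 2 := by
    induction k with
    | zero => simp
    | succ k ih => rw [sum_range_succ, ih]; push_cast; ring
  rw [sinDef, sum_sub_distrib, ← sum_mul, h, sinSum]

lemma cdf_sub_half {k R : ℕ} {lam d : ℝ} (h : (R : ℝ) - 1 / 2 = k * (k + 1) / 2 * lam - d) :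
    IntervalIntegrable (devFun k d lam) MeasureTheory.volume 0 Real.pi ∧
    ∑ j ∈ range R, poissonOrderKPmf k lam j - 1 / 2 =
      (∫ t in (0 : ℝ)..Real.pi, devFun k d lam t) / (2 * Real.pi) := by
  have heq : devFun k d lam = fun t => Real.exp (-(k * lam)) * (Real.exp (lam * cosSum k t) *
      Real.sin ((R - 1 / 2) * t - lam * sinSum k t) / Real.sin (t / 2)) := by
    funext t
    rw [devFun, cosDef_eq, sinDef_eq, h, ← mul_div_assoc, ← mul_assoc, ← Real.exp_add]
    congr 3
    · ring
    · ring
  obtain ⟨h1, h2⟩ := integral_sin_div k lam R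
  rw [heq]
  refine ⟨h1.const_mul _, ?_⟩
  rw [intervalIntegral.integral_const_mul, h2]
  simp_rw [pmf_eq]
  rw [← mul_sum, mul_sub, mul_left_comm _ Real.pi, ← Real.exp_add, neg_add_cancel, Real.exp_zero]
  have := Real.pi_pos.ne'
  field_simp

lemma norm_exp_sub_sum_le (n : ℕ) {u : ℝ} (hu : 0 ≤ u) :
    ‖Complex.exp (u * Complex.I) - ∑ m ∈ range n, (u * Complex.I) ^ m / (m.factorial : ℂ)‖ ≤
      u ^ n / n.factorial := by
  induction n generalizing u with
  | zero => simp [Complex.norm_exp_ofReal_mul_I]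
  | succ n ih =>
    have hd : ∀ x : ℝ, HasDerivAt (fun x : ℝ => Complex.exp (x * Complex.I) -
        ∑ m ∈ range (n + 1), (x * Complex.I) ^ m / (m.factorial : ℂ))
        (Complex.I * (Complex.exp (x * Complex.I) -
          ∑ m ∈ range n, (x * Complex.I) ^ m / (m.factorial : ℂ))) x := by
      intro x
      have h0 : HasDerivAt (fun x : ℝ => (x : ℂ) * Complex.I) Complex.I x := by
        simpa using (Complex.ofRealCLM.hasDerivAt (x := x)).mul_const Complex.I
      have h1 : ∀ m ∈ range (n + 1), HasDerivAt
          (fun x : ℝ => (x * Complex.I) ^ m / (m.factorial : ℂ))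
          (m * (x * Complex.I) ^ (m - 1) * Complex.I / (m.factorial : ℂ)) x :=
        fun m _ => (h0.fun_pow m).div_const _
      refine ((h0.cexp).fun_sub (HasDerivAt.fun_sum h1)).congr_deriv ?_
      rw [sum_range_succ']
      simp only [Nat.cast_zero, zero_mul, zero_div, add_zero, Nat.add_sub_cancel]
      rw [mul_sub, mul_comm, mul_sum]
      congr 1
      refine sum_congr rfl fun m _ => ?_
      rw [Nat.factorial_succ]
      have : (m.factorial : ℂ) ≠ 0 := by exact_mod_cast m.factorial_ne_zero
      have : (m : ℂ) + 1 ≠ 0 := by exact_mod_cast m.succ_ne_zero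
      push_cast
      field_simp
    have hB : ∀ x : ℝ, HasDerivAt (fun x : ℝ => x ^ (n + 1) / (n + 1).factorial)
        (x ^ n / n.factorial) x := by
      intro x
      refine ((hasDerivAt_pow (n + 1) x).div_const _).congr_deriv ?_
      rw [Nat.factorial_succ]
      have : (n.factorial : ℝ) ≠ 0 := by exact_mod_cast n.factorial_ne_zero
      push_cast
      field_simp
    refine image_norm_le_of_norm_deriv_right_le_deriv_boundary (a := 0) (b := u)
      (fun x _ => (hd x).continuousAt.continuousWithinAt)
      (fun x _ => (hd x).hasDerivWithinAt) ?_ hB (fun x hx => ?_) ⟨hu, le_rfl⟩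
    · rw [sum_range_succ']
      simp
    · rw [norm_mul, Complex.norm_I, one_mul]
      exact ih hx.1

lemma sub_sin_nonneg {u : ℝ} (hu : 0 ≤ u) : 0 ≤ u - Real.sin u := by
  linarith [Real.sin_le hu]

lemma sub_sin_le {u : ℝ} (hu : 0 ≤ u) : u - Real.sin u ≤ u ^ 3 / 6 := by
  linarith [Real.sin_ge_sub_cube hu]

lemma one_sub_cos_le (u : ℝ) : 1 - Real.cos u ≤ u ^ 2 / 2 := by
  linarith [Real.one_sub_sq_div_two_le_cos (x := u)]

lemma le_one_sub_cos {u : ℝ} (hu : 0 ≤ u) : u ^ 2 / 2 - u ^ 4 / 24 ≤ 1 - Real.cos u := by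
  have h := (Complex.abs_re_le_norm _).trans (norm_exp_sub_sum_le 4 hu)
  rw [abs_le] at h
  have h2 : (Complex.exp (u * Complex.I) -
      ∑ m ∈ range 4, (u * Complex.I) ^ m / (m.factorial : ℂ)).re =
      Real.cos u - (1 - u ^ 2 / 2) := by
    simp [sum_range_succ, Complex.exp_ofReal_mul_I_re, pow_succ, Nat.factorial]
    ring
  rw [h2] at h
  simp [Nat.factorial] at h
  linarith [h.2]

lemma le_sub_sin {u : ℝ} (hu : 0 ≤ u) : u ^ 3 / 6 - u ^ 5 / 120 ≤ u - Real.sin u := by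
  have h := (Complex.abs_im_le_norm _).trans (norm_exp_sub_sum_le 5 hu)
  rw [abs_le] at h
  have h2 : (Complex.exp (u * Complex.I) -
      ∑ m ∈ range 5, (u * Complex.I) ^ m / (m.factorial : ℂ)).im =
      Real.sin u - (u - u ^ 3 / 6) := by
    simp [sum_range_succ, Complex.exp_ofReal_mul_I_im, pow_succ, Nat.factorial]
    ring
  rw [h2] at h
  simp [Nat.factorial] at h
  linarith [h.2]

/-- The power sum `∑ j ^ m` over `1 ≤ j ≤ k`. -/
noncomputable def powSum (k m : ℕ) : ℝ := ∑ j ∈ range k, ((j : ℝ) + 1) ^ m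

lemma powSum_one (k : ℕ) : powSum k 1 = k * (k + 1) / 2 := by
  unfold powSum
  induction k with
  | zero => simp
  | succ k ih => rw [sum_range_succ, ih]; push_cast; ring

lemma powSum_two (k : ℕ) : powSum k 2 = k * (k + 1) * (2 * k + 1) / 6 := by
  unfold powSum
  induction k with
  | zero => simp
  | succ k ih => rw [sum_range_succ, ih]; push_cast; ring

lemma powSum_three (k : ℕ) : powSum k 3 = (k * (k + 1)) ^ 2 / 4 := by
  unfold powSum
  induction k with
  | zero => simp
  | succ k ih => rw [sum_range_succ, ih]; push_cast; ring

lemma powSum_four (k : ℕ) :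
    powSum k 4 = k * (k + 1) * (2 * k + 1) * (3 * (k * (k + 1)) - 1) / 30 := by
  unfold powSum
  induction k with
  | zero => simp
  | succ k ih => rw [sum_range_succ, ih]; push_cast; ring

lemma powSum_five (k : ℕ) :
    powSum k 5 = (k * (k + 1)) ^ 2 * (2 * (k * (k + 1)) - 1) / 12 := by
  unfold powSum
  induction k with
  | zero => simp
  | succ k ih => rw [sum_range_succ, ih]; push_cast; ring

lemma powSum_six (k : ℕ) : powSum k 6 =
    k * (k + 1) * (2 * k + 1) * (3 * (k * (k + 1)) ^ 2 - 3 * (k * (k + 1)) + 1) / 42 := by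
  unfold powSum
  induction k with
  | zero => simp
  | succ k ih => rw [sum_range_succ, ih]; push_cast; ring

lemma powSum_seven (k : ℕ) : powSum k 7 =
    (k * (k + 1)) ^ 2 * (3 * (k * (k + 1)) ^ 2 - 4 * (k * (k + 1)) + 2) / 24 := by
  unfold powSum
  induction k with
  | zero => simp
  | succ k ih => rw [sum_range_succ, ih]; push_cast; ring

lemma powSum_eight_le (k : ℕ) : powSum k 8 ≤ (((2 * k + 1) / 2 : ℝ)) ^ 9 / 9 := by
  unfold powSum
  induction k with
  | zero => norm_num
  | succ k ih =>
    rw [sum_range_succ]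
    push_cast
    have hk : (0 : ℝ) ≤ k := Nat.cast_nonneg k
    have h : ((2 * ((k : ℝ) + 1) + 1) / 2) ^ 9 / 9 - ((2 * (k : ℝ) + 1) / 2) ^ 9 / 9 -
        ((k : ℝ) + 1) ^ 8 = 7 / 3 * (k + 1) ^ 6 + 7 / 8 * (k + 1) ^ 4 + 1 / 16 * (k + 1) ^ 2
          + 1 / 2304 := by ring
    have : (0 : ℝ) ≤ 7 / 3 * ((k : ℝ) + 1) ^ 6 + 7 / 8 * (k + 1) ^ 4 + 1 / 16 * (k + 1) ^ 2
          + 1 / 2304 := by positivity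
    linarith

lemma cosDef_nonneg (k : ℕ) (t : ℝ) : 0 ≤ cosDef k t :=
  sum_nonneg fun j _ => by linarith [Real.cos_le_one (((j : ℝ) + 1) * t)]

lemma cosDef_le (k : ℕ) (t : ℝ) : cosDef k t ≤ powSum k 2 / 2 * t ^ 2 := by
  rw [cosDef, powSum, sum_div, sum_mul]
  exact sum_le_sum fun j _ => (one_sub_cos_le _).trans_eq (by ring)

lemma le_cosDef (k : ℕ) {t : ℝ} (ht : 0 ≤ t) :
    powSum k 2 / 2 * t ^ 2 - powSum k 4 / 24 * t ^ 4 ≤ cosDef k t := by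
  rw [cosDef, powSum, powSum, sum_div, sum_mul, sum_div, sum_mul, ← sum_sub_distrib]
  exact sum_le_sum fun j _ => le_trans (by ring_nf; rfl)
    (le_one_sub_cos (u := (j + 1) * t) (by positivity))

lemma sinDef_nonneg (k : ℕ) {t : ℝ} (ht : 0 ≤ t) : 0 ≤ sinDef k t :=
  sum_nonneg fun _ _ => sub_sin_nonneg (by positivity)

lemma sinDef_le (k : ℕ) {t : ℝ} (ht : 0 ≤ t) : sinDef k t ≤ powSum k 3 / 6 * t ^ 3 := by
  rw [sinDef, powSum, sum_div, sum_mul]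
  exact sum_le_sum fun j _ => (sub_sin_le (by positivity)).trans_eq (by ring)

lemma le_sinDef (k : ℕ) {t : ℝ} (ht : 0 ≤ t) :
    powSum k 3 / 6 * t ^ 3 - powSum k 5 / 120 * t ^ 5 ≤ sinDef k t := by
  rw [sinDef, powSum, powSum, sum_div, sum_mul, sum_div, sum_mul, ← sum_sub_distrib]
  exact sum_le_sum fun j _ => le_trans (by ring_nf; rfl)
    (le_sub_sin (u := (j + 1) * t) (by positivity))

lemma quadratic_le_cosDef {k : ℕ} (hk : 1 ≤ k) {t : ℝ} (h0 : 0 ≤ t) (h1 : t ≤ Real.pi) :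
    2 / Real.pi ^ 2 * t ^ 2 ≤ cosDef k t := by
  have h := Real.cos_le_one_sub_mul_cos_sq (x := t) (by rwa [abs_of_nonneg h0])
  have h2 := single_le_sum (f := fun j : ℕ => 1 - Real.cos ((j + 1) * t))
    (fun j _ => by linarith [Real.cos_le_one (((j : ℝ) + 1) * t)]) (mem_range.2 hk)
  simp only [Nat.cast_zero, zero_add, one_mul] at h2
  unfold cosDef
  linarith

@[fun_prop]
lemma continuous_cosDef (k : ℕ) : Continuous (cosDef k) := by
  unfold cosDef; fun_prop

@[fun_prop]
lemma continuous_sinDef (k : ℕ) : Continuous (sinDef k) := by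
  unfold sinDef; fun_prop

lemma measurable_devFun (k : ℕ) (d lam : ℝ) : Measurable (devFun k d lam) := by
  unfold devFun
  have h1 := (continuous_cosDef k).measurable
  have h2 := (continuous_sinDef k).measurable
  fun_prop

lemma div_pi_le_sin_half {t : ℝ} (h0 : 0 ≤ t) (h1 : t ≤ Real.pi) : t / Real.pi ≤ Real.sin (t / 2) := by
  have h := Real.mul_le_sin (x := t / 2) (by linarith) (by linarith)
  refine le_trans (le_of_eq ?_) h
  field_simp

lemma abs_devFun_le {k : ℕ} (hk : 1 ≤ k) (d : ℝ) {lam t : ℝ} (hl : 0 ≤ lam) (h0 : 0 < t)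
    (h1 : t ≤ Real.pi) :
    |devFun k d lam t| ≤ Real.exp (-(2 / Real.pi ^ 2) * (lam * t ^ 2)) *
      (Real.pi * (powSum k 3 / 6 * (lam * t ^ 2) + |d|)) := by
  have hs := div_pi_le_sin_half h0.le h1
  have hpos : 0 < t / Real.pi := div_pos h0 Real.pi_pos
  rw [devFun, mul_div_assoc, abs_mul, Real.abs_exp]
  refine mul_le_mul (Real.exp_le_exp.2 ?_) ?_ (abs_nonneg _) (Real.exp_pos _).le
  · nlinarith [mul_le_mul_of_nonneg_left (quadratic_le_cosDef hk h0.le h1) hl]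
  · rw [abs_div, abs_of_pos (hpos.trans_le hs), div_le_iff₀ (hpos.trans_le hs)]
    have hB := sinDef_le k h0.le
    have hB0 := sinDef_nonneg k h0.le
    have h2 : |Real.sin (lam * sinDef k t - d * t)| ≤
        (powSum k 3 / 6 * (lam * t ^ 2) + |d|) * t := by
      refine Real.abs_sin_le_abs.trans ((abs_sub _ _).trans ?_)
      rw [abs_mul, abs_mul, abs_of_nonneg hl, abs_of_nonneg hB0, abs_of_pos h0]
      nlinarith [mul_le_mul_of_nonneg_left hB hl]
    refine h2.trans ?_
    have h3 : 0 ≤ powSum k 3 / 6 * (lam * t ^ 2) + |d| := by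
      have : 0 ≤ powSum k 3 := sum_nonneg fun _ _ => by positivity
      positivity
    calc _ = Real.pi * (powSum k 3 / 6 * (lam * t ^ 2) + |d|) * (t / Real.pi) := by
          field_simp
      _ ≤ _ := by gcongr

/-- Rescaling limit of the deviation integrand. -/
lemma tendsto_devFun_div_sqrt (k : ℕ) (d : ℝ) {y : ℝ} (hy : 0 < y) :
    Tendsto (fun r : ℝ => devFun k d (r ^ 2) (y / r)) atTop
      (𝓝 (Real.exp (-(powSum k 2 / 2) * y ^ 2) * (powSum k 3 / 3 * y ^ 2 - 2 * d))) := by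
  have hinv : Tendsto (fun r : ℝ => r⁻¹) atTop (𝓝 0) := tendsto_inv_atTop_zero
  have hA : Tendsto (fun r : ℝ => r ^ 2 * cosDef k (y / r)) atTop (𝓝 (powSum k 2 / 2 * y ^ 2)) := by
    have hlow : Tendsto (fun r : ℝ => powSum k 2 / 2 * y ^ 2 - powSum k 4 / 24 * y ^ 4 * r⁻¹ ^ 2)
        atTop (𝓝 (powSum k 2 / 2 * y ^ 2)) := by
      simpa using ((hinv.pow 2).const_mul (powSum k 4 / 24 * y ^ 4)).const_sub
        (powSum k 2 / 2 * y ^ 2)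
    refine tendsto_of_tendsto_of_tendsto_of_le_of_le' hlow tendsto_const_nhds ?_ ?_
    · filter_upwards [eventually_gt_atTop 0] with r hr
      refine le_trans (le_of_eq ?_) (mul_le_mul_of_nonneg_left
        (le_cosDef k (t := y / r) (by positivity)) (sq_nonneg r))
      field_simp
    · filter_upwards [eventually_gt_atTop 0] with r hr
      refine (mul_le_mul_of_nonneg_left (cosDef_le k (y / r)) (sq_nonneg r)).trans_eq ?_
      field_simp
  have hB : Tendsto (fun r : ℝ => r ^ 3 * sinDef k (y / r)) atTop (𝓝 (powSum k 3 / 6 * y ^ 3)) := by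
    have hlow : Tendsto (fun r : ℝ => powSum k 3 / 6 * y ^ 3 - powSum k 5 / 120 * y ^ 5 * r⁻¹ ^ 2)
        atTop (𝓝 (powSum k 3 / 6 * y ^ 3)) := by
      simpa using ((hinv.pow 2).const_mul (powSum k 5 / 120 * y ^ 5)).const_sub
        (powSum k 3 / 6 * y ^ 3)
    refine tendsto_of_tendsto_of_tendsto_of_le_of_le' hlow tendsto_const_nhds ?_ ?_
    · filter_upwards [eventually_gt_atTop 0] with r hr
      refine le_trans (le_of_eq ?_) (mul_le_mul_of_nonneg_left
        (le_sinDef k (t := y / r) (by positivity)) (pow_nonneg hr.le 3))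
      field_simp
    · filter_upwards [eventually_gt_atTop 0] with r hr
      refine (mul_le_mul_of_nonneg_left (sinDef_le k (t := y / r) (by positivity))
        (pow_nonneg hr.le 3)).trans_eq ?_
      field_simp
  have hsinc : ∀ {f : ℝ → ℝ}, Tendsto f atTop (𝓝 0) →
      Tendsto (fun r => Real.sinc (f r)) atTop (𝓝 1) := fun hf => by
    simpa [Function.comp_def] using (Real.continuous_sinc.tendsto 0).comp hf
  have hth : Tendsto (fun r : ℝ => r⁻¹ * (r ^ 3 * sinDef k (y / r) - d * y)) atTop (𝓝 0) := by
    simpa using hinv.mul (hB.sub_const (d * y))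
  have hy2 : Tendsto (fun r : ℝ => r⁻¹ * (y / 2)) atTop (𝓝 0) := by
    simpa using hinv.mul_const (y / 2)
  have hmain := (hA.neg.rexp).mul (((hB.sub_const (d * y)).mul (hsinc hth)).div
    ((tendsto_const_nhds (x := y / 2)).mul (hsinc hy2)) (by simp [hy.ne']))
  have hval : Real.exp (-(powSum k 2 / 2 * y ^ 2)) *
      (((powSum k 3 / 6 * y ^ 3 - d * y) * 1) / (y / 2 * 1)) =
      Real.exp (-(powSum k 2 / 2) * y ^ 2) * (powSum k 3 / 3 * y ^ 2 - 2 * d) := by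
    rw [neg_mul]
    congr 1
    field_simp
    ring
  rw [hval] at hmain
  refine hmain.congr' ?_
  have hsx : ∀ x : ℝ, x * Real.sinc x = Real.sin x := fun x => by
    rcases eq_or_ne x 0 with rfl | hx
    · simp
    · rw [Real.sinc_of_ne_zero hx]; field_simp
  filter_upwards [eventually_gt_atTop 0] with r hr
  have e1 : (r ^ 3 * sinDef k (y / r) - d * y) *
      Real.sinc (r⁻¹ * (r ^ 3 * sinDef k (y / r) - d * y)) =
      r * Real.sin (r ^ 2 * sinDef k (y / r) - d * (y / r)) := by
    rw [show r ^ 2 * sinDef k (y / r) - d * (y / r) =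
      r⁻¹ * (r ^ 3 * sinDef k (y / r) - d * y) by field_simp, ← hsx]
    field_simp
  have e2 : y / 2 * Real.sinc (r⁻¹ * (y / 2)) = r * Real.sin (y / r / 2) := by
    rw [show y / r / 2 = r⁻¹ * (y / 2) by field_simp, ← hsx]
    field_simp
  simp only [Pi.div_apply]
  rw [e1, e2, devFun, mul_div_mul_left _ _ hr.ne', neg_mul, mul_div_assoc]

lemma integral_exp_mul_sub {b : ℝ} (hb : 0 < b) (c d : ℝ) :
    ∫ y in Set.Ioi (0 : ℝ), Real.exp (-b * y ^ 2) * (c * (2 * b) * y ^ 2 - 2 * d) =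
      (c - 2 * d) * (Real.sqrt (Real.pi / b) / 2) := by
  have h1 : Integrable (fun y : ℝ => Real.exp (-b * y ^ 2)) := integrable_exp_neg_mul_sq hb
  have h2 : Integrable (fun y : ℝ => y ^ 2 * Real.exp (-b * y ^ 2)) := by
    have := integrable_rpow_mul_exp_neg_mul_sq hb (s := 2) (by norm_num)
    simpa using this
  have hd : ∀ y : ℝ, HasDerivAt (fun y : ℝ => y * Real.exp (-b * y ^ 2))
      (Real.exp (-b * y ^ 2) - 2 * b * (y ^ 2 * Real.exp (-b * y ^ 2))) y := by
    intro y
    refine ((hasDerivAt_id y).fun_mul (((hasDerivAt_pow 2 y).const_mul (-b)).exp)).congr_deriv ?_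
    simp
    ring
  have h3 := integral_Ioi_of_hasDerivAt_of_tendsto' (a := 0) (m := 0) (fun y _ => hd y)
    (h1.sub (h2.const_mul (2 * b))).integrableOn ?_
  · rw [integral_sub h1.integrableOn (h2.const_mul (2 * b)).integrableOn,
      integral_const_mul] at h3
    have h4 : (fun y : ℝ => Real.exp (-b * y ^ 2) * (c * (2 * b) * y ^ 2 - 2 * d)) =
        fun y => (c * (2 * b)) * (y ^ 2 * Real.exp (-b * y ^ 2)) -
          2 * d * Real.exp (-b * y ^ 2) := by
      funext y; ring
    rw [h4, integral_sub (h2.const_mul _).integrableOn (h1.const_mul _).integrableOn,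
      integral_const_mul, integral_const_mul]
    rw [integral_gaussian_Ioi] at h3 ⊢
    linear_combination (-c) * h3
  · have := (tendsto_rpow_abs_mul_exp_neg_mul_sq_cocompact hb 1).mono_left
      atTop_le_cocompact
    refine this.congr' ?_
    filter_upwards [eventually_gt_atTop 0] with y hy
    simp [abs_of_pos hy]

lemma tendsto_integral_devFun {k : ℕ} (hk : 1 ≤ k) (d : ℝ) :
    Tendsto (fun r : ℝ => r * ∫ t in (0 : ℝ)..Real.pi, devFun k d (r ^ 2) t) atTop
      (𝓝 ((k * (k + 1) / (2 * (2 * k + 1)) - 2 * d) *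
        (Real.sqrt (Real.pi / (powSum k 2 / 2)) / 2))) := by
  have hk0 : (1 : ℝ) ≤ k := by exact_mod_cast hk
  have hb : 0 < powSum k 2 / 2 := by rw [powSum_two]; positivity
  rw [← integral_exp_mul_sub hb]
  have hc : (k * (k + 1) / (2 * (2 * k + 1)) : ℝ) * (2 * (powSum k 2 / 2)) = powSum k 3 / 3 := by
    rw [powSum_two, powSum_three]; field_simp; ring
  rw [hc]
  have h1 : ∀ r : ℝ, 0 < r → ∫ y in Set.Ioi (0 : ℝ),
      (Set.Ioc 0 (Real.pi * r)).indicator (fun y => devFun k d (r ^ 2) (y / r)) y =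
      r * ∫ t in (0 : ℝ)..Real.pi, devFun k d (r ^ 2) t := by
    intro r hr
    rw [setIntegral_indicator measurableSet_Ioc, Set.inter_eq_right.2 Set.Ioc_subset_Ioi_self,
      ← intervalIntegral.integral_of_le (by positivity),
      intervalIntegral.integral_comp_div _ hr.ne', zero_div, mul_div_cancel_right₀ _ hr.ne',
      smul_eq_mul]
  refine Tendsto.congr' (f₁ := fun r : ℝ => ∫ y in Set.Ioi (0 : ℝ),
      (Set.Ioc 0 (Real.pi * r)).indicator (fun y => devFun k d (r ^ 2) (y / r)) y) ?_ ?_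
  · filter_upwards [eventually_gt_atTop 0] with r hr using h1 r hr
  have hS3 : 0 ≤ powSum k 3 := sum_nonneg fun _ _ => by positivity
  have hb2 : 0 < 2 / Real.pi ^ 2 := by have := Real.pi_pos; positivity
  refine tendsto_integral_filter_of_dominated_convergence
    (fun y => Real.exp (-(2 / Real.pi ^ 2) * y ^ 2) *
      (Real.pi * (powSum k 3 / 6 * y ^ 2 + |d|))) ?_ ?_ ?_ ?_
  · exact Eventually.of_forall fun r => (((measurable_devFun k d (r ^ 2)).comp
      (measurable_id.div_const r)).indicator measurableSet_Ioc).aestronglyMeasurable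
  · filter_upwards [eventually_gt_atTop 0] with r hr
    refine Eventually.of_forall fun y => ?_
    by_cases hy : y ∈ Set.Ioc 0 (Real.pi * r)
    · rw [Set.indicator_of_mem hy, Real.norm_eq_abs]
      have := abs_devFun_le hk d (sq_nonneg r) (div_pos hy.1 hr) ((div_le_iff₀ hr).2 hy.2)
      rwa [div_pow, mul_div_cancel₀ _ (by positivity : r ^ 2 ≠ 0)] at this
    · rw [Set.indicator_of_notMem hy, norm_zero]
      have := Real.pi_pos
      positivity
  · have h1 : Integrable (fun y : ℝ => Real.exp (-(2 / Real.pi ^ 2) * y ^ 2)) :=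
      integrable_exp_neg_mul_sq hb2
    have h2 : Integrable (fun y : ℝ => y ^ 2 * Real.exp (-(2 / Real.pi ^ 2) * y ^ 2)) := by
      have := integrable_rpow_mul_exp_neg_mul_sq hb2 (s := 2) (by norm_num)
      simpa using this
    have h3 := (h2.const_mul (Real.pi * (powSum k 3 / 6))).add (h1.const_mul (Real.pi * |d|))
    refine (h3.congr (Eventually.of_forall fun y => ?_)).integrableOn
    simp only [Pi.add_apply]
    ring
  · refine (ae_restrict_iff' measurableSet_Ioi).2 (Eventually.of_forall fun y hy => ?_)
    refine (tendsto_devFun_div_sqrt k d hy).congr' ?_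
    filter_upwards [eventually_gt_atTop 0, eventually_ge_atTop (y / Real.pi)] with r hr h2
    rw [Set.indicator_of_mem]
    exact ⟨hy, by rw [div_le_iff₀ Real.pi_pos] at h2; linarith⟩

/-- The squared reciprocal `1 / (2 k + 1) ^ 2`, the small parameter of the expansions. -/
noncomputable def eps (k : ℕ) : ℝ := 1 / (2 * (k : ℝ) + 1) ^ 2

/-- The normalized cumulant exponent on the imaginary axis. -/
noncomputable def phi (k : ℕ) (v : ℝ) : ℂ :=
  ((1 / ((2 * (k : ℝ) + 1) * (1 - eps k)) : ℝ) : ℂ) * ∑ j ∈ range k,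
    (Complex.exp ((2 * ((j : ℝ) + 1) / (2 * (k : ℝ) + 1) * v : ℝ) * Complex.I) - 1 -
      (2 * ((j : ℝ) + 1) / (2 * (k : ℝ) + 1) * v : ℝ) * Complex.I)

/-- The derivative of `phi` along the imaginary axis. -/
noncomputable def dphi (k : ℕ) (v : ℝ) : ℂ :=
  ((1 / ((2 * (k : ℝ) + 1) * (1 - eps k)) : ℝ) : ℂ) * ∑ j ∈ range k,
    ((2 * ((j : ℝ) + 1) / (2 * (k : ℝ) + 1) : ℝ) : ℂ) *
    (Complex.exp ((2 * ((j : ℝ) + 1) / (2 * (k : ℝ) + 1) * v : ℝ) * Complex.I) - 1)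

/-- The Taylor polynomial of `phi`, in terms of `eps k` and `v * I`. -/
noncomputable def phiPoly (e w : ℂ) : ℂ :=
  w ^ 2 / 12 + (1 - e) * w ^ 3 / 48 + (3 - 7 * e) * w ^ 4 / 720 +
    (1 - e) * (1 - 3 * e) * w ^ 5 / 1440 + (3 - 18 * e + 31 * e ^ 2) * w ^ 6 / 30240 +
    (1 - e) * (3 - 22 * e + 51 * e ^ 2) * w ^ 7 / 241920

/-- The formal derivative of `phiPoly`. -/
noncomputable def dphiPoly (e w : ℂ) : ℂ :=
  w / 6 + (1 - e) * w ^ 2 / 16 + (3 - 7 * e) * w ^ 3 / 180 +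
    (1 - e) * (1 - 3 * e) * w ^ 4 / 288 + (3 - 18 * e + 31 * e ^ 2) * w ^ 5 / 5040 +
    (1 - e) * (3 - 22 * e + 51 * e ^ 2) * w ^ 6 / 34560

lemma eps_pos (k : ℕ) : 0 < eps k := by unfold eps; positivity

lemma eps_le {k : ℕ} (hk : 2 ≤ k) : eps k ≤ 1 / 25 := by
  have : (2 : ℝ) ≤ k := by exact_mod_cast hk
  rw [eps, div_le_div_iff₀ (by positivity) (by norm_num)]
  nlinarith

/-- The coefficients of the Taylor expansion of `phi` in terms of power sums. -/
lemma phi_coeff {k : ℕ} (hk : 2 ≤ k) :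
    (1 / ((2 * (k : ℝ) + 1) * (1 - eps k))) * (2 / (2 * (k : ℝ) + 1)) ^ 2 * powSum k 2 / 2 = 1 / 12 ∧
    (1 / ((2 * (k : ℝ) + 1) * (1 - eps k))) * (2 / (2 * (k : ℝ) + 1)) ^ 3 * powSum k 3 / 6 =
      (1 - eps k) / 48 ∧
    (1 / ((2 * (k : ℝ) + 1) * (1 - eps k))) * (2 / (2 * (k : ℝ) + 1)) ^ 4 * powSum k 4 / 24 =
      (3 - 7 * eps k) / 720 ∧
    (1 / ((2 * (k : ℝ) + 1) * (1 - eps k))) * (2 / (2 * (k : ℝ) + 1)) ^ 5 * powSum k 5 / 120 =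
      (1 - eps k) * (1 - 3 * eps k) / 1440 ∧
    (1 / ((2 * (k : ℝ) + 1) * (1 - eps k))) * (2 / (2 * (k : ℝ) + 1)) ^ 6 * powSum k 6 / 720 =
      (3 - 18 * eps k + 31 * eps k ^ 2) / 30240 ∧
    (1 / ((2 * (k : ℝ) + 1) * (1 - eps k))) * (2 / (2 * (k : ℝ) + 1)) ^ 7 * powSum k 7 / 5040 =
      (1 - eps k) * (3 - 22 * eps k + 51 * eps k ^ 2) / 241920 := by
  have hk0 : (2 : ℝ) ≤ k := by exact_mod_cast hk
  obtain ⟨N, hN⟩ : ∃ N : ℝ, N = 2 * (k : ℝ) + 1 := ⟨_, rfl⟩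
  have hkN : (k : ℝ) = (N - 1) / 2 := by linarith
  have hN0 : N ≠ 0 := by intro h; linarith
  have hN2 : N ^ 2 - 1 ≠ 0 := by nlinarith
  rw [powSum_two, powSum_three, powSum_four, powSum_five, powSum_six, powSum_seven, eps, ← hN, hkN]
  refine ⟨?_, ?_, ?_, ?_, ?_, ?_⟩ <;> field_simp <;> ring

lemma sum_pow_eight_le {k : ℕ} (hk : 2 ≤ k) :
    (1 / ((2 * (k : ℝ) + 1) * (1 - eps k))) *
      ∑ j ∈ range k, (2 * ((j : ℝ) + 1) / (2 * (k : ℝ) + 1)) ^ 8 ≤ 1 / 17 := by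
  have he := eps_le hk
  have h1 : ∑ j ∈ range k, (2 * ((j : ℝ) + 1) / (2 * (k : ℝ) + 1)) ^ 8 =
      (2 / (2 * (k : ℝ) + 1)) ^ 8 * powSum k 8 := by
    rw [powSum, mul_sum]
    exact sum_congr rfl fun j _ => by rw [← mul_pow]; congr 1; ring
  have h2 : (2 / (2 * (k : ℝ) + 1)) ^ 8 * powSum k 8 ≤ (2 * (k : ℝ) + 1) / 18 := by
    refine (mul_le_mul_of_nonneg_left (powSum_eight_le k) (by positivity)).trans_eq ?_
    field_simp
    norm_num
  rw [h1, div_mul_eq_mul_div, one_mul, div_le_iff₀ (by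
    have : (0 : ℝ) < 1 - eps k := by linarith
    positivity)]
  have : (0 : ℝ) ≤ k := Nat.cast_nonneg k
  nlinarith

lemma pow_scaled_sum (k m : ℕ) (w : ℂ) :
    ∑ j ∈ range k, ((2 * ((j : ℝ) + 1) / (2 * (k : ℝ) + 1) : ℝ) * w : ℂ) ^ m =
      ((2 / (2 * (k : ℝ) + 1)) ^ m * powSum k m : ℝ) * w ^ m := by
  rw [powSum]
  push_cast
  rw [mul_sum, sum_mul]
  refine sum_congr rfl fun j _ => ?_
  rw [← mul_pow, ← mul_pow]
  congr 1
  ring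

lemma norm_phi_sub_le {k : ℕ} (hk : 2 ≤ k) {v : ℝ} (hv : 0 ≤ v) :
    ‖phi k v - phiPoly (eps k) (v * Complex.I)‖ ≤ v ^ 8 / 685440 := by
  have he := eps_le hk
  have hx : (0 : ℝ) < 1 - eps k := by linarith
  set c : ℝ := 1 / ((2 * (k : ℝ) + 1) * (1 - eps k)) with hc
  have hc0 : 0 ≤ c := by positivity
  have hpoly : phiPoly (eps k) (v * Complex.I) = (c : ℂ) * ∑ j ∈ range k,
      ((∑ m ∈ range 8, ((2 * ((j : ℝ) + 1) / (2 * (k : ℝ) + 1) * v : ℝ) * Complex.I) ^ m /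
        (m.factorial : ℂ)) - 1 - (2 * ((j : ℝ) + 1) / (2 * (k : ℝ) + 1) * v : ℝ) * Complex.I) := by
    have h1 : ∀ j ∈ range k,
        ((∑ m ∈ range 8, ((2 * ((j : ℝ) + 1) / (2 * (k : ℝ) + 1) * v : ℝ) * Complex.I) ^ m /
        (m.factorial : ℂ)) - 1 - (2 * ((j : ℝ) + 1) / (2 * (k : ℝ) + 1) * v : ℝ) * Complex.I) =
        ∑ m ∈ Ico 2 8, ((2 * ((j : ℝ) + 1) / (2 * (k : ℝ) + 1) : ℝ) * (v * Complex.I)) ^ m /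
          (m.factorial : ℂ) := by
      intro j _
      rw [sum_Ico_eq_sub _ (by norm_num)]
      have h2 : (((2 * ((j : ℝ) + 1) / (2 * (k : ℝ) + 1) * v : ℝ) : ℂ) * Complex.I) =
        ((2 * ((j : ℝ) + 1) / (2 * (k : ℝ) + 1) : ℝ) * (v * Complex.I)) := by push_cast; ring
      rw [h2]
      simp only [sum_range_succ, sum_range_zero, Nat.factorial]
      push_cast
      ring
    rw [sum_congr rfl h1, sum_comm]
    simp_rw [← sum_div, pow_scaled_sum]
    obtain ⟨e2, e3, e4, e5, e6, e7⟩ := phi_coeff hk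
    rw [← hc] at e2 e3 e4 e5 e6 e7
    simp only [sum_Ico_succ_top (show 2 ≤ 7 by norm_num), sum_Ico_succ_top (show 2 ≤ 6 by norm_num),
      sum_Ico_succ_top (show 2 ≤ 5 by norm_num), sum_Ico_succ_top (show 2 ≤ 4 by norm_num),
      sum_Ico_succ_top (show 2 ≤ 3 by norm_num), sum_Ico_succ_top (show 2 ≤ 2 by norm_num),
      Ico_self, sum_empty, Nat.factorial]
    apply_fun ((↑) : ℝ → ℂ) at e2 e3 e4 e5 e6 e7
    push_cast at e2 e3 e4 e5 e6 e7 ⊢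
    rw [phiPoly]
    linear_combination (-(v * Complex.I) ^ 2) * e2 - (v * Complex.I) ^ 3 * e3 -
      (v * Complex.I) ^ 4 * e4 - (v * Complex.I) ^ 5 * e5 - (v * Complex.I) ^ 6 * e6 -
      (v * Complex.I) ^ 7 * e7
  rw [hpoly, phi, ← mul_sub, ← sum_sub_distrib, norm_mul, Complex.norm_real, Real.norm_eq_abs,
    abs_of_nonneg hc0]
  calc _ ≤ c * ∑ j ∈ range k, (2 * ((j : ℝ) + 1) / (2 * (k : ℝ) + 1)) ^ 8 * (v ^ 8 / 40320) := by
        gcongr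
        refine (norm_sum_le _ _).trans (sum_le_sum fun j _ => ?_)
        rw [sub_sub_sub_cancel_right, sub_sub_sub_cancel_right]
        refine (norm_exp_sub_sum_le 8 (by positivity)).trans_eq ?_
        simp only [Nat.factorial]
        push_cast
        ring
    _ ≤ _ := by
        rw [← sum_mul, ← mul_assoc]
        have := mul_le_mul_of_nonneg_right (sum_pow_eight_le hk)
          (show (0 : ℝ) ≤ v ^ 8 / 40320 by positivity)
        rw [← hc] at this
        linarith

lemma norm_dphi_sub_le {k : ℕ} (hk : 2 ≤ k) {v : ℝ} (hv : 0 ≤ v) :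
    ‖dphi k v - dphiPoly (eps k) (v * Complex.I)‖ ≤ v ^ 7 / 85680 := by
  have he := eps_le hk
  have hx : (0 : ℝ) < 1 - eps k := by linarith
  set c : ℝ := 1 / ((2 * (k : ℝ) + 1) * (1 - eps k)) with hc
  have hc0 : 0 ≤ c := by positivity
  have hpoly : dphiPoly (eps k) (v * Complex.I) = (c : ℂ) * ∑ j ∈ range k,
      ((2 * ((j : ℝ) + 1) / (2 * (k : ℝ) + 1) : ℝ) : ℂ) *
      ((∑ m ∈ range 7, ((2 * ((j : ℝ) + 1) / (2 * (k : ℝ) + 1) * v : ℝ) * Complex.I) ^ m /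
        (m.factorial : ℂ)) - 1) := by
    have h1 : ∀ j ∈ range k,
        ((2 * ((j : ℝ) + 1) / (2 * (k : ℝ) + 1) : ℝ) : ℂ) *
        ((∑ m ∈ range 7, ((2 * ((j : ℝ) + 1) / (2 * (k : ℝ) + 1) * v : ℝ) * Complex.I) ^ m /
        (m.factorial : ℂ)) - 1) =
        ∑ m ∈ Ico 2 8, ((2 * ((j : ℝ) + 1) / (2 * (k : ℝ) + 1) : ℝ) * 1) ^ m *
          ((v * Complex.I) ^ (m - 1) / ((m - 1).factorial : ℂ)) := by
      intro j _
      rw [sum_Ico_eq_sum_range]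
      have h2 : (((2 * ((j : ℝ) + 1) / (2 * (k : ℝ) + 1) * v : ℝ) : ℂ) * Complex.I) =
        ((2 * ((j : ℝ) + 1) / (2 * (k : ℝ) + 1) : ℝ) * (v * Complex.I)) := by push_cast; ring
      rw [h2]
      simp only [sum_range_succ, sum_range_zero, Nat.factorial]
      push_cast
      ring
    rw [sum_congr rfl h1, sum_comm]
    simp_rw [← sum_mul, pow_scaled_sum]
    obtain ⟨e2, e3, e4, e5, e6, e7⟩ := phi_coeff hk
    rw [← hc] at e2 e3 e4 e5 e6 e7
    simp only [sum_Ico_succ_top (show 2 ≤ 7 by norm_num), sum_Ico_succ_top (show 2 ≤ 6 by norm_num),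
      sum_Ico_succ_top (show 2 ≤ 5 by norm_num), sum_Ico_succ_top (show 2 ≤ 4 by norm_num),
      sum_Ico_succ_top (show 2 ≤ 3 by norm_num), sum_Ico_succ_top (show 2 ≤ 2 by norm_num),
      Ico_self, sum_empty, Nat.factorial]
    apply_fun ((↑) : ℝ → ℂ) at e2 e3 e4 e5 e6 e7
    push_cast at e2 e3 e4 e5 e6 e7 ⊢
    rw [dphiPoly]
    linear_combination (-2 * (v * Complex.I)) * e2 - 3 * (v * Complex.I) ^ 2 * e3 -
      4 * (v * Complex.I) ^ 3 * e4 - 5 * (v * Complex.I) ^ 4 * e5 - 6 * (v * Complex.I) ^ 5 * e6 -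
      7 * (v * Complex.I) ^ 6 * e7
  rw [hpoly, dphi, ← mul_sub, ← sum_sub_distrib, norm_mul, Complex.norm_real, Real.norm_eq_abs,
    abs_of_nonneg hc0]
  calc _ ≤ c * ∑ j ∈ range k, (2 * ((j : ℝ) + 1) / (2 * (k : ℝ) + 1)) ^ 8 * (v ^ 7 / 5040) := by
        gcongr
        refine (norm_sum_le _ _).trans (sum_le_sum fun j _ => ?_)
        have hs : (0 : ℝ) ≤ 2 * ((j : ℝ) + 1) / (2 * (k : ℝ) + 1) := by positivity
        rw [← mul_sub, sub_sub_sub_cancel_right, norm_mul, Complex.norm_real, Real.norm_eq_abs,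
          abs_of_nonneg hs]
        refine (mul_le_mul_of_nonneg_left (norm_exp_sub_sum_le 7 (by positivity)) hs).trans_eq ?_
        simp only [Nat.factorial]
        push_cast
        ring
    _ ≤ _ := by
        rw [← sum_mul, ← mul_assoc]
        have := mul_le_mul_of_nonneg_right (sum_pow_eight_le hk)
          (show (0 : ℝ) ≤ v ^ 7 / 5040 by positivity)
        rw [← hc] at this
        linarith

lemma hasDerivAt_phi (k : ℕ) (v : ℝ) : HasDerivAt (phi k) (Complex.I * dphi k v) v := by
  unfold phi dphi
  have h0 : ∀ s : ℝ, HasDerivAt (fun v : ℝ => ((s * v : ℝ) : ℂ) * Complex.I) (s * Complex.I) v := by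
    intro s
    have := ((Complex.ofRealCLM.hasDerivAt (x := v)).const_mul (s : ℂ)).mul_const Complex.I
    simpa using this
  refine ((HasDerivAt.fun_sum (u := range k) fun (j : ℕ) _ =>
    (((h0 (2 * ((j : ℝ) + 1) / (2 * (k : ℝ) + 1))).cexp).sub_const 1).fun_sub
      (h0 (2 * ((j : ℝ) + 1) / (2 * (k : ℝ) + 1)))).const_mul _).congr_deriv ?_
  rw [mul_left_comm, mul_sum _ _ Complex.I]
  congr 1
  exact sum_congr rfl fun j _ => by ring

lemma phi_eq (k : ℕ) (v : ℝ) :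
    phi k v = ((-((1 / ((2 * (k : ℝ) + 1) * (1 - eps k))) * cosDef k (2 * v / (2 * k + 1))) : ℝ) : ℂ) -
      ((1 / ((2 * (k : ℝ) + 1) * (1 - eps k))) * sinDef k (2 * v / (2 * k + 1)) : ℝ) *
        Complex.I := by
  rw [phi, cosDef, sinDef]
  push_cast
  rw [mul_assoc, sum_mul, ← mul_neg, ← sum_neg_distrib, ← mul_sub, ← sum_sub_distrib]
  congr 1
  refine sum_congr rfl fun j _ => ?_
  rw [Complex.exp_mul_I, show (2 * ((j : ℂ) + 1) / (2 * (k : ℂ) + 1) * v) =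
    (((j : ℂ) + 1) * (2 * v / (2 * k + 1))) by ring]
  ring

lemma phi_re (k : ℕ) (v : ℝ) : (phi k v).re =
    -((1 / ((2 * (k : ℝ) + 1) * (1 - eps k))) * cosDef k (2 * v / (2 * k + 1))) := by
  rw [phi_eq]; simp only [Complex.sub_re, Complex.ofReal_re, Complex.re_ofReal_mul, Complex.I_re]
  ring

lemma phi_im (k : ℕ) (v : ℝ) : (phi k v).im =
    -((1 / ((2 * (k : ℝ) + 1) * (1 - eps k))) * sinDef k (2 * v / (2 * k + 1))) := by
  rw [phi_eq]; simp only [Complex.sub_im, Complex.ofReal_im, Complex.im_ofReal_mul, Complex.I_im]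
  ring

lemma phi_zero (k : ℕ) : phi k 0 = 0 := by simp [phi]

@[fun_prop]
lemma continuous_phi (k : ℕ) : Continuous (phi k) :=
  continuous_iff_continuousAt.2 fun v => (hasDerivAt_phi k v).continuousAt

lemma scale_pos {k : ℕ} (hk : 2 ≤ k) : 0 < 1 / ((2 * (k : ℝ) + 1) * (1 - eps k)) := by
  have := eps_le hk
  have : (0 : ℝ) < 1 - eps k := by linarith
  positivity

lemma neg_phi_re_le {k : ℕ} (hk : 2 ≤ k) (v : ℝ) : -(phi k v).re ≤ v ^ 2 / 12 := by
  rw [phi_re, neg_neg]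
  refine (mul_le_mul_of_nonneg_left (cosDef_le k _) (scale_pos hk).le).trans_eq ?_
  have := (phi_coeff hk).1
  linear_combination v ^ 2 * this

lemma le_neg_phi_re {k : ℕ} (hk : 2 ≤ k) {v : ℝ} (h0 : 0 ≤ v) (h1 : v ≤ 5 / 2) :
    11 / 192 * v ^ 2 ≤ -(phi k v).re := by
  rw [phi_re, neg_neg]
  refine le_trans ?_ (mul_le_mul_of_nonneg_left
    (le_cosDef k (t := 2 * v / (2 * k + 1)) (by positivity)) (scale_pos hk).le)
  have e2 := (phi_coeff hk).1
  have e4 := (phi_coeff hk).2.2.1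
  have : (1 / ((2 * (k : ℝ) + 1) * (1 - eps k))) * (powSum k 2 / 2 * (2 * v / (2 * k + 1)) ^ 2 -
      powSum k 4 / 24 * (2 * v / (2 * k + 1)) ^ 4) =
      v ^ 2 / 12 - (3 - 7 * eps k) / 720 * v ^ 4 := by
    linear_combination v ^ 2 * e2 - v ^ 4 * e4
  rw [this]
  have h2 : v ^ 2 * v ^ 2 ≤ v ^ 2 * (25 / 4) := by
    have : v ^ 2 ≤ 25 / 4 := by nlinarith
    gcongr
  have h3 : 0 ≤ eps k * v ^ 4 := mul_nonneg (eps_pos k).le (by positivity)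
  nlinarith

lemma abs_phi_im_le {k : ℕ} (hk : 2 ≤ k) {v : ℝ} (h0 : 0 ≤ v) : |(phi k v).im| ≤ v ^ 3 / 48 := by
  rw [phi_im, abs_neg, abs_of_nonneg (mul_nonneg (scale_pos hk).le
    (sinDef_nonneg k (by positivity)))]
  refine (mul_le_mul_of_nonneg_left (sinDef_le k (t := 2 * v / (2 * k + 1)) (by positivity))
    (scale_pos hk).le).trans ?_
  have e3 := (phi_coeff hk).2.1
  have : (1 / ((2 * (k : ℝ) + 1) * (1 - eps k))) * (powSum k 3 / 6 * (2 * v / (2 * k + 1)) ^ 3) =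
      (1 - eps k) / 48 * v ^ 3 := by
    linear_combination v ^ 3 * e3
  rw [this]
  have h3 : 0 ≤ eps k * v ^ 3 := mul_nonneg (eps_pos k).le (by positivity)
  linarith

lemma norm_phi_le {k : ℕ} (hk : 2 ≤ k) {v : ℝ} (h0 : 0 ≤ v) : ‖phi k v‖ ≤ v ^ 2 / 12 := by
  rw [phi, norm_mul, Complex.norm_real, Real.norm_eq_abs, abs_of_pos (scale_pos hk)]
  have h : ∀ j ∈ range k, ‖Complex.exp ((2 * ((j : ℝ) + 1) / (2 * (k : ℝ) + 1) * v : ℝ) *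
      Complex.I) - 1 - (2 * ((j : ℝ) + 1) / (2 * (k : ℝ) + 1) * v : ℝ) * Complex.I‖ ≤
      ((j : ℝ) + 1) ^ 2 * ((2 / (2 * (k : ℝ) + 1)) ^ 2 * v ^ 2 / 2) := by
    intro j _
    have := norm_exp_sub_sum_le 2 (u := 2 * ((j : ℝ) + 1) / (2 * (k : ℝ) + 1) * v) (by positivity)
    simp only [sum_range_succ, sum_range_zero, pow_zero, pow_one, Nat.factorial_zero,
      Nat.factorial_one, Nat.factorial_two, zero_add, Nat.cast_one, div_one, ← sub_sub] at this
    refine this.trans_eq ?_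
    push_cast
    ring
  refine (mul_le_mul_of_nonneg_left ((norm_sum_le _ _).trans (sum_le_sum h))
    (scale_pos hk).le).trans_eq ?_
  rw [← sum_mul, ← powSum]
  linear_combination v ^ 2 * (phi_coeff hk).1

lemma norm_phi_le_linear {k : ℕ} (hk : 2 ≤ k) {v : ℝ} (h0 : 0 ≤ v) :
    ‖phi k v‖ ≤ v / 4 + 25 / 24 := by
  have he := eps_le hk
  have hx : (0 : ℝ) < 1 - eps k := by linarith
  have hk0 : (2 : ℝ) ≤ k := by exact_mod_cast hk
  rw [phi, norm_mul, Complex.norm_real, Real.norm_eq_abs, abs_of_pos (scale_pos hk)]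
  have h : ∀ j ∈ range k, ‖Complex.exp ((2 * ((j : ℝ) + 1) / (2 * (k : ℝ) + 1) * v : ℝ) *
      Complex.I) - 1 - (2 * ((j : ℝ) + 1) / (2 * (k : ℝ) + 1) * v : ℝ) * Complex.I‖ ≤
      2 + ((j : ℝ) + 1) ^ 1 * (2 / (2 * (k : ℝ) + 1) * v) := by
    intro j _
    have hu : (0 : ℝ) ≤ 2 * ((j : ℝ) + 1) / (2 * (k : ℝ) + 1) * v := by positivity
    refine (norm_sub_le _ _).trans (add_le_add ((norm_sub_le _ _).trans ?_) ?_)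
    · rw [Complex.norm_exp_ofReal_mul_I, norm_one]; norm_num
    · rw [norm_mul, Complex.norm_I, Complex.norm_real, Real.norm_eq_abs, abs_of_nonneg hu]
      exact le_of_eq (by ring)
  refine (mul_le_mul_of_nonneg_left ((norm_sum_le _ _).trans (sum_le_sum h))
    (scale_pos hk).le).trans ?_
  rw [sum_add_distrib, ← sum_mul, ← powSum, sum_const, card_range, nsmul_eq_mul, powSum_one]
  have h1 : (2 * (k : ℝ) + 1) ^ 2 * (1 - eps k) = 4 * (k * (k + 1)) := by
    rw [eps]; field_simp; ring
  rw [div_mul_eq_mul_div, one_mul, div_le_iff₀ (by positivity)]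
  have h2 : (k : ℝ) * (k + 1) / 2 * (2 / (2 * (k : ℝ) + 1) * v) =
      v / 4 * ((2 * (k : ℝ) + 1) * (1 - eps k)) := by
    have : (k : ℝ) * (k + 1) = (2 * (k : ℝ) + 1) ^ 2 * (1 - eps k) / 4 := by linarith
    rw [this]; field_simp
  rw [h2]
  nlinarith

/-- The coefficient of `w ^ 2` in the first corrector. -/
noncomputable def coefTwo (e : ℂ) : ℂ := -(7 / 1280) - 41 / 640 * e + 5 / 256 * e ^ 2

/-- The coefficient of `w ^ 3` in the first corrector. -/
noncomputable def coefThree (e : ℂ) : ℂ :=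
  1 / 15360 + 29 / 15360 * e - 25 / 3072 * e ^ 2 + 19 / 3072 * e ^ 3

/-- The leading coefficient of the expansion of the integral. -/
noncomputable def coefEta (e : ℂ) : ℂ :=
  33 / 1280 + 381 / 1280 * e - 669 / 1280 * e ^ 2 + 51 / 256 * e ^ 3

/-- The first corrector, used to integrate by parts. -/
noncomputable def corrOne (e w : ℂ) : ℂ := 1 / 2 + coefTwo e * w ^ 2 + coefThree e * w ^ 3

/-- The derivative of the first corrector. -/
noncomputable def corrOneDeriv (e w : ℂ) : ℂ := 2 * coefTwo e * w + 3 * coefThree e * w ^ 2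

/-- The second corrector, used to integrate by parts. -/
noncomputable def corrTwo (e w : ℂ) : ℂ := 12 * coefTwo e + coefEta e * w

/-- The quotient of `phiPoly e w` by `w`. -/
noncomputable def phiQuot (e w : ℂ) : ℂ :=
  w / 12 + (1 - e) * w ^ 2 / 48 + (3 - 7 * e) * w ^ 3 / 720 +
    (1 - e) * (1 - 3 * e) * w ^ 4 / 1440 + (3 - 18 * e + 31 * e ^ 2) * w ^ 5 / 30240 +
    (1 - e) * (3 - 22 * e + 51 * e ^ 2) * w ^ 6 / 241920

/-- The cubic Taylor polynomial of `exp ((1 - e) * w / 8)`. -/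
noncomputable def expPoly (e w : ℂ) : ℂ :=
  1 + (1 - e) * w / 8 + (1 - e) ^ 2 * w ^ 2 / 128 + (1 - e) ^ 3 * w ^ 3 / 3072

lemma phiPoly_eq (e w : ℂ) : phiPoly e w = phiQuot e w * w := by
  unfold phiPoly phiQuot; ring

lemma norm_remainder_one_poly_le {e v : ℝ} {w : ℂ} (he0 : 0 ≤ e) (he : e ≤ 1 / 25) (h0 : 0 ≤ v)
    (h1 : v ≤ 5 / 2) (hw : ‖w‖ = v) :
    ‖phiQuot e w * (expPoly e w * (1 - e * w ^ 2 / 6)) - dphiPoly e w * corrOne e w‖ ≤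
      1970 / 10 ^ 8 * v ^ 5 + 722 / 10 ^ 8 * v ^ 6 + 1000 / 10 ^ 8 * v ^ 7 := by
  have f2 : 0 ≤ e ^ 2 := by positivity
  have g2 : e ^ 2 ≤ (1 / 25) ^ 2 := by gcongr
  have f3 : 0 ≤ e ^ 3 := by positivity
  have g3 : e ^ 3 ≤ (1 / 25) ^ 3 := by gcongr
  have f4 : 0 ≤ e ^ 4 := by positivity
  have g4 : e ^ 4 ≤ (1 / 25) ^ 4 := by gcongr
  have f5 : 0 ≤ e ^ 5 := by positivity
  have g5 : e ^ 5 ≤ (1 / 25) ^ 5 := by gcongr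
  have f6 : 0 ≤ e ^ 6 := by positivity
  have g6 : e ^ 6 ≤ (1 / 25) ^ 6 := by gcongr
  have f7 : 0 ≤ e ^ 7 := by positivity
  have g7 : e ^ 7 ≤ (1 / 25) ^ 7 := by gcongr
  obtain ⟨c5, hc5⟩ : ∃ c : ℝ, c = 191 / 12902400 + 149 / 1612800 * e - 13591 / 19353600 * e ^ 2 -
      1 / 960 * e ^ 3 + 29 / 73728 *
      e ^ 4 := ⟨_, rfl⟩
  obtain ⟨c6, hc6⟩ : ∃ c : ℝ, c = 157 / 25804800 + 13 / 860160 * e - 1 / 3150 * e ^ 2 +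
      179 / 860160 * e ^ 3 + 13 / 147456 * e ^
      4 := ⟨_, rfl⟩
  obtain ⟨c7, hc7⟩ : ∃ c : ℝ, c = 1 / 179200 - 1451 / 30965760 * e + 4621 / 38707200 * e ^ 2 -
      20843 / 232243200 * e ^ 3 + 383 /
      2580480 * e ^ 4 - 293 / 4423680 * e ^ 5 := ⟨_, rfl⟩
  obtain ⟨c8, hc8⟩ : ∃ c : ℝ, c = 1 / 1769472 - 67 / 11468800 * e + 2803 / 154828800 * e ^ 2 -
      4147 / 464486400 * e ^ 3 + 1399 /
      132710400 * e ^ 4 - 2683 / 185794560 * e ^ 5 := ⟨_, rfl⟩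
  obtain ⟨c9, hc9⟩ : ∃ c : ℝ, c = -1 / 619315200 - 13 / 22118400 * e +
      10877 / 1857945600 * e ^ 2 - 887 / 38707200 * e ^ 3 +
      24733 / 619315200 * e ^ 4 - 587 / 18579456 * e ^ 5 + 1153 / 123863040 * e ^ 6 := ⟨_, rfl⟩
  obtain ⟨c10, hc10⟩ : ∃ c : ℝ, c = -1 / 46448640 * e + 1 / 4644864 * e ^ 2 -
      59 / 69672960 * e ^ 3 + 17 / 11612160 * e ^ 4 - 53 /
      46448640 * e ^ 5 + 23 / 69672960 * e ^ 6 := ⟨_, rfl⟩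
  obtain ⟨c11, hc11⟩ : ∃ c : ℝ, c = -1 / 1486356480 * e + 17 / 2229534720 * e ^ 2 -
      157 / 4459069440 * e ^ 3 + 29 / 371589120 * e
      ^ 4 - 397 / 4459069440 * e ^ 5 + 113 / 2229534720 * e ^ 6 - 17 / 1486356480 * e ^ 7 := ⟨_, rfl⟩
  have hid : phiQuot e w * (expPoly e w * (1 - e * w ^ 2 / 6)) - dphiPoly e w * corrOne e w =
      c5 * w ^ 5 + c6 * w ^ 6 + c7 * w ^ 7 + c8 * w ^ 8 + c9 * w ^ 9 + c10 * w ^ 10 + c11 * w ^ 11 := by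
    simp only [phiQuot, dphiPoly, corrOne, coefTwo, coefThree, expPoly]
    rw [hc5, hc6, hc7, hc8, hc9, hc10, hc11]
    push_cast
    ring
  have hb5 : |c5| ≤ 1969016 / 100000000000 := abs_le.2 ⟨by linarith, by linarith⟩
  have hb6 : |c6| ≤ 721016 / 100000000000 := abs_le.2 ⟨by linarith, by linarith⟩
  have hb7 : |c7| ≤ 765183 / 100000000000 := abs_le.2 ⟨by linarith, by linarith⟩
  have hb8 : |c8| ≤ 82839 / 100000000000 := abs_le.2 ⟨by linarith, by linarith⟩
  have hb9 : |c9| ≤ 3607 / 100000000000 := abs_le.2 ⟨by linarith, by linarith⟩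
  have hb10 : |c10| ≤ 127 / 100000000000 := abs_le.2 ⟨by linarith, by linarith⟩
  have hb11 : |c11| ≤ 5 / 100000000000 := abs_le.2 ⟨by linarith, by linarith⟩
  rw [hid]
  have hn (c : ℝ) (m : ℕ) : ‖(c : ℂ) * w ^ m‖ = |c| * v ^ m := by
    rw [norm_mul, norm_pow, hw, Complex.norm_real, Real.norm_eq_abs]
  refine (norm_add_le_of_le (norm_add_le_of_le (norm_add_le_of_le (norm_add_le_of_le (norm_add_le_of_le
      (norm_add_le_of_le (hn _ _).le (hn _ _).le) (hn _ _).le) (hn _ _).le) (hn _ _).le) (hn _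
      _).le) (hn _ _).le).trans ?_
  have q5 : |c5| * v ^ 5 ≤ _ * v ^ 5 := mul_le_mul_of_nonneg_right hb5 (by positivity)
  have q6 : |c6| * v ^ 6 ≤ _ * v ^ 6 := mul_le_mul_of_nonneg_right hb6 (by positivity)
  have q7 : |c7| * v ^ 7 ≤ _ * v ^ 7 := mul_le_mul_of_nonneg_right hb7 (by positivity)
  have q8 : |c8| * v ^ 8 ≤ _ * v ^ 8 := mul_le_mul_of_nonneg_right hb8 (by positivity)
  have q9 : |c9| * v ^ 9 ≤ _ * v ^ 9 := mul_le_mul_of_nonneg_right hb9 (by positivity)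
  have q10 : |c10| * v ^ 10 ≤ _ * v ^ 10 := mul_le_mul_of_nonneg_right hb10 (by positivity)
  have q11 : |c11| * v ^ 11 ≤ _ * v ^ 11 := mul_le_mul_of_nonneg_right hb11 (by positivity)
  have p8 : v ^ 8 ≤ 5 / 2 * v ^ 7 := by
    rw [pow_succ, mul_comm]; gcongr
  have p9 : v ^ 9 ≤ 5 / 2 * v ^ 8 := by
    rw [pow_succ, mul_comm]; gcongr
  have p10 : v ^ 10 ≤ 5 / 2 * v ^ 9 := by
    rw [pow_succ, mul_comm]; gcongr
  have p11 : v ^ 11 ≤ 5 / 2 * v ^ 10 := by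
    rw [pow_succ, mul_comm]; gcongr
  linarith [pow_nonneg h0 5, pow_nonneg h0 6, pow_nonneg h0 7]

lemma norm_remainder_two_poly_le {e v : ℝ} {w : ℂ} (he0 : 0 ≤ e) (he : e ≤ 1 / 25) (h0 : 0 ≤ v)
    (h1 : v ≤ 5 / 2) (hw : ‖w‖ = v) :
    ‖corrOneDeriv e w - dphiPoly e w * corrTwo e w‖ ≤
      818 / 10 ^ 6 * v ^ 3 + 306 / 10 ^ 6 * v ^ 4 + 127 / 10 ^ 6 * v ^ 5 := by
  have f2 : 0 ≤ e ^ 2 := by positivity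
  have g2 : e ^ 2 ≤ (1 / 25) ^ 2 := by gcongr
  have f3 : 0 ≤ e ^ 3 := by positivity
  have g3 : e ^ 3 ≤ (1 / 25) ^ 3 := by gcongr
  have f4 : 0 ≤ e ^ 4 := by positivity
  have g4 : e ^ 4 ≤ (1 / 25) ^ 4 := by gcongr
  have f5 : 0 ≤ e ^ 5 := by positivity
  have g5 : e ^ 5 ≤ (1 / 25) ^ 5 := by gcongr
  have f6 : 0 ≤ e ^ 6 := by positivity
  have g6 : e ^ 6 ≤ (1 / 25) ^ 6 := by gcongr
  obtain ⟨c3, hc3⟩ : ∃ c : ℝ, c = -53 / 102400 - 517 / 76800 * e + 2683 / 153600 * e ^ 2 -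
      553 / 15360 * e ^ 3 + 51 / 4096 * e ^
      4 := ⟨_, rfl⟩
  obtain ⟨c4, hc4⟩ : ∃ c : ℝ, c = -31 / 153600 - 169 / 76800 * e + 91 / 9600 * e ^ 2 -
      317 / 25600 * e ^ 3 + 163 / 30720 * e ^ 4 := ⟨_, rfl⟩
  obtain ⟨c5, hc5⟩ : ∃ c : ℝ, c = -31 / 614400 - 389 / 860160 * e + 2293 / 716800 * e ^ 2 -
      11797 / 2150400 * e ^ 3 + 1941 /
      286720 * e ^ 4 - 17 / 8192 * e ^ 5 := ⟨_, rfl⟩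
  obtain ⟨c6, hc6⟩ : ∃ c : ℝ, c = -83 / 8601600 - 1699 / 25804800 * e + 223 / 286720 * e ^ 2 -
      27347 / 12902400 * e ^ 3 + 59267
      / 25804800 * e ^ 4 - 1513 / 1720320 * e ^ 5 := ⟨_, rfl⟩
  obtain ⟨c7, hc7⟩ : ∃ c : ℝ, c = -11 / 4915200 - 53 / 7372800 * e + 3041 / 14745600 * e ^ 2 -
      727 / 737280 * e ^ 3 + 24881 /
      14745600 * e ^ 4 - 8789 / 7372800 * e ^ 5 + 289 / 983040 * e ^ 6 := ⟨_, rfl⟩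
  have hid : corrOneDeriv e w - dphiPoly e w * corrTwo e w =
      c3 * w ^ 3 + c4 * w ^ 4 + c5 * w ^ 5 + c6 * w ^ 6 + c7 * w ^ 7 := by
    simp only [dphiPoly, corrOneDeriv, corrTwo, coefTwo, coefThree, coefEta]
    rw [hc3, hc4, hc5, hc6, hc7]
    push_cast
    ring
  have hb3 : |c3| ≤ 81713292 / 100000000000 := abs_le.2 ⟨by linarith, by linarith⟩
  have hb4 : |c4| ≤ 30581651 / 100000000000 := abs_le.2 ⟨by linarith, by linarith⟩
  have hb5 : |c5| ≤ 7403234 / 100000000000 := abs_le.2 ⟨by linarith, by linarith⟩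
  have hb6 : |c6| ≤ 1366903 / 100000000000 := abs_le.2 ⟨by linarith, by linarith⟩
  have hb7 : |c7| ≤ 292302 / 100000000000 := abs_le.2 ⟨by linarith, by linarith⟩
  rw [hid]
  have hn (c : ℝ) (m : ℕ) : ‖(c : ℂ) * w ^ m‖ = |c| * v ^ m := by
    rw [norm_mul, norm_pow, hw, Complex.norm_real, Real.norm_eq_abs]
  refine (norm_add_le_of_le (norm_add_le_of_le (norm_add_le_of_le (norm_add_le_of_le (hn _ _).le (hn _
      _).le) (hn _ _).le) (hn _ _).le) (hn _ _).le).trans ?_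
  have q3 : |c3| * v ^ 3 ≤ _ * v ^ 3 := mul_le_mul_of_nonneg_right hb3 (by positivity)
  have q4 : |c4| * v ^ 4 ≤ _ * v ^ 4 := mul_le_mul_of_nonneg_right hb4 (by positivity)
  have q5 : |c5| * v ^ 5 ≤ _ * v ^ 5 := mul_le_mul_of_nonneg_right hb5 (by positivity)
  have q6 : |c6| * v ^ 6 ≤ _ * v ^ 6 := mul_le_mul_of_nonneg_right hb6 (by positivity)
  have q7 : |c7| * v ^ 7 ≤ _ * v ^ 7 := mul_le_mul_of_nonneg_right hb7 (by positivity)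
  have p6 : v ^ 6 ≤ 5 / 2 * v ^ 5 := by
    rw [pow_succ, mul_comm]; gcongr
  have p7 : v ^ 7 ≤ 5 / 2 * v ^ 6 := by
    rw [pow_succ, mul_comm]; gcongr
  linarith [pow_nonneg h0 3, pow_nonneg h0 4, pow_nonneg h0 5]

lemma sub_div_sin {s : ℝ} (h0 : 0 < s) (h1 : s ≤ 1 / 2) :
    |s / Real.sin s - (1 + s ^ 2 / 6)| ≤ 29 / 1000 * s ^ 4 := by
  have hl := sub_sin_le h0.le
  have hu := le_sub_sin h0.le
  have h2 : s ^ 2 ≤ 1 / 4 := by nlinarith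
  have hs : 0 < Real.sin s := Real.sin_pos_of_pos_of_lt_pi h0 (by linarith [Real.pi_gt_three])
  have h3 : s * (1 - s ^ 2 / 6) ≤ Real.sin s := by linarith
  rw [abs_le]
  constructor
  · have : 1 + s ^ 2 / 6 ≤ s / Real.sin s := by
      rw [le_div_iff₀ hs]
      have : (1 + s ^ 2 / 6) * Real.sin s ≤ (1 + s ^ 2 / 6) * (s - s ^ 3 / 6 + s ^ 5 / 120) := by
        gcongr; linarith
      refine this.trans ?_
      have : (1 + s ^ 2 / 6) * (s - s ^ 3 / 6 + s ^ 5 / 120) =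
        s - s ^ 5 * (7 / 360 - s ^ 2 / 720) := by ring
      rw [this]
      have : 0 ≤ s ^ 5 * (7 / 360 - s ^ 2 / 720) := mul_nonneg (by positivity) (by linarith)
      linarith
    have : 0 ≤ s ^ 4 := by positivity
    linarith
  · have : s / Real.sin s ≤ 1 + s ^ 2 / 6 + 29 / 1000 * s ^ 4 := by
      rw [div_le_iff₀ hs]
      have : (1 + s ^ 2 / 6 + 29 / 1000 * s ^ 4) * (s * (1 - s ^ 2 / 6)) ≤
          (1 + s ^ 2 / 6 + 29 / 1000 * s ^ 4) * Real.sin s := by gcongr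
      refine le_trans ?_ this
      have : (1 + s ^ 2 / 6 + 29 / 1000 * s ^ 4) * (s * (1 - s ^ 2 / 6)) =
        s + s ^ 5 * (29 / 1000 * (1 - s ^ 2 / 6) - 1 / 36) := by ring
      rw [this]
      have : 0 ≤ s ^ 5 * (29 / 1000 * (1 - s ^ 2 / 6) - 1 / 36) :=
        mul_nonneg (by positivity) (by linarith)
      linarith
    linarith

/-- The amplitude of the normalized integrand. -/
noncomputable def ampl (k : ℕ) (v : ℝ) : ℂ :=
  Complex.exp (((1 - eps k) * v / 8 : ℝ) * Complex.I) *
    ((v / (2 * k + 1) / Real.sin (v / (2 * k + 1)) : ℝ) : ℂ)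

/-- The normalized integrand, without its exponential factor. -/
noncomputable def wFun (k : ℕ) (v : ℝ) : ℂ := phi k v / (v * Complex.I) * ampl k v

lemma norm_ofReal_mul_I {v : ℝ} (hv : 0 ≤ v) : ‖(v * Complex.I : ℂ)‖ = v := by
  rw [norm_mul, Complex.norm_I, Complex.norm_real, Real.norm_eq_abs, abs_of_nonneg hv, mul_one]

lemma sq_div_eq_eps (k : ℕ) (v : ℝ) : (v / (2 * k + 1)) ^ 2 = eps k * v ^ 2 := by
  rw [eps, div_pow]; ring

lemma norm_ampl_sub_le {k : ℕ} (hk : 2 ≤ k) {v : ℝ} (h0 : 0 < v) (h1 : v ≤ 5 / 2) :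
    ‖ampl k v - expPoly (eps k) (v * Complex.I) * (1 - eps k * (v * Complex.I) ^ 2 / 6)‖ ≤
      58 / 10 ^ 6 * v ^ 4 := by
  have he := eps_le hk
  have he0 := eps_pos k
  have hk0 : (2 : ℝ) ≤ k := by exact_mod_cast hk
  set e := eps k with hedef
  have hs2 := sq_div_eq_eps k v
  set s : ℝ := v / (2 * k + 1) with hs
  have hs0 : 0 < s := by positivity
  have hv2 : v ^ 2 ≤ 25 / 4 := by nlinarith
  have hs1 : s ≤ 1 / 2 := by
    rw [hs, div_le_iff₀ (by positivity)]; linarith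
  have hsin := sub_div_sin hs0 hs1
  have hE := norm_exp_sub_sum_le 4 (u := (1 - e) * v / 8)
    (div_nonneg (mul_nonneg (by linarith) h0.le) (by norm_num))
  have hEp : ∑ m ∈ range 4, (((1 - e) * v / 8 : ℝ) * Complex.I) ^ m / (m.factorial : ℂ) =
      expPoly e (v * Complex.I) := by
    simp [sum_range_succ, expPoly, Nat.factorial]
    ring
  rw [hEp] at hE
  have hE' : ((1 - e) * v / 8) ^ 4 / ((4).factorial : ℝ) ≤ 11 / 10 ^ 6 * v ^ 4 := by
    have : (1 - e) ^ 4 ≤ 1 := pow_le_one₀ (by linarith) (by linarith)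
    have h4 : 0 < v ^ 4 := by positivity
    have : ((1 - e) * v / 8) ^ 4 / ((4).factorial : ℝ) = (1 - e) ^ 4 * (v ^ 4 / 98304) := by
      simp [Nat.factorial]; ring
    rw [this]; nlinarith
  have hS3 : (1 - (e : ℂ) * (v * Complex.I) ^ 2 / 6) = ((1 + s ^ 2 / 6 : ℝ) : ℂ) := by
    rw [hs2, mul_pow, Complex.I_sq]; push_cast; ring
  rw [hS3, ampl]
  have hsplit : Complex.exp (((1 - e) * v / 8 : ℝ) * Complex.I) * ((s / Real.sin s : ℝ) : ℂ) -
      expPoly e (v * Complex.I) * ((1 + s ^ 2 / 6 : ℝ) : ℂ) =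
      Complex.exp (((1 - e) * v / 8 : ℝ) * Complex.I) *
        ((s / Real.sin s - (1 + s ^ 2 / 6) : ℝ) : ℂ) +
      (Complex.exp (((1 - e) * v / 8 : ℝ) * Complex.I) - expPoly e (v * Complex.I)) *
        ((1 + s ^ 2 / 6 : ℝ) : ℂ) := by
    push_cast; ring
  rw [hsplit]
  refine (norm_add_le _ _).trans ?_
  rw [norm_mul, norm_mul, Complex.norm_exp_ofReal_mul_I, one_mul, Complex.norm_real,
    Complex.norm_real, Real.norm_eq_abs, Real.norm_eq_abs, abs_of_pos (by positivity :
      (0 : ℝ) < 1 + s ^ 2 / 6)]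
  have hs4 : s ^ 4 ≤ 1 / 625 * v ^ 4 := by
    have : s ^ 4 = e ^ 2 * v ^ 4 := by
      rw [show s ^ 4 = (s ^ 2) ^ 2 by ring, hs2]; ring
    rw [this]
    gcongr
    nlinarith
  have hs22 : s ^ 2 ≤ 1 / 4 := by nlinarith
  have h4 : 0 < v ^ 4 := by positivity
  have : ‖Complex.exp (((1 - e) * v / 8 : ℝ) * Complex.I) - expPoly e (v * Complex.I)‖ *
      (1 + s ^ 2 / 6) ≤ 11 / 10 ^ 6 * v ^ 4 * (1 + 1 / 4 / 6) := by
    gcongr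
    exact hE.trans hE'
  nlinarith

lemma norm_coefTwo_le {e : ℝ} (he0 : 0 ≤ e) (he : e ≤ 1 / 25) : ‖coefTwo e‖ ≤ 81 / 10000 := by
  have : coefTwo e = ((-(7 / 1280) - 41 / 640 * e + 5 / 256 * e ^ 2 : ℝ) : ℂ) := by
    rw [coefTwo]; push_cast; ring
  rw [this, Complex.norm_real, Real.norm_eq_abs, abs_le]
  constructor <;> nlinarith

lemma norm_coefThree_le {e : ℝ} (he0 : 0 ≤ e) (he : e ≤ 1 / 25) : ‖coefThree e‖ ≤ 16 / 100000 := by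
  have : coefThree e =
      ((1 / 15360 + 29 / 15360 * e - 25 / 3072 * e ^ 2 + 19 / 3072 * e ^ 3 : ℝ) : ℂ) := by
    rw [coefThree]; push_cast; ring
  have f2 : 0 ≤ e ^ 2 := by positivity
  have g2 : e ^ 2 ≤ (1 / 25) ^ 2 := by gcongr
  have f3 : 0 ≤ e ^ 3 := by positivity
  have g3 : e ^ 3 ≤ (1 / 25) ^ 3 := by gcongr
  rw [this, Complex.norm_real, Real.norm_eq_abs, abs_le]
  constructor <;> nlinarith

/-- The real value of `coefEta`. -/
noncomputable def etaReal (e : ℝ) : ℝ :=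
  33 / 1280 + 381 / 1280 * e - 669 / 1280 * e ^ 2 + 51 / 256 * e ^ 3

lemma coefEta_eq (e : ℝ) : coefEta e = (etaReal e : ℂ) := by
  rw [coefEta, etaReal]; push_cast; ring

lemma le_etaReal {e : ℝ} (he0 : 0 ≤ e) (he : e ≤ 1 / 25) : 33 / 1280 ≤ etaReal e := by
  have f3 : 0 ≤ e ^ 3 := by positivity
  rw [etaReal]; nlinarith

lemma etaReal_le {e : ℝ} (he0 : 0 ≤ e) (he : e ≤ 1 / 25) : etaReal e ≤ 4 / 100 := by
  have f2 : 0 ≤ e ^ 2 := by positivity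
  have g3 : e ^ 3 ≤ (1 / 25) ^ 3 := by gcongr
  rw [etaReal]; nlinarith

lemma norm_corrOne_le {e v : ℝ} {w : ℂ} (he0 : 0 ≤ e) (he : e ≤ 1 / 25) (h0 : 0 ≤ v)
    (h1 : v ≤ 5 / 2) (hw : ‖w‖ = v) : ‖corrOne e w‖ ≤ 56 / 100 := by
  have a := norm_coefTwo_le he0 he
  have b := norm_coefThree_le he0 he
  rw [corrOne]
  have : ‖(1 / 2 : ℂ)‖ ≤ 1 / 2 := by simp
  refine (norm_add_le_of_le (norm_add_le_of_le this (norm_mul _ _).le) (norm_mul _ _).le).trans ?_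
  rw [norm_pow, norm_pow, hw]
  have : ‖coefTwo e‖ * v ^ 2 ≤ 81 / 10000 * (5 / 2) ^ 2 := by gcongr
  have : ‖coefThree e‖ * v ^ 3 ≤ 16 / 100000 * (5 / 2) ^ 3 := by gcongr
  linarith

lemma norm_corrTwo_le {e v : ℝ} {w : ℂ} (he0 : 0 ≤ e) (he : e ≤ 1 / 25) (h0 : 0 ≤ v)
    (h1 : v ≤ 5 / 2) (hw : ‖w‖ = v) : ‖corrTwo e w‖ ≤ 20 / 100 := by
  have a := norm_coefTwo_le he0 he
  have b := etaReal_le he0 he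
  have b0 := le_etaReal he0 he
  rw [corrTwo, coefEta_eq]
  refine (norm_add_le_of_le (norm_mul _ _).le (norm_mul _ _).le).trans ?_
  rw [hw, Complex.norm_real, Real.norm_eq_abs, abs_of_nonneg (by linarith)]
  have : etaReal e * v ≤ 4 / 100 * (5 / 2) := by gcongr
  have : ‖(12 : ℂ)‖ = 12 := by simp
  rw [this]
  linarith

lemma norm_expPoly_mul_le {e v : ℝ} (he0 : 0 ≤ e) (he : e ≤ 1 / 25) (h0 : 0 ≤ v)
    (h1 : v ≤ 5 / 2) :
    ‖expPoly e (v * Complex.I) * (1 - e * (v * Complex.I) ^ 2 / 6)‖ ≤ 3 / 2 := by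
  have hx : ‖(1 - e : ℂ)‖ ≤ 1 := by
    rw [← Complex.ofReal_one, ← Complex.ofReal_sub, Complex.norm_real, Real.norm_eq_abs, abs_le]
    constructor <;> linarith
  have hw := norm_ofReal_mul_I h0
  set w : ℂ := v * Complex.I with hwdef
  have hx0 : 0 ≤ ‖(1 - e : ℂ)‖ := norm_nonneg _
  have h2 : ‖(1 - e * w ^ 2 / 6 : ℂ)‖ ≤ 1 + 1 / 25 * (5 / 2) ^ 2 / 6 := by
    refine (norm_sub_le _ _).trans ?_
    rw [norm_one, norm_div, norm_mul, norm_pow, hw, Complex.norm_real, Real.norm_eq_abs,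
      abs_of_nonneg he0]
    have : ‖(6 : ℂ)‖ = 6 := by simp
    rw [this]
    gcongr
  have h3 : ‖expPoly e w‖ ≤ 1 + 1 * (5 / 2) / 8 + 1 ^ 2 * (5 / 2) ^ 2 / 128 +
      1 ^ 3 * (5 / 2) ^ 3 / 3072 := by
    rw [expPoly]
    refine (norm_add_le_of_le (norm_add_le_of_le (norm_add_le_of_le le_rfl le_rfl) le_rfl)
      le_rfl).trans ?_
    simp only [norm_one, norm_div, norm_mul, norm_pow, hw, Complex.norm_ofNat]
    gcongr
  rw [norm_mul]
  refine (mul_le_mul h3 h2 (norm_nonneg _) (by norm_num)).trans ?_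
  norm_num

lemma norm_remainder_one_le {k : ℕ} (hk : 2 ≤ k) {v : ℝ} (h0 : 0 < v) (h1 : v ≤ 5 / 2) :
    ‖wFun k v - dphi k v * corrOne (eps k) (v * Complex.I)‖ ≤
      2455 / 10 ^ 8 * v ^ 5 + 722 / 10 ^ 8 * v ^ 6 + 1900 / 10 ^ 8 * v ^ 7 := by
  have he := eps_le hk
  have he0 := (eps_pos k).le
  have hw := norm_ofReal_mul_I h0.le
  have hpoly := norm_remainder_one_poly_le he0 he h0.le h1 hw
  have hH := norm_expPoly_mul_le he0 he h0.le h1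
  have hA := norm_ampl_sub_le hk h0 h1
  have hG := norm_corrOne_le he0 he h0.le h1 hw
  have hp := norm_phi_sub_le hk h0.le
  have hd := norm_dphi_sub_le hk h0.le
  have hq := phiPoly_eq (eps k) (v * Complex.I)
  have hph := norm_phi_le hk h0.le
  set w : ℂ := v * Complex.I with hwdef
  have hw0 : w ≠ 0 := by rw [← norm_pos_iff, hw]; exact h0
  set H : ℂ := expPoly (eps k) w * (1 - eps k * w ^ 2 / 6)
  clear_value H
  have hsplit : wFun k v - dphi k v * corrOne (eps k) w =
      (phiQuot (eps k) w * H - dphiPoly (eps k) w * corrOne (eps k) w) +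
      phi k v / w * (ampl k v - H) + (phi k v - phiPoly (eps k) w) / w * H +
      -((dphi k v - dphiPoly (eps k) w) * corrOne (eps k) w) := by
    rw [wFun, ← hwdef, hq]; field_simp; ring
  rw [hsplit]
  refine (norm_add_le_of_le (norm_add_le_of_le (norm_add_le_of_le hpoly le_rfl) le_rfl)
    le_rfl).trans ?_
  rw [norm_neg, norm_mul, norm_mul, norm_mul, norm_div, norm_div, hw]
  have t1 : ‖phi k v‖ / v * ‖ampl k v - H‖ ≤ v ^ 2 / 12 / v * (58 / 10 ^ 6 * v ^ 4) := by gcongr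
  have t2 : ‖phi k v - phiPoly (eps k) w‖ / v * ‖H‖ ≤ v ^ 8 / 685440 / v * (3 / 2) := by gcongr
  have t3 : ‖dphi k v - dphiPoly (eps k) w‖ * ‖corrOne (eps k) w‖ ≤ v ^ 7 / 85680 * (56 / 100) := by
    gcongr
  have s1 : v ^ 2 / 12 / v * (58 / 10 ^ 6 * v ^ 4) = 58 / 10 ^ 6 / 12 * v ^ 5 := by field_simp
  have s2 : v ^ 8 / 685440 / v * (3 / 2) = 3 / 2 / 685440 * v ^ 7 := by field_simp
  rw [s1] at t1
  rw [s2] at t2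
  have h5 : 0 < v ^ 5 := by positivity
  have h7 : 0 < v ^ 7 := by positivity
  linarith

lemma norm_remainder_two_le {k : ℕ} (hk : 2 ≤ k) {v : ℝ} (h0 : 0 ≤ v) (h1 : v ≤ 5 / 2) :
    ‖corrOneDeriv (eps k) (v * Complex.I) - dphi k v * corrTwo (eps k) (v * Complex.I)‖ ≤
      818 / 10 ^ 6 * v ^ 3 + 306 / 10 ^ 6 * v ^ 4 + 142 / 10 ^ 6 * v ^ 5 := by
  have he := eps_le hk
  have he0 := (eps_pos k).le
  have hw := norm_ofReal_mul_I h0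
  have hpoly := norm_remainder_two_poly_le he0 he h0 h1 hw
  have hG := norm_corrTwo_le he0 he h0 h1 hw
  have hd := norm_dphi_sub_le hk h0
  set w : ℂ := v * Complex.I with hwdef
  have hsplit : corrOneDeriv (eps k) w - dphi k v * corrTwo (eps k) w =
      (corrOneDeriv (eps k) w - dphiPoly (eps k) w * corrTwo (eps k) w) +
      -((dphi k v - dphiPoly (eps k) w) * corrTwo (eps k) w) := by ring
  rw [hsplit]
  refine (norm_add_le_of_le hpoly le_rfl).trans ?_
  rw [norm_neg, norm_mul]
  have t3 : ‖dphi k v - dphiPoly (eps k) w‖ * ‖corrTwo (eps k) w‖ ≤ v ^ 7 / 85680 * (20 / 100) := by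
    gcongr
  have : v ^ 7 ≤ (5 / 2) ^ 2 * v ^ 5 := by
    rw [show v ^ 7 = v ^ 2 * v ^ 5 by ring]; gcongr
  have h5 : 0 ≤ v ^ 5 := by positivity
  linarith

lemma norm_ampl_le {k : ℕ} {v : ℝ} (h0 : 0 ≤ v) (h1 : v ≤ Real.pi * (2 * k + 1) / 2) :
    ‖ampl k v‖ ≤ Real.pi / 2 := by
  rw [ampl, norm_mul, Complex.norm_exp_ofReal_mul_I, one_mul, Complex.norm_real, Real.norm_eq_abs]
  rcases h0.eq_or_lt with rfl | h0
  · simp; positivity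
  have hs0 : 0 < v / (2 * (k : ℝ) + 1) := by positivity
  have hs1 : v / (2 * (k : ℝ) + 1) ≤ Real.pi / 2 := by
    rw [div_le_iff₀ (by positivity)]; linarith
  have hsin := Real.mul_le_sin hs0.le hs1
  have hpos : 0 < Real.sin (v / (2 * (k : ℝ) + 1)) :=
    Real.sin_pos_of_pos_of_lt_pi hs0 (by linarith [Real.pi_pos])
  rw [abs_of_pos (by positivity), div_le_iff₀ hpos]
  calc v / (2 * (k : ℝ) + 1) = Real.pi / 2 * (2 / Real.pi * (v / (2 * k + 1))) := by
        field_simp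
    _ ≤ _ := by gcongr

lemma norm_wFun_le {k : ℕ} (hk : 2 ≤ k) {v : ℝ} (h0 : 0 ≤ v)
    (h1 : v ≤ Real.pi * (2 * k + 1) / 2) : ‖wFun k v‖ ≤ v / 12 * (Real.pi / 2) := by
  rcases h0.eq_or_lt with rfl | h0
  · simp [wFun]
  rw [wFun, norm_mul, norm_div, norm_ofReal_mul_I h0.le]
  refine mul_le_mul ?_ (norm_ampl_le h0.le h1) (norm_nonneg _) (by positivity)
  rw [div_le_iff₀ h0]
  exact (norm_phi_le hk h0.le).trans_eq (by ring)

lemma phi_re_nonpos {k : ℕ} (hk : 2 ≤ k) (v : ℝ) : (phi k v).re ≤ 0 := by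
  rw [phi_re, neg_nonpos]
  exact mul_nonneg (scale_pos hk).le (cosDef_nonneg k _)

lemma norm_exp_phi (k : ℕ) (tau v : ℝ) :
    ‖Complex.exp (tau * phi k v)‖ = Real.exp (tau * (phi k v).re) := by
  rw [Complex.norm_exp, Complex.re_ofReal_mul]

lemma intervalIntegrable_wFun {k : ℕ} (hk : 2 ≤ k) {tau : ℝ} (ht : 0 ≤ tau) {a b : ℝ}
    (ha : 0 ≤ a) (hab : a ≤ b) (hb : b ≤ Real.pi * (2 * k + 1) / 2) :
    IntervalIntegrable (fun v => (Complex.exp (tau * phi k v) * wFun k v).re) volume a b := by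
  have hm : Measurable fun v => (Complex.exp (tau * phi k v) * wFun k v).re := by
    have := (continuous_phi k).measurable
    fun_prop
  refine (intervalIntegrable_const (c := b / 12 * (Real.pi / 2))).mono_fun
    hm.aestronglyMeasurable ?_
  refine (ae_restrict_mem measurableSet_uIoc).mono fun v hv => ?_
  rw [Set.uIoc_of_le hab] at hv
  have hv0 : 0 ≤ v := ha.trans hv.1.le
  have hb0 : 0 ≤ b / 12 * (Real.pi / 2) := mul_nonneg (by linarith) (by positivity)
  simp only [Real.norm_eq_abs, abs_of_nonneg hb0]
  refine (Complex.abs_re_le_norm _).trans ?_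
  rw [norm_mul, norm_exp_phi]
  have : Real.exp (tau * (phi k v).re) ≤ 1 :=
    Real.exp_le_one_iff.2 (mul_nonpos_of_nonneg_of_nonpos ht (phi_re_nonpos hk v))
  have h2 := norm_wFun_le hk hv0 (hv.2.trans hb)
  calc _ ≤ 1 * (v / 12 * (Real.pi / 2)) := by gcongr
    _ ≤ _ := by rw [one_mul]; gcongr; exact hv.2

lemma integral_odd_mul_exp_le {b V p q s : ℝ} (hb : 0 < b) (hp : 0 ≤ p)
    (hq : 0 ≤ q) (hs : 0 ≤ s) :
    ∫ v in (0 : ℝ)..V, (p * v ^ 3 + q * v ^ 5 + s * v ^ 7) * Real.exp (-(b * v ^ 2)) ≤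
      p / (2 * b ^ 2) + q / b ^ 3 + 3 * s / b ^ 4 := by
  have hd : ∀ v : ℝ, HasDerivAt (fun v : ℝ => -(p * ((b * v ^ 2 + 1) / (2 * b ^ 2)) +
      q * ((b ^ 2 * v ^ 4 + 2 * b * v ^ 2 + 2) / (2 * b ^ 3)) +
      s * ((b ^ 3 * v ^ 6 + 3 * b ^ 2 * v ^ 4 + 6 * b * v ^ 2 + 6) / (2 * b ^ 4))) *
      Real.exp (-(b * v ^ 2)))
      ((p * v ^ 3 + q * v ^ 5 + s * v ^ 7) * Real.exp (-(b * v ^ 2))) v := by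
    intro v
    have d (n : ℕ) := hasDerivAt_pow n v
    have he := (((d 2).const_mul b).neg).exp
    have h1 := (((((d 2).const_mul b).add_const 1).div_const (2 * b ^ 2)).const_mul p)
    have h2 := ((((((d 4).const_mul (b ^ 2)).fun_add ((d 2).const_mul (2 * b))).add_const
      2).div_const (2 * b ^ 3)).const_mul q)
    have h3 := (((((((d 6).const_mul (b ^ 3)).fun_add ((d 4).const_mul (3 * b ^ 2))).fun_add
      ((d 2).const_mul (6 * b))).add_const 6).div_const (2 * b ^ 4)).const_mul s)
    refine ((((h1.fun_add h2).fun_add h3).fun_neg).fun_mul he).congr_deriv ?_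
    simp only [Pi.neg_apply]
    field_simp
    push_cast
    ring
  rw [intervalIntegral.integral_eq_sub_of_hasDerivAt (fun v _ => hd v)
    (Continuous.intervalIntegrable (by fun_prop) _ _)]
  have h1 : 0 ≤ (p * ((b * V ^ 2 + 1) / (2 * b ^ 2)) +
      q * ((b ^ 2 * V ^ 4 + 2 * b * V ^ 2 + 2) / (2 * b ^ 3)) +
      s * ((b ^ 3 * V ^ 6 + 3 * b ^ 2 * V ^ 4 + 6 * b * V ^ 2 + 6) / (2 * b ^ 4))) *
      Real.exp (-(b * V ^ 2)) := by positivity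
  have h2 : p * (1 / (2 * b ^ 2)) + q * (2 / (2 * b ^ 3)) + s * (6 / (2 * b ^ 4)) =
      p / (2 * b ^ 2) + q / b ^ 3 + 3 * s / b ^ 4 := by
    field_simp; ring
  rw [← h2]
  norm_num
  linarith

lemma le_integral_exp_neg_sq {r : ℝ} (hr : 7 ≤ r) :
    28151 / 10000 / r ≤ ∫ v in (0 : ℝ)..(5 / 2), Real.exp (-(r ^ 2 * v ^ 2 / 12)) := by
  obtain ⟨c, hc⟩ : ∃ c : ℝ, c = 6928 / 1000 / r := ⟨_, rfl⟩
  have hr0 : 0 < r := by linarith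
  have hc0 : 0 < c := by rw [hc]; positivity
  have hc1 : c ≤ 5 / 2 := by
    rw [hc, div_le_iff₀ hr0]; linarith
  have hrc : r = 6928 / 1000 / c := by rw [hc]; field_simp
  have hcont : Continuous fun v : ℝ => Real.exp (-(r ^ 2 * v ^ 2 / 12)) := by fun_prop
  have h1 : ∫ v in (0 : ℝ)..c, Real.exp (-(r ^ 2 * v ^ 2 / 12)) ≤
      ∫ v in (0 : ℝ)..(5 / 2), Real.exp (-(r ^ 2 * v ^ 2 / 12)) := by
    rw [← intervalIntegral.integral_add_adjacent_intervals (b := c)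
      (hcont.intervalIntegrable _ _) (hcont.intervalIntegrable _ (5 / 2))]
    have : 0 ≤ ∫ v in c..(5 / 2), Real.exp (-(r ^ 2 * v ^ 2 / 12)) :=
      intervalIntegral.integral_nonneg hc1 fun v _ => (Real.exp_pos _).le
    linarith
  refine le_trans ?_ h1
  have hd : ∀ v : ℝ, HasDerivAt (fun v : ℝ => v - 4 / 3 * v ^ 3 / c ^ 2 + 6 / 5 * v ^ 5 / c ^ 4 -
      4 / 7 * v ^ 7 / c ^ 6 + 1 / 9 * v ^ 9 / c ^ 8) ((1 - v ^ 2 / c ^ 2) ^ 4) v := by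
    intro v
    have d (n : ℕ) := hasDerivAt_pow n v
    refine (((((hasDerivAt_id' v).fun_sub (((d 3).const_mul (4 / 3)).div_const (c ^ 2))).fun_add
      (((d 5).const_mul (6 / 5)).div_const (c ^ 4))).fun_sub
      (((d 7).const_mul (4 / 7)).div_const (c ^ 6))).fun_add
      (((d 9).const_mul (1 / 9)).div_const (c ^ 8))).congr_deriv ?_
    field_simp
    push_cast
    ring
  have h2 : ∫ v in (0 : ℝ)..c, (1 - v ^ 2 / c ^ 2) ^ 4 = 128 / 315 * c := by
    rw [intervalIntegral.integral_eq_sub_of_hasDerivAt (fun v _ => hd v)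
      (Continuous.intervalIntegrable (by fun_prop) _ _)]
    field_simp
    ring
  have h3 : ∫ v in (0 : ℝ)..c, (1 - v ^ 2 / c ^ 2) ^ 4 ≤
      ∫ v in (0 : ℝ)..c, Real.exp (-(r ^ 2 * v ^ 2 / 12)) := by
    refine intervalIntegral.integral_mono_on hc0.le
      (Continuous.intervalIntegrable (by fun_prop) _ _) (hcont.intervalIntegrable _ _)
      fun v hv => ?_
    have hle : v ^ 2 / c ^ 2 ≤ 1 := by
      rw [div_le_one (by positivity)]
      have := hv.1; have := hv.2
      gcongr
    have h4 : 1 - v ^ 2 / c ^ 2 ≤ Real.exp (-(v ^ 2 / c ^ 2)) := by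
      linarith [Real.add_one_le_exp (-(v ^ 2 / c ^ 2))]
    calc (1 - v ^ 2 / c ^ 2) ^ 4 ≤ Real.exp (-(v ^ 2 / c ^ 2)) ^ 4 := by
          gcongr
      _ = Real.exp (-(4 * (v ^ 2 / c ^ 2))) := by rw [← Real.exp_nat_mul]; congr 1; push_cast; ring
      _ ≤ _ := by
          apply Real.exp_le_exp.2
          rw [neg_le_neg_iff, hrc]
          have : (6928 / 1000 / c) ^ 2 * v ^ 2 / 12 = (6928 / 1000) ^ 2 / 12 * (v ^ 2 / c ^ 2) := by
            field_simp
          rw [this]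
          have : 0 ≤ v ^ 2 / c ^ 2 := by positivity
          nlinarith
  rw [h2] at h3
  refine le_trans ?_ h3
  rw [hc]
  rw [div_le_iff₀ hr0]
  field_simp
  norm_num

@[fun_prop]
lemma continuous_dphi (k : ℕ) : Continuous (dphi k) := by
  unfold dphi; fun_prop

/-- The corrector used to integrate by parts. -/
noncomputable def corr (e tau w : ℂ) : ℂ := corrOne e w / tau - corrTwo e w / tau ^ 2

/-- The derivative of `corr` in its last argument. -/
noncomputable def corrDeriv (e tau w : ℂ) : ℂ := corrOneDeriv e w / tau - coefEta e / tau ^ 2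

lemma continuous_corr (e tau : ℂ) : Continuous (corr e tau) := by
  unfold corr corrOne corrTwo; fun_prop

lemma continuous_corrDeriv (e tau : ℂ) : Continuous (corrDeriv e tau) := by
  unfold corrDeriv corrOneDeriv; fun_prop

lemma hasDerivAt_exp_mul_corr (k : ℕ) (tau v : ℝ) :
    HasDerivAt (fun v : ℝ => Complex.exp (tau * phi k v) * corr (eps k) tau (v * Complex.I))
      (Complex.I * (Complex.exp (tau * phi k v) *
        (tau * dphi k v * corr (eps k) tau (v * Complex.I) +
          corrDeriv (eps k) tau (v * Complex.I)))) v := by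
  have hw : HasDerivAt (fun v : ℝ => (v : ℂ) * Complex.I) Complex.I v := by
    simpa using (Complex.ofRealCLM.hasDerivAt (x := v)).mul_const Complex.I
  have hg : ∀ w, HasDerivAt (corr (eps k) tau) (corrDeriv (eps k) tau w) w := by
    intro w
    unfold corr corrOne corrTwo
    refine ((((((hasDerivAt_pow 2 w).const_mul _).const_add _).fun_add
      ((hasDerivAt_pow 3 w).const_mul _)).div_const _).fun_sub
      ((((hasDerivAt_id' w).const_mul _).const_add _).div_const _)).congr_deriv ?_
    rw [corrDeriv, corrOneDeriv]
    push_cast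
    ring
  have h1 := ((hasDerivAt_phi k v).const_mul (tau : ℂ)).cexp
  have h2 := (hg (v * Complex.I)).comp v hw
  refine (h1.fun_mul h2).congr_deriv ?_
  simp only [Function.comp_apply]
  ring

lemma hasDerivAt_im_exp_mul_corr (k : ℕ) (tau v : ℝ) :
    HasDerivAt (fun v : ℝ => (Complex.exp (tau * phi k v) * corr (eps k) tau (v * Complex.I)).im)
      (Complex.exp (tau * phi k v) *
        (tau * dphi k v * corr (eps k) tau (v * Complex.I) +
          corrDeriv (eps k) tau (v * Complex.I))).re v := by
  have := Complex.imCLM.hasFDerivAt.comp_hasDerivAt v (hasDerivAt_exp_mul_corr k tau v)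
  refine this.congr_deriv ?_
  rw [Complex.imCLM_apply, Complex.I_mul_im]

lemma wFun_eq (k : ℕ) {tau : ℝ} (ht : tau ≠ 0) (v : ℝ) : wFun k v =
    (tau * dphi k v * corr (eps k) tau (v * Complex.I) + corrDeriv (eps k) tau (v * Complex.I)) +
    ((etaReal (eps k) / tau ^ 2 : ℝ) : ℂ) +
    ((wFun k v - dphi k v * corrOne (eps k) (v * Complex.I)) -
      (corrOneDeriv (eps k) (v * Complex.I) - dphi k v * corrTwo (eps k) (v * Complex.I)) / tau) := by
  have : (tau : ℂ) ≠ 0 := by exact_mod_cast ht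
  rw [corr, corrDeriv, coefEta_eq]
  push_cast
  field_simp
  ring

lemma exp_phi_le {k : ℕ} (hk : 2 ≤ k) {r v : ℝ} (h0 : 0 ≤ v) (h1 : v ≤ 5 / 2) :
    Real.exp (r ^ 2 * (phi k v).re) ≤ Real.exp (-(11 * r ^ 2 / 192 * v ^ 2)) := by
  apply Real.exp_le_exp.2
  have := le_neg_phi_re hk h0 h1
  have := mul_le_mul_of_nonneg_left this (sq_nonneg r)
  linarith

lemma le_re_exp_phi {k : ℕ} (hk : 2 ≤ k) {r v : ℝ} (h0 : 0 ≤ v) (h1 : v ≤ 5 / 2) :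
    Real.exp (-(r ^ 2 * v ^ 2 / 12)) -
      Real.exp (-(11 * r ^ 2 / 192 * v ^ 2)) * (r ^ 4 * v ^ 6 / 4608) ≤
      (Complex.exp (((r ^ 2 : ℝ) : ℂ) * phi k v)).re := by
  rw [Complex.exp_re, Complex.re_ofReal_mul, Complex.im_ofReal_mul]
  have hc := Real.one_sub_sq_div_two_le_cos (x := r ^ 2 * (phi k v).im)
  have hi : (phi k v).im ^ 2 ≤ (v ^ 3 / 48) ^ 2 := by
    rw [← sq_abs]
    have := abs_phi_im_le hk h0
    gcongr
  have hE := exp_phi_le hk (r := r) h0 h1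
  have hE' : Real.exp (-(r ^ 2 * v ^ 2 / 12)) ≤ Real.exp (r ^ 2 * (phi k v).re) := by
    apply Real.exp_le_exp.2
    have := mul_le_mul_of_nonneg_left (neg_phi_re_le hk v) (sq_nonneg r)
    linarith
  have hpos := Real.exp_pos (r ^ 2 * (phi k v).re)
  calc _ ≤ Real.exp (r ^ 2 * (phi k v).re) - Real.exp (r ^ 2 * (phi k v).re) *
        (r ^ 4 * v ^ 6 / 4608) := by gcongr
    _ = Real.exp (r ^ 2 * (phi k v).re) * (1 - r ^ 4 * (v ^ 3 / 48) ^ 2 / 2) := by ring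
    _ ≤ Real.exp (r ^ 2 * (phi k v).re) * (1 - r ^ 4 * (phi k v).im ^ 2 / 2) := by gcongr
    _ = Real.exp (r ^ 2 * (phi k v).re) * (1 - (r ^ 2 * (phi k v).im) ^ 2 / 2) := by ring
    _ ≤ _ := by gcongr

/-- The pointwise lower bound for the normalized integrand. -/
lemma le_re_exp_mul_wFun {k : ℕ} (hk : 2 ≤ k) {r v : ℝ} (hr : 0 < r) (h0 : 0 < v)
    (h1 : v ≤ 5 / 2) :
    (Complex.exp (((r ^ 2 : ℝ) : ℂ) * phi k v) *
        (((r ^ 2 : ℝ) : ℂ) * dphi k v * corr (eps k) ((r ^ 2 : ℝ) : ℂ) (v * Complex.I) +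
          corrDeriv (eps k) ((r ^ 2 : ℝ) : ℂ) (v * Complex.I))).re +
      etaReal (eps k) / r ^ 4 * Real.exp (-(r ^ 2 * v ^ 2 / 12)) -
      ((818 / 10 ^ 6 + 3 * (306 / 10 ^ 6) / r) / r ^ 2 * v ^ 3 +
        (2455 / 10 ^ 8 + 15 / 4 / r * (722 / 10 ^ 8 + 869 / 10 ^ 8) +
          (306 / 10 ^ 6 * r / 12 + 142 / 10 ^ 6) / r ^ 2) * v ^ 5 +
        (1900 / 10 ^ 8 + r / 15 * (722 / 10 ^ 8 + 869 / 10 ^ 8)) * v ^ 7) *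
        Real.exp (-(11 * r ^ 2 / 192 * v ^ 2)) ≤
    (Complex.exp (((r ^ 2 : ℝ) : ℂ) * phi k v) * wFun k v).re := by
  have hr2 : r ^ 2 ≠ 0 := by positivity
  have he := eps_le hk
  have he0 := (eps_pos k).le
  have hη0 := le_etaReal he0 he
  have hη1 := etaReal_le he0 he
  have hR1 := norm_remainder_one_le hk h0 h1
  have hR2 := norm_remainder_two_le hk h0.le h1
  have hre := le_re_exp_phi hk (r := r) h0.le h1
  have hE := exp_phi_le hk (r := r) h0.le h1
  have hsplit := wFun_eq k hr2 v
  set A := ((r ^ 2 : ℝ) : ℂ) * dphi k v * corr (eps k) ((r ^ 2 : ℝ) : ℂ) (v * Complex.I) +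
          corrDeriv (eps k) ((r ^ 2 : ℝ) : ℂ) (v * Complex.I)
  set R1 := wFun k v - dphi k v * corrOne (eps k) (v * Complex.I)
  set R2 := corrOneDeriv (eps k) (v * Complex.I) - dphi k v * corrTwo (eps k) (v * Complex.I)
  set E := Complex.exp (((r ^ 2 : ℝ) : ℂ) * phi k v) with hEdef
  have hEn : ‖E‖ = Real.exp (r ^ 2 * (phi k v).re) := norm_exp_phi k (r ^ 2) v
  set X := Real.exp (-(11 * r ^ 2 / 192 * v ^ 2))
  have hX : 0 < X := Real.exp_pos _
  clear_value A R1 R2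
  rw [hsplit, mul_add E, mul_add E, Complex.add_re, Complex.add_re, mul_comm E (Complex.ofReal _),
    Complex.re_ofReal_mul]
  have hlast : -(X * ((2455 / 10 ^ 8 * v ^ 5 + 722 / 10 ^ 8 * v ^ 6 + 1900 / 10 ^ 8 * v ^ 7) +
      (818 / 10 ^ 6 * v ^ 3 + 306 / 10 ^ 6 * v ^ 4 + 142 / 10 ^ 6 * v ^ 5) / r ^ 2)) ≤
      (E * (R1 - R2 / ((r ^ 2 : ℝ) : ℂ))).re := by
    refine (abs_le.1 ((Complex.abs_re_le_norm _).trans ?_)).1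
    rw [norm_mul, hEn]
    refine mul_le_mul hE ((norm_sub_le _ _).trans ?_) (norm_nonneg _) hX.le
    rw [norm_div, Complex.norm_real, Real.norm_eq_abs, abs_of_pos (by positivity : 0 < r ^ 2)]
    gcongr
  have hmid : etaReal (eps k) / r ^ 4 * Real.exp (-(r ^ 2 * v ^ 2 / 12)) -
      X * (869 / 10 ^ 8 * v ^ 6) ≤
      etaReal (eps k) / (r ^ 2) ^ 2 * E.re := by
    have h2 : etaReal (eps k) / r ^ 4 * (X * (r ^ 4 * v ^ 6 / 4608)) ≤
        X * (869 / 10 ^ 8 * v ^ 6) := by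
      have : etaReal (eps k) / r ^ 4 * (X * (r ^ 4 * v ^ 6 / 4608)) =
        X * (etaReal (eps k) / 4608 * v ^ 6) := by field_simp
      rw [this]
      have h4 : etaReal (eps k) / 4608 ≤ 869 / 10 ^ 8 := by linarith
      exact mul_le_mul_of_nonneg_left (mul_le_mul_of_nonneg_right h4 (by positivity)) hX.le
    have h3 := mul_le_mul_of_nonneg_left hre (by positivity : 0 ≤ etaReal (eps k) / r ^ 4)
    rw [← pow_mul]
    linarith
  have p6 : v ^ 6 ≤ 15 / 4 / r * v ^ 5 + r / 15 * v ^ 7 := by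
    have : 0 ≤ v ^ 5 * (r / 15) * (v - 15 / 2 / r) ^ 2 := by positivity
    have h : v ^ 5 * (r / 15) * (v - 15 / 2 / r) ^ 2 =
      15 / 4 / r * v ^ 5 + r / 15 * v ^ 7 - v ^ 6 := by field_simp; ring
    linarith
  have p4 : v ^ 4 / r ^ 2 ≤ (3 / r * v ^ 3 + r / 12 * v ^ 5) / r ^ 2 := by
    gcongr
    have : 0 ≤ v ^ 3 * (r / 12) * (v - 6 / r) ^ 2 := by positivity
    have h : v ^ 3 * (r / 12) * (v - 6 / r) ^ 2 =
      3 / r * v ^ 3 + r / 12 * v ^ 5 - v ^ 4 := by field_simp; ring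
    linarith
  have hfin : X * ((2455 / 10 ^ 8 * v ^ 5 + 722 / 10 ^ 8 * v ^ 6 + 1900 / 10 ^ 8 * v ^ 7) +
      (818 / 10 ^ 6 * v ^ 3 + 306 / 10 ^ 6 * v ^ 4 + 142 / 10 ^ 6 * v ^ 5) / r ^ 2) +
      X * (869 / 10 ^ 8 * v ^ 6) ≤
      X * ((818 / 10 ^ 6 + 3 * (306 / 10 ^ 6) / r) / r ^ 2 * v ^ 3 +
        (2455 / 10 ^ 8 + 15 / 4 / r * (722 / 10 ^ 8 + 869 / 10 ^ 8) +
          (306 / 10 ^ 6 * r / 12 + 142 / 10 ^ 6) / r ^ 2) * v ^ 5 +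
        (1900 / 10 ^ 8 + r / 15 * (722 / 10 ^ 8 + 869 / 10 ^ 8)) * v ^ 7) := by
    rw [← mul_add]
    refine mul_le_mul_of_nonneg_left ?_ hX.le
    linear_combination (1591 / 10 ^ 8) * p6 + (306 / 10 ^ 6) * p4
  linarith

lemma norm_corr_le {k : ℕ} (hk : 2 ≤ k) {r : ℝ} (hr : 1 ≤ r) :
    ‖corr (eps k) ((r ^ 2 : ℝ) : ℂ) ((5 / 2 : ℝ) * Complex.I)‖ ≤ 1 / r ^ 2 := by
  have he := eps_le hk
  have he0 := (eps_pos k).le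
  have hw := norm_ofReal_mul_I (show (0 : ℝ) ≤ 5 / 2 by norm_num)
  have h1 := norm_corrOne_le he0 he (by norm_num) le_rfl hw
  have h2 := norm_corrTwo_le he0 he (by norm_num) le_rfl hw
  rw [corr]
  refine (norm_sub_le _ _).trans ?_
  rw [norm_div, norm_div, norm_pow, Complex.norm_real, Real.norm_eq_abs,
    abs_of_nonneg (by positivity : 0 ≤ r ^ 2)]
  have hr2 : 1 ≤ r ^ 2 := by nlinarith
  have t1 : ‖corrOne (eps k) ((5 / 2 : ℝ) * Complex.I)‖ / r ^ 2 ≤ 56 / 100 / r ^ 2 := by gcongr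
  have t2 : ‖corrTwo (eps k) ((5 / 2 : ℝ) * Complex.I)‖ / (r ^ 2) ^ 2 ≤ 20 / 100 / r ^ 2 := by
    gcongr
    nlinarith
  have : 56 / 100 / r ^ 2 + 20 / 100 / r ^ 2 ≤ 1 / r ^ 2 := by
    rw [← add_div]; gcongr; norm_num
  linarith

lemma corr_zero_im (e tau : ℝ) : (corr e tau 0).im = 0 := by
  have : corr e tau 0 = ((1 / 2 / tau -
      12 * (-(7 / 1280) - 41 / 640 * e + 5 / 256 * e ^ 2) / tau ^ 2 : ℝ) : ℂ) := by
    rw [corr, corrOne, corrTwo, coefTwo]; push_cast; ring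
  rw [this, Complex.ofReal_im]

/-- A lower bound for the integral over the central range. -/
lemma le_central_integral {k : ℕ} (hk : 2 ≤ k) {r : ℝ} (hr : 0 < r) (hr60 : 60 ≤ r ^ 2) :
    1 / 200 / r ^ 5 ≤
      ∫ v in (0 : ℝ)..(5 / 2), (Complex.exp (((r ^ 2 : ℝ) : ℂ) * phi k v) * wFun k v).re := by
  have hr7 : 774 / 100 ≤ r := by nlinarith
  have he := eps_le hk
  have he0 := (eps_pos k).le
  have hη0 := le_etaReal he0 he
  have hk0 : (2 : ℝ) ≤ k := by exact_mod_cast hk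
  have hV : (5 / 2 : ℝ) ≤ Real.pi * (2 * k + 1) / 2 := by nlinarith [Real.pi_gt_three]
  obtain ⟨a, ha⟩ : ∃ a : ℝ, a = (818 / 10 ^ 6 + 3 * (306 / 10 ^ 6) / r) / r ^ 2 := ⟨_, rfl⟩
  obtain ⟨b, hb⟩ : ∃ b : ℝ, b = 2455 / 10 ^ 8 + 15 / 4 / r * (722 / 10 ^ 8 + 869 / 10 ^ 8) +
          (306 / 10 ^ 6 * r / 12 + 142 / 10 ^ 6) / r ^ 2 := ⟨_, rfl⟩
  obtain ⟨c, hc⟩ : ∃ c : ℝ, c = 1900 / 10 ^ 8 + r / 15 * (722 / 10 ^ 8 + 869 / 10 ^ 8) := ⟨_, rfl⟩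
  obtain ⟨D, hD⟩ : ∃ D : ℝ → ℝ, D = fun v => (Complex.exp (((r ^ 2 : ℝ) : ℂ) * phi k v) *
        (((r ^ 2 : ℝ) : ℂ) * dphi k v * corr (eps k) ((r ^ 2 : ℝ) : ℂ) (v * Complex.I) +
          corrDeriv (eps k) ((r ^ 2 : ℝ) : ℂ) (v * Complex.I))).re := ⟨_, rfl⟩
  have hDc : Continuous D := by
    have c0 : Continuous fun v : ℝ => (v : ℂ) * Complex.I := by fun_prop
    have c1 := (continuous_corr (eps k) ((r ^ 2 : ℝ) : ℂ)).comp c0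
    have c2 := (continuous_corrDeriv (eps k) ((r ^ 2 : ℝ) : ℂ)).comp c0
    rw [hD]
    exact Complex.continuous_re.comp ((continuous_const.mul (continuous_phi k)).cexp.mul
      (((continuous_const.mul (continuous_dphi k)).mul c1).add c2))
  have hmono : ∫ v in (0 : ℝ)..(5 / 2), (D v +
      etaReal (eps k) / r ^ 4 * Real.exp (-(r ^ 2 * v ^ 2 / 12)) -
      (a * v ^ 3 + b * v ^ 5 + c * v ^ 7) * Real.exp (-(11 * r ^ 2 / 192 * v ^ 2))) ≤
      ∫ v in (0 : ℝ)..(5 / 2), (Complex.exp (((r ^ 2 : ℝ) : ℂ) * phi k v) * wFun k v).re := by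
    refine intervalIntegral.integral_mono_on_of_le_Ioo (by norm_num)
      (Continuous.intervalIntegrable (by fun_prop) _ _)
      (intervalIntegrable_wFun hk (sq_nonneg r) le_rfl (by norm_num) hV) fun v hv => ?_
    have := le_re_exp_mul_wFun hk hr hv.1 hv.2.le
    rw [hD, ha, hb, hc]
    exact this
  refine le_trans ?_ hmono
  rw [intervalIntegral.integral_sub (Continuous.intervalIntegrable (by fun_prop) _ _)
      (Continuous.intervalIntegrable (by fun_prop) _ _),
    intervalIntegral.integral_add (Continuous.intervalIntegrable (by fun_prop) _ _)
      (Continuous.intervalIntegrable (by fun_prop) _ _), intervalIntegral.integral_const_mul]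
  have hodd := integral_odd_mul_exp_le (V := 5 / 2) (b := 11 * r ^ 2 / 192) (p := a) (q := b)
    (s := c) (by positivity) (by rw [ha]; positivity) (by rw [hb]; positivity)
    (by rw [hc]; positivity)
  have hgauss := le_integral_exp_neg_sq (r := r) (by linarith)
  have hDint : ∫ v in (0 : ℝ)..(5 / 2), D v =
      (Complex.exp (((r ^ 2 : ℝ) : ℂ) * phi k (5 / 2)) *
        corr (eps k) ((r ^ 2 : ℝ) : ℂ) (((5 / 2 : ℝ) : ℂ) * Complex.I)).im := by
    rw [hD, intervalIntegral.integral_eq_sub_of_hasDerivAt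
      (fun v _ => hasDerivAt_im_exp_mul_corr k (r ^ 2) v)
      (by rw [← hD]; exact hDc.intervalIntegrable _ _), phi_zero, mul_zero, Complex.exp_zero,
      one_mul, Complex.ofReal_zero, zero_mul, corr_zero_im, sub_zero]
  have hbd : -(1 / 2000 / r ^ 5) ≤ ∫ v in (0 : ℝ)..(5 / 2), D v := by
    rw [hDint]
    refine (abs_le.1 ((Complex.abs_im_le_norm _).trans ?_)).1
    rw [norm_mul, norm_exp_phi]
    have h1 := exp_phi_le hk (r := r) (v := 5 / 2) (by norm_num) le_rfl
    have h2 := norm_corr_le hk (r := r) (by linarith)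
    have h3 := Real.pow_div_factorial_le_exp (11 * r ^ 2 / 192 * (5 / 2) ^ 2) (by positivity) 8
    refine (mul_le_mul h1 h2 (norm_nonneg _) (Real.exp_pos _).le).trans ?_
    rw [Real.exp_neg, inv_mul_eq_div, div_div, div_le_div_iff₀ (by positivity) (by positivity)]
    have h4 : 60 ^ 6 ≤ (r ^ 2) ^ 6 := by gcongr
    have h5 : 2000 * r ^ 3 ≤
        (11 * r ^ 2 / 192 * (5 / 2) ^ 2) ^ 8 / ((8).factorial : ℝ) := by
      have : (11 * r ^ 2 / 192 * (5 / 2) ^ 2) ^ 8 / ((8).factorial : ℝ) =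
        (11 / 192 * (5 / 2) ^ 2) ^ 8 / 40320 * (r ^ 2) ^ 6 * r * r ^ 3 := by
        simp [Nat.factorial]; ring
      rw [this]
      gcongr
      calc (2000 : ℝ) ≤ (11 / 192 * (5 / 2) ^ 2) ^ 8 / 40320 * 60 ^ 6 * (774 / 100) := by norm_num
        _ ≤ _ := by gcongr
    calc 1 * r ^ 5 = 1 / 2000 * (r ^ 2 * (2000 * r ^ 3)) := by ring
      _ ≤ 1 / 2000 * (r ^ 2 * Real.exp (11 * r ^ 2 / 192 * (5 / 2) ^ 2)) := by
        gcongr; exact h5.trans h3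
      _ = _ := by ring
  have hmain : 33 / 1280 * (28151 / 10000) / r ^ 5 ≤ etaReal (eps k) / r ^ 4 *
      ∫ v in (0 : ℝ)..(5 / 2), Real.exp (-(r ^ 2 * v ^ 2 / 12)) := by
    calc 33 / 1280 * (28151 / 10000) / r ^ 5 = 33 / 1280 / r ^ 4 * (28151 / 10000 / r) := by
          field_simp
      _ ≤ _ := by gcongr
  have herr : a / (2 * (11 * r ^ 2 / 192) ^ 2) + b / (11 * r ^ 2 / 192) ^ 3 +
      3 * c / (11 * r ^ 2 / 192) ^ 4 ≤ 65 / 1000 / r ^ 5 := by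
    have hp1 : 1 / r ≤ 100 / 774 := by
      rw [div_le_div_iff₀ hr (by norm_num)]; linarith
    have hp2 : (1 / r) ^ 2 ≤ 1 / 60 := by
      rw [div_pow, one_pow, div_le_div_iff₀ (by positivity) (by norm_num)]; linarith
    have hp3 : (1 / r) ^ 3 ≤ 1 / 60 * (100 / 774) := by
      rw [pow_succ]; gcongr
    obtain ⟨p, hp⟩ : ∃ p : ℝ, p = 1 / r := ⟨_, rfl⟩
    rw [← hp] at hp1 hp2 hp3
    have hr' : r = 1 / p := by rw [hp]; simp
    have hp0 : 0 < p := by rw [hp]; positivity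
    have : a / (2 * (11 * r ^ 2 / 192) ^ 2) + b / (11 * r ^ 2 / 192) ^ 3 +
      3 * c / (11 * r ^ 2 / 192) ^ 4 = (18432 / 121 * (818 / 10 ^ 6 * p + 918 / 10 ^ 6 * p ^ 2) +
        7077888 / 1331 * (2455 / 10 ^ 8 * p + 15 / 4 * (1591 / 10 ^ 8) * p ^ 2 +
          306 / 10 ^ 6 / 12 * p ^ 2 + 142 / 10 ^ 6 * p ^ 3) +
        4076863488 / 14641 * (1900 / 10 ^ 8 * p ^ 3 + 1591 / 10 ^ 8 / 15 * p ^ 2)) / r ^ 5 := by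
      rw [ha, hb, hc, hr']
      field_simp
      ring
    rw [this]
    gcongr
    linarith
  have hsum : -(1 / 2000 / r ^ 5) + 33 / 1280 * (28151 / 10000) / r ^ 5 - 65 / 1000 / r ^ 5 =
    (33 / 1280 * (28151 / 10000) - 65 / 1000 - 1 / 2000) / r ^ 5 := by ring
  have : 1 / 200 / r ^ 5 ≤ (33 / 1280 * (28151 / 10000) - 65 / 1000 - 1 / 2000) / r ^ 5 := by
    gcongr; norm_num
  linarith

lemma two_mul_cosSum_mul_sin (k : ℕ) (t : ℝ) :
    2 * cosSum k t * Real.sin (t / 2) = Real.sin ((k + 1 / 2) * t) - Real.sin (t / 2) := by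
  induction k with
  | zero => simp [cosSum]; try ring_nf
  | succ k ih =>
    have h : cosSum (k + 1) t = cosSum k t + Real.cos ((k + 1) * t) := by
      simp [cosSum, sum_range_succ]
    have h1 : ((k + 1 : ℕ) + 1 / 2 : ℝ) * t = (k + 1) * t + t / 2 := by push_cast; ring
    have h2 : ((k : ℝ) + 1 / 2) * t = (k + 1) * t - t / 2 := by ring
    rw [h2] at ih
    rw [h, h1, Real.sin_add]
    rw [Real.sin_sub] at ih
    linear_combination ih

/-- Away from the origin the real part of `phi` is bounded away from zero. -/
lemma phi_re_le_tail {k : ℕ} (hk : 2 ≤ k) {v : ℝ} (h0 : 5 / 2 ≤ v)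
    (h1 : v ≤ Real.pi * (2 * k + 1) / 2) : (phi k v).re ≤ -(36 / 100) := by
  have hk0 : (2 : ℝ) ≤ k := by exact_mod_cast hk
  obtain ⟨N, hN⟩ : ∃ N : ℝ, N = 2 * (k : ℝ) + 1 := ⟨_, rfl⟩
  have hN5 : 5 ≤ N := by linarith
  obtain ⟨s, hs⟩ : ∃ s : ℝ, s = v / N := ⟨_, rfl⟩
  have hv : v = N * s := by rw [hs]; field_simp
  have hs0 : 0 < s := by rw [hs]; positivity
  have hpi := Real.pi_pos
  have hs1 : s ≤ Real.pi / 2 := by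
    rw [hs, div_le_iff₀ (by linarith), hN]; linarith
  have hsin : 0 < Real.sin s := Real.sin_pos_of_pos_of_lt_pi hs0 (by linarith)
  have key : Real.sin v ≤ 28 / 100 * (N * Real.sin s) := by
    rcases le_total v Real.pi with hvp | hvp
    · have h2 : Real.sin v ≤ Real.pi - v := by
        rw [← Real.sin_pi_sub]
        exact Real.sin_le (by linarith)
      have h3 := sub_sin_le hs0.le
      have hs2 : s ≤ 63 / 100 := by
        have := Real.pi_lt_d2
        nlinarith
      have h4 : s * (1 - 662 / 10000) ≤ Real.sin s := by
        have : s ^ 3 / 6 ≤ s * (662 / 10000) := by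
          have : s ^ 3 = s * s ^ 2 := by ring
          have : s ^ 2 ≤ (63 / 100) ^ 2 := by gcongr
          nlinarith
        linarith
      have h5 : N * (s * (1 - 662 / 10000)) ≤ N * Real.sin s := by gcongr
      have := Real.pi_lt_d2
      nlinarith
    · rcases le_total v (2 * Real.pi) with hv2 | hv2
      · have : Real.sin v ≤ 0 := by
          rw [← Real.sin_sub_two_pi]
          exact Real.sin_nonpos_of_nonpos_of_neg_pi_le (by linarith) (by linarith)
        have : 0 ≤ 28 / 100 * (N * Real.sin s) := by positivity
        linarith
      · have h2 := Real.mul_le_sin hs0.le hs1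
        have h3 : 4 ≤ N * Real.sin s := by
          calc (4 : ℝ) = 2 / Real.pi * (2 * Real.pi) := by field_simp; norm_num
            _ ≤ 2 / Real.pi * v := by gcongr
            _ = N * (2 / Real.pi * s) := by rw [hv]; ring
            _ ≤ _ := by gcongr
        linarith [Real.sin_le_one v]
  have hdir := two_mul_cosSum_mul_sin k (2 * v / (2 * k + 1))
  have e1 : ((k : ℝ) + 1 / 2) * (2 * v / (2 * k + 1)) = v := by field_simp
  have e2 : 2 * v / (2 * (k : ℝ) + 1) / 2 = s := by rw [hs, hN]; field_simp
  rw [e1, e2] at hdir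
  have hA : 36 / 100 * N ≤ cosDef k (2 * v / (2 * k + 1)) := by
    rw [cosDef_eq]
    have : 2 * cosSum k (2 * v / (2 * k + 1)) + 1 ≤ 28 / 100 * N := by
      by_contra hcon
      push Not at hcon
      nlinarith
    linarith
  have hsc := (scale_pos hk).le
  rw [phi_re, neg_le_neg_iff]
  rw [← hN] at hA hsc ⊢
  have he := eps_le hk
  have he0 := (eps_pos k).le
  have : 1 / N ≤ 1 / (N * (1 - eps k)) := by
    apply one_div_le_one_div_of_le (by nlinarith)
    nlinarith
  calc (36 / 100 : ℝ) = 1 / N * (36 / 100 * N) := by field_simp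
    _ ≤ 1 / (N * (1 - eps k)) * cosDef k (2 * v / N) := by gcongr

lemma norm_wFun_le_tail {k : ℕ} (hk : 2 ≤ k) {v : ℝ} (h0 : 5 / 2 ≤ v)
    (h1 : v ≤ Real.pi * (2 * k + 1) / 2) : ‖wFun k v‖ ≤ 105 / 100 := by
  have hv : 0 < v := by linarith
  rw [wFun, norm_mul, norm_div, norm_ofReal_mul_I hv.le]
  have h2 : ‖phi k v‖ / v ≤ 2 / 3 := by
    rw [div_le_iff₀ hv]
    linarith [norm_phi_le_linear hk hv.le]
  calc _ ≤ 2 / 3 * (Real.pi / 2) :=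
        mul_le_mul h2 (norm_ampl_le hv.le h1) (norm_nonneg _) (by norm_num)
    _ ≤ _ := by linarith [Real.pi_lt_d2]

lemma pow_seven_lt_exp {r : ℝ} (hr : 0 < r) (hr60 : 60 ≤ r ^ 2) :
    350 * r ^ 7 < Real.exp (36 / 100 * r ^ 2) := by
  have hr7 : 774 / 100 ≤ r := by nlinarith
  obtain ⟨u, hu⟩ : ∃ u : ℝ, u = r ^ 2 / 60 := ⟨_, rfl⟩
  have hu1 : 1 ≤ u := by rw [hu]; linarith
  have hru : r ^ 2 = 60 * u := by rw [hu]; ring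
  have h1 : r ^ 7 ≤ 60 ^ 4 * u ^ 4 / (774 / 100) := by
    rw [le_div_iff₀ (by norm_num)]
    calc r ^ 7 * (774 / 100) ≤ r ^ 7 * r := by gcongr
      _ = (r ^ 2) ^ 4 := by ring
      _ = _ := by rw [hru]; ring
  have h2 : Real.exp (36 / 100 * r ^ 2) = Real.exp (108 / 20) ^ 4 * Real.exp (108 / 20 * (u - 1)) ^ 4 := by
    rw [← mul_pow, ← Real.exp_add, ← Real.exp_nat_mul, hru]; congr 1; push_cast; ring
  have h3 : u ≤ Real.exp (108 / 20 * (u - 1)) := by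
    linarith [Real.add_one_le_exp (108 / 20 * (u - 1))]
  have h4 : (200 : ℝ) ≤ Real.exp (108 / 20) := by
    have : Real.exp (108 / 20) = Real.exp 1 ^ 5 * Real.exp (4 / 10) := by
      rw [← Real.exp_nat_mul, ← Real.exp_add]; norm_num
    rw [this]
    have := Real.exp_one_gt_d9
    have h5 : (27182 / 10000 : ℝ) ^ 5 ≤ Real.exp 1 ^ 5 := by
      gcongr; linarith
    have h6 := Real.add_one_le_exp (4 / 10)
    calc (200 : ℝ) ≤ (27182 / 10000 : ℝ) ^ 5 * (4 / 10 + 1) := by norm_num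
      _ ≤ _ := by gcongr
  rw [h2]
  calc 350 * r ^ 7 ≤ 350 * (60 ^ 4 * u ^ 4 / (774 / 100)) := by gcongr
    _ < 200 ^ 4 * u ^ 4 := by
      have : 0 < u ^ 4 := by positivity
      linarith
    _ ≤ _ := by gcongr

/-- The full integral is positive. -/
lemma integral_exp_mul_wFun_pos {k : ℕ} (hk : 2 ≤ k) {r : ℝ} (hr : 0 < r) (hr60 : 60 ≤ r ^ 2)
    (hrk : 96 / 100 * (2 * k + 1) ≤ r ^ 2) :
    0 < ∫ v in (0 : ℝ)..(Real.pi * (2 * k + 1) / 2),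
      (Complex.exp (((r ^ 2 : ℝ) : ℂ) * phi k v) * wFun k v).re := by
  have hk0 : (2 : ℝ) ≤ k := by exact_mod_cast hk
  have hV : (5 / 2 : ℝ) ≤ Real.pi * (2 * k + 1) / 2 := by nlinarith [Real.pi_gt_three]
  rw [← intervalIntegral.integral_add_adjacent_intervals
    (intervalIntegrable_wFun hk (sq_nonneg r) le_rfl (by norm_num : (0 : ℝ) ≤ 5 / 2) hV)
    (intervalIntegrable_wFun hk (sq_nonneg r) (by norm_num) hV le_rfl)]
  have h1 := le_central_integral hk hr hr60
  have h2 : ‖∫ v in (5 / 2 : ℝ)..(Real.pi * (2 * k + 1) / 2),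
      (Complex.exp (((r ^ 2 : ℝ) : ℂ) * phi k v) * wFun k v).re‖ ≤
      Real.exp (-(36 / 100 * r ^ 2)) * (105 / 100) * |Real.pi * (2 * k + 1) / 2 - 5 / 2| := by
    apply intervalIntegral.norm_integral_le_of_norm_le_const
    intro v hv
    rw [Set.uIoc_of_le hV] at hv
    refine (Complex.abs_re_le_norm _).trans ?_
    rw [norm_mul, norm_exp_phi]
    have h3 := phi_re_le_tail hk hv.1.le hv.2
    have h4 := norm_wFun_le_tail hk hv.1.le hv.2
    gcongr
    nlinarith [sq_nonneg r]
  rw [abs_of_nonneg (by linarith), Real.norm_eq_abs] at h2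
  have h3 : Real.pi * (2 * k + 1) / 2 - 5 / 2 ≤ 165 / 100 * r ^ 2 := by
    nlinarith [Real.pi_lt_d2, Real.pi_gt_three]
  have h4 := pow_seven_lt_exp hr hr60
  have h5 : Real.exp (-(36 / 100 * r ^ 2)) * (105 / 100) * (165 / 100 * r ^ 2) <
      1 / 200 / r ^ 5 := by
    rw [Real.exp_neg, lt_div_iff₀ (by positivity)]
    have : (Real.exp (36 / 100 * r ^ 2))⁻¹ * (105 / 100) * (165 / 100 * r ^ 2) * r ^ 5 =
      (105 / 100 * (165 / 100)) * r ^ 7 / Real.exp (36 / 100 * r ^ 2) := by field_simp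
    rw [this, div_lt_iff₀ (Real.exp_pos _)]
    have : 0 < r ^ 7 := by positivity
    linarith
  have h6 : Real.exp (-(36 / 100 * r ^ 2)) * (105 / 100) * (Real.pi * (2 * k + 1) / 2 - 5 / 2) ≤
      Real.exp (-(36 / 100 * r ^ 2)) * (105 / 100) * (165 / 100 * r ^ 2) := by gcongr
  have := neg_abs_le (∫ v in (5 / 2 : ℝ)..(Real.pi * (2 * k + 1) / 2),
      (Complex.exp (((r ^ 2 : ℝ) : ℂ) * phi k v) * wFun k v).re)
  linarith

/-- The derivative of `devFun` in the parameter. -/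
noncomputable def devFunDeriv (k : ℕ) (d lam t : ℝ) : ℝ :=
  Real.exp (-lam * cosDef k t) * (sinDef k t * Real.cos (lam * sinDef k t - d * t) -
    cosDef k t * Real.sin (lam * sinDef k t - d * t)) / Real.sin (t / 2)

lemma hasDerivAt_devFun (k : ℕ) (d lam t : ℝ) :
    HasDerivAt (fun x => devFun k d x t) (devFunDeriv k d lam t) lam := by
  have h1 : HasDerivAt (fun x : ℝ => Real.exp (-x * cosDef k t))
      (Real.exp (-lam * cosDef k t) * (-1 * cosDef k t)) lam :=
    ((hasDerivAt_neg lam).mul_const _).exp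
  have h2 : HasDerivAt (fun x : ℝ => Real.sin (x * sinDef k t - d * t))
      (Real.cos (lam * sinDef k t - d * t) * (1 * sinDef k t)) lam :=
    (((hasDerivAt_id' lam).mul_const _).sub_const _).sin
  refine ((h1.fun_mul h2).div_const _).congr_deriv ?_
  rw [devFunDeriv]
  ring

lemma measurable_devFunDeriv (k : ℕ) (d lam : ℝ) : Measurable (devFunDeriv k d lam) := by
  have := (continuous_cosDef k).measurable
  have := (continuous_sinDef k).measurable
  unfold devFunDeriv
  fun_prop

lemma abs_devFunDeriv_le {k : ℕ} (d : ℝ) {lam t : ℝ} (hl : 0 ≤ lam) (h0 : 0 < t)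
    (h1 : t ≤ Real.pi) : |devFunDeriv k d lam t| ≤
      Real.pi * (powSum k 3 / 6 * Real.pi ^ 2 + powSum k 2 / 2 * Real.pi) := by
  have hpi := Real.pi_pos
  have hs := div_pi_le_sin_half h0.le h1
  have hpos : 0 < t / Real.pi := by positivity
  have hA0 := cosDef_nonneg k t
  have hB0 := sinDef_nonneg k h0.le
  have hA := cosDef_le k t
  have hB := sinDef_le k h0.le
  have hp2 : 0 ≤ powSum k 2 := sum_nonneg fun j _ => by positivity
  have hp3 : 0 ≤ powSum k 3 := sum_nonneg fun j _ => by positivity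
  rw [devFunDeriv, abs_div, abs_of_pos (hpos.trans_le hs), div_le_iff₀ (hpos.trans_le hs), abs_mul,
    abs_of_pos (Real.exp_pos _)]
  have he : Real.exp (-lam * cosDef k t) ≤ 1 :=
    Real.exp_le_one_iff.2 (by nlinarith)
  have h2 : |sinDef k t * Real.cos (lam * sinDef k t - d * t) -
      cosDef k t * Real.sin (lam * sinDef k t - d * t)| ≤ sinDef k t + cosDef k t := by
    refine (abs_sub _ _).trans (add_le_add ?_ ?_)
    · rw [abs_mul, abs_of_nonneg hB0]
      exact mul_le_of_le_one_right hB0 (Real.abs_cos_le_one _)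
    · rw [abs_mul, abs_of_nonneg hA0]
      exact mul_le_of_le_one_right hA0 (Real.abs_sin_le_one _)
  calc _ ≤ 1 * (sinDef k t + cosDef k t) := by gcongr
    _ ≤ powSum k 3 / 6 * t ^ 3 + powSum k 2 / 2 * t ^ 2 := by linarith
    _ = Real.pi * (powSum k 3 / 6 * t ^ 2 + powSum k 2 / 2 * t) * (t / Real.pi) := by
      field_simp
    _ ≤ Real.pi * (powSum k 3 / 6 * Real.pi ^ 2 + powSum k 2 / 2 * Real.pi) * Real.sin (t / 2) := by
      gcongr

lemma hasDerivAt_integral_devFun {k : ℕ} (hk : 1 ≤ k) (d : ℝ) {lam : ℝ} (hl : 0 < lam) :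
    HasDerivAt (fun x => ∫ t in (0 : ℝ)..Real.pi, devFun k d x t)
      (∫ t in (0 : ℝ)..Real.pi, devFunDeriv k d lam t) lam := by
  have hint : IntervalIntegrable (devFun k d lam) volume 0 Real.pi := by
    refine (intervalIntegrable_const (c := Real.pi * (powSum k 3 / 6 * (lam * Real.pi ^ 2) +
      |d|))).mono_fun (measurable_devFun k d lam).aestronglyMeasurable ?_
    refine (ae_restrict_mem measurableSet_uIoc).mono fun t ht => ?_
    rw [Set.uIoc_of_le Real.pi_pos.le] at ht
    have hp3 : 0 ≤ powSum k 3 := sum_nonneg fun j _ => by positivity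
    have hpi := Real.pi_pos
    simp only [Real.norm_eq_abs]
    refine (abs_devFun_le hk d hl.le ht.1 ht.2).trans ?_
    refine le_trans ?_ (le_abs_self _)
    have h0 := ht.1
    have he : Real.exp (-(2 / Real.pi ^ 2) * (lam * t ^ 2)) ≤ 1 :=
      Real.exp_le_one_iff.2 (mul_nonpos_of_nonpos_of_nonneg
        (by rw [neg_nonpos]; positivity) (by positivity))
    calc _ ≤ 1 * (Real.pi * (powSum k 3 / 6 * (lam * t ^ 2) + |d|)) := by gcongr
      _ ≤ _ := by rw [one_mul]; gcongr; exact ht.2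
  refine (intervalIntegral.hasDerivAt_integral_of_dominated_loc_of_deriv_le
    (bound := fun _ => Real.pi * (powSum k 3 / 6 * Real.pi ^ 2 + powSum k 2 / 2 * Real.pi))
    (Ioi_mem_nhds hl)
    (Eventually.of_forall fun x => (measurable_devFun k d x).aestronglyMeasurable) hint
    (measurable_devFunDeriv k d lam).aestronglyMeasurable ?_ intervalIntegrable_const ?_).2
  · refine Eventually.of_forall fun t ht x hx => ?_
    rw [Set.uIoc_of_le Real.pi_pos.le] at ht
    exact abs_devFunDeriv_le d (Set.mem_Ioi.1 hx).le ht.1 ht.2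
  · exact Eventually.of_forall fun t _ x _ => hasDerivAt_devFun k d x t

lemma devFunDeriv_scaled {k : ℕ} (hk : 2 ≤ k) (lam : ℝ) {v : ℝ} (hv : 0 < v) :
    devFunDeriv k (k * (k + 1) / (4 * (2 * k + 1))) lam (2 / (2 * k + 1) * v) =
      -((2 * k + 1) ^ 2 * (1 - eps k)) *
      (Complex.exp ((lam * (2 * k + 1) * (1 - eps k) : ℝ) * phi k v) * wFun k v).re := by
  have hk0 : (2 : ℝ) ≤ k := by exact_mod_cast hk
  have he := eps_le hk
  have hx0 : 1 - eps k ≠ 0 := by linarith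
  have hN0 : 2 * (k : ℝ) + 1 ≠ 0 := by positivity
  obtain ⟨A, hA⟩ : ∃ A, A = cosDef k (2 * v / (2 * k + 1)) := ⟨_, rfl⟩
  obtain ⟨B, hB⟩ : ∃ B, B = sinDef k (2 * v / (2 * k + 1)) := ⟨_, rfl⟩
  obtain ⟨q, hq⟩ : ∃ q, q = Real.sin (v / (2 * k + 1)) := ⟨_, rfl⟩
  obtain ⟨th, hth⟩ : ∃ th, th = (1 - eps k) * v / 8 := ⟨_, rfl⟩
  have hre := phi_re k v
  have him := phi_im k v
  rw [← hA] at hre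
  rw [← hB] at him
  have hphi : phi k v = ((-(1 / ((2 * (k : ℝ) + 1) * (1 - eps k)) * A) : ℝ) : ℂ) +
      ((-(1 / ((2 * (k : ℝ) + 1) * (1 - eps k)) * B) : ℝ) : ℂ) * Complex.I := by
    rw [← hre, ← him, Complex.re_add_im]
  have e1 : 2 / (2 * (k : ℝ) + 1) * v = 2 * v / (2 * k + 1) := by ring
  have e2 : 2 * v / (2 * (k : ℝ) + 1) / 2 = v / (2 * k + 1) := by ring
  have e3 : (k : ℝ) * (k + 1) / (4 * (2 * k + 1)) * (2 * v / (2 * k + 1)) = th := by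
    rw [hth, eps]; field_simp; ring
  rw [devFunDeriv, e1, e2, e3, ← hA, ← hB, ← hq]
  have hexp : Complex.exp ((lam * (2 * k + 1) * (1 - eps k) : ℝ) * phi k v) *
      Complex.exp ((th : ℝ) * Complex.I) =
      (Real.exp (-lam * A) : ℂ) * (Real.cos (lam * B - th) - Real.sin (lam * B - th) * Complex.I) := by
    have : (Real.cos (lam * B - th) - Real.sin (lam * B - th) * Complex.I : ℂ) =
        Complex.exp ((-(lam * B - th) : ℝ) * Complex.I) := by
      rw [Complex.exp_mul_I, ← Complex.ofReal_cos, ← Complex.ofReal_sin, Real.cos_neg, Real.sin_neg]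
      push_cast; ring
    rw [this, Complex.ofReal_exp, ← Complex.exp_add, ← Complex.exp_add]
    congr 1
    rw [hphi]
    have hx0' : (1 - eps k : ℂ) ≠ 0 := by exact_mod_cast hx0
    have hN0' : (2 * k + 1 : ℂ) ≠ 0 := by exact_mod_cast hN0
    push_cast
    field_simp
    ring
  have hprod : Complex.exp ((lam * (2 * k + 1) * (1 - eps k) : ℝ) * phi k v) * wFun k v =
      (Real.exp (-lam * A) : ℂ) * (Real.cos (lam * B - th) - Real.sin (lam * B - th) * Complex.I) *
      (phi k v / (v * Complex.I) * ((v / (2 * k + 1) / q : ℝ) : ℂ)) := by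
    rw [← hexp, wFun, ampl, ← hth, ← hq]; ring
  have hfac : phi k v / (v * Complex.I) * ((v / (2 * k + 1) / q : ℝ) : ℂ) =
      ((-(1 / ((2 * k + 1) ^ 2 * (1 - eps k) * q)) : ℝ) : ℂ) * (B - A * Complex.I) := by
    rw [hphi]
    have hx0' : (1 - eps k : ℂ) ≠ 0 := by exact_mod_cast hx0
    have hN0' : (2 * k + 1 : ℂ) ≠ 0 := by exact_mod_cast hN0
    have hv0 : (v : ℂ) ≠ 0 := by exact_mod_cast hv.ne'
    have hI := Complex.I_ne_zero
    rcases eq_or_ne q 0 with h | h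
    · simp [h]
    have h' : (q : ℂ) ≠ 0 := by exact_mod_cast h
    push_cast
    field_simp
    linear_combination (-(A : ℂ)) * Complex.I_sq
  have hfin : ((Real.exp (-lam * A) : ℂ) *
      (Real.cos (lam * B - th) - Real.sin (lam * B - th) * Complex.I) *
      (((-(1 / ((2 * k + 1) ^ 2 * (1 - eps k) * q)) : ℝ) : ℂ) * (B - A * Complex.I))).re =
      -(1 / ((2 * k + 1) ^ 2 * (1 - eps k) * q)) * (Real.exp (-lam * A) *
        (B * Real.cos (lam * B - th) - A * Real.sin (lam * B - th))) := by
    have : ((Real.exp (-lam * A) : ℂ) *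
      (Real.cos (lam * B - th) - Real.sin (lam * B - th) * Complex.I) *
      (((-(1 / ((2 * k + 1) ^ 2 * (1 - eps k) * q)) : ℝ) : ℂ) * (B - A * Complex.I))) =
      ((-(1 / ((2 * k + 1) ^ 2 * (1 - eps k) * q)) * (Real.exp (-lam * A) *
        (B * Real.cos (lam * B - th) - A * Real.sin (lam * B - th))) : ℝ) : ℂ) +
      ((-(1 / ((2 * k + 1) ^ 2 * (1 - eps k) * q)) * (Real.exp (-lam * A) *
        (-(A * Real.cos (lam * B - th)) - B * Real.sin (lam * B - th))) : ℝ) : ℂ) * Complex.I := by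
      push_cast
      linear_combination (-(1 / ((2 * k + 1) ^ 2 * (1 - eps k) * q) : ℂ)) *
        Complex.exp (-lam * A) * Complex.sin (lam * B - th) * A * Complex.I_sq
    rw [this, Complex.add_re, Complex.ofReal_re, Complex.re_ofReal_mul]
    simp
  rw [hprod, hfac, hfin]
  rcases eq_or_ne q 0 with h | h
  · simp [h]
  field_simp

lemma integral_devFunDeriv_eq {k : ℕ} (hk : 2 ≤ k) (lam : ℝ) :
    ∫ t in (0 : ℝ)..Real.pi, devFunDeriv k (k * (k + 1) / (4 * (2 * k + 1))) lam t =
      -(2 * (2 * k + 1) * (1 - eps k)) * ∫ v in (0 : ℝ)..(Real.pi * (2 * k + 1) / 2),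
      (Complex.exp ((lam * (2 * k + 1) * (1 - eps k) : ℝ) * phi k v) * wFun k v).re := by
  have hN0 : 0 < 2 * (k : ℝ) + 1 := by positivity
  have h1 := intervalIntegral.mul_integral_comp_mul_left (a := 0) (b := Real.pi * (2 * k + 1) / 2)
    (f := devFunDeriv k (k * (k + 1) / (4 * (2 * k + 1))) lam) (2 / (2 * (k : ℝ) + 1))
  have e1 : 2 / (2 * (k : ℝ) + 1) * (Real.pi * (2 * k + 1) / 2) = Real.pi := by field_simp
  rw [mul_zero, e1] at h1
  rw [← h1, intervalIntegral.integral_congr_Ioo_of_le (by positivity)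
    (fun v hv => devFunDeriv_scaled hk lam hv.1), intervalIntegral.integral_const_mul]
  field_simp

lemma integral_devFun_pos {k : ℕ} (hk : 2 ≤ k) {lam : ℝ} (hl : 1 ≤ lam)
    (h60 : 60 ≤ lam * (2 * k + 1) * (1 - eps k)) :
    0 < ∫ t in (0 : ℝ)..Real.pi, devFun k (k * (k + 1) / (4 * (2 * k + 1))) lam t := by
  obtain ⟨Q, hQ⟩ : ∃ Q : ℝ → ℝ, Q = fun x => ∫ t in (0 : ℝ)..Real.pi,
    devFun k (k * (k + 1) / (4 * (2 * k + 1))) x t := ⟨_, rfl⟩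
  have hx := eps_le hk
  have hd (x : ℝ) (hx0 : lam ≤ x) := hasDerivAt_integral_devFun (k := k) (by omega)
    (k * (k + 1) / (4 * (2 * k + 1))) (show 0 < x by linarith)
  rw [← hQ] at hd
  have hanti : StrictAntiOn Q (Set.Ici lam) := by
    refine strictAntiOn_of_deriv_neg (convex_Ici lam)
      (fun x hx => (hd x hx).continuousAt.continuousWithinAt) fun x hx => ?_
    rw [interior_Ici, Set.mem_Ioi] at hx
    rw [(hd x hx.le).deriv, integral_devFunDeriv_eq hk, neg_mul, neg_lt_zero]
    have hN : 0 ≤ (2 * (k : ℝ) + 1) * (1 - eps k) := mul_nonneg (by positivity) (by linarith)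
    have hle : lam * (2 * k + 1) * (1 - eps k) ≤ x * (2 * k + 1) * (1 - eps k) := by
      rw [mul_assoc, mul_assoc x]; gcongr
    have hsq := Real.sq_sqrt (show 0 ≤ x * (2 * k + 1) * (1 - eps k) by linarith)
    have := integral_exp_mul_wFun_pos hk (r := √(x * (2 * k + 1) * (1 - eps k)))
      (Real.sqrt_pos.2 (by linarith)) (by rw [hsq]; linarith) (by
        rw [hsq]
        have hN1 : 0 ≤ 2 * (k : ℝ) + 1 := by positivity
        have : 1 * ((2 * k + 1) * (1 - eps k)) ≤ x * ((2 * k + 1) * (1 - eps k)) := by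
          gcongr; linarith
        nlinarith)
    rw [hsq] at this
    exact mul_pos (by nlinarith [hN]) this
  have hlim := tendsto_integral_devFun (k := k) (by omega) (k * (k + 1) / (4 * (2 * k + 1)))
  have hz : ((k * (k + 1) / (2 * (2 * k + 1)) - 2 * (k * (k + 1) / (4 * (2 * k + 1)))) *
      (√(Real.pi / (powSum k 2 / 2)) / 2) : ℝ) = 0 := by
    apply mul_eq_zero_of_left; field_simp; ring
  rw [hz] at hlim
  change 0 < (fun x => ∫ t in (0 : ℝ)..Real.pi, devFun k (k * (k + 1) / (4 * (2 * k + 1))) x t) lam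
  rw [← hQ]
  by_contra! hcon
  have h1 : Q (lam + 1) < Q lam := hanti (by simp) (by simp) (by linarith)
  have h2 : 0 ≤ Q (lam + 1) := by
    refine le_of_tendsto hlim ?_
    filter_upwards [eventually_ge_atTop (lam + 1)] with r hr
    have h3 : lam + 1 ≤ r ^ 2 := by nlinarith
    have h4 : Q (r ^ 2) ≤ Q (lam + 1) := hanti.antitoneOn (by simp) (by simp; linarith) h3
    have h5 : r * (∫ t in (0 : ℝ)..Real.pi, devFun k (k * (k + 1) / (4 * (2 * k + 1))) (r ^ 2) t) =
      r * Q (r ^ 2) := by rw [hQ]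
    rw [h5]
    nlinarith
  linarith

/-- The value `F x`, computed by first reducing `x` to a numeral. -/
noncomputable def forced {α : Type} (x : ℕ) (F : ℕ → α) : α :=
  Nat.rec (motive := fun _ => α) (F 0) (fun n _ => F n.succ) x

lemma forced_eq {α : Type} (x : ℕ) (F : ℕ → α) : forced x F = F x := by cases x <;> rfl

/-- Fixed-point evaluation of the partial sums of the masses for the rational parameter `num / den`,
with the last `k` values packed in base `B` into `W`. -/
noncomputable def windowRun (k num den B Bk f : ℕ) : ℕ → ℕ → ℕ → ℕ → ℕ → ℕ :=
  Nat.rec (motive := fun _ => ℕ → ℕ → ℕ → ℕ → ℕ → ℕ) (fun _ _ _ _ T => T)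
    (fun _ run j W S P T =>
      forced (Nat.mod (Nat.div (Nat.mul num S) (Nat.mul den j)) B) fun g =>
      forced (Nat.add g (Nat.mul B (Nat.mod W Bk))) fun W' =>
      forced (Nat.add g (Nat.sub (Nat.add S P) (Nat.mul k.succ (Nat.div W Bk)))) fun S' =>
      forced (Nat.sub (Nat.add g P) (Nat.div W Bk)) fun P' =>
      forced j.succ fun j' => run j' W' S' P' (Nat.add T g)) f

lemma windowRun_succ (k num den B Bk f j W S P T : ℕ) :
    windowRun k num den B Bk (f + 1) j W S P T =
      windowRun k num den B Bk f (j + 1) (num * S / (den * j) % B + B * (W % Bk))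
        (num * S / (den * j) % B + (S + P - (k + 1) * (W / Bk)))
        (num * S / (den * j) % B + P - W / Bk) (T + num * S / (den * j) % B) := by
  simp only [windowRun, forced_eq]
  rfl

/-- Repeated squaring in fixed-point arithmetic with scale `s`, rounding up. -/
noncomputable def expIter (s m : ℕ) : ℕ → ℕ :=
  Nat.rec (motive := fun _ => ℕ → ℕ) (fun a => a)
    (fun _ iter a => forced (Nat.succ (Nat.div (Nat.mul a a) s)) iter) m

lemma expIter_succ (s m a : ℕ) : expIter s (m + 1) a = expIter s m (a * a / s + 1) := by
  simp only [expIter, forced_eq]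
  rfl

lemma lt_expIter {s : ℕ} (hs : 0 < s) (m : ℕ) (a : ℕ) (u : ℝ) (h : s * Real.exp u < a) :
    s * Real.exp (2 ^ m * u) < expIter s m a := by
  induction m generalizing a u with
  | zero => simpa [expIter] using h
  | succ m ih =>
    have hs0 : (0 : ℝ) < s := by exact_mod_cast hs
    rw [expIter_succ, pow_succ, mul_assoc]
    apply ih
    have h1 : (a : ℝ) * a / s < (a * a / s : ℕ) + 1 := by
      have := Nat.lt_floor_add_one ((a : ℝ) * a / s)
      rwa [← Nat.cast_mul, Nat.floor_div_natCast, Nat.floor_natCast, Nat.cast_mul] at this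
    push_cast
    refine lt_of_lt_of_le ?_ h1.le
    rw [lt_div_iff₀ hs0, two_mul, Real.exp_add]
    calc (s : ℝ) * (Real.exp u * Real.exp u) * s = (s * Real.exp u) * (s * Real.exp u) := by ring
      _ < _ := by gcongr

lemma exp_lt_expIter {s : ℕ} (hs : 0 < s) (m : ℕ) {p q : ℕ} (h : p < q * 2 ^ m) :
    s * Real.exp ((p : ℝ) / q) < expIter s m (s * (q * 2 ^ m) / (q * 2 ^ m - p) + 1) := by
  obtain ⟨M, hM⟩ : ∃ M : ℕ, M = q * 2 ^ m := ⟨_, rfl⟩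
  have hq : (q : ℝ) ≠ 0 := by
    rintro h0
    have : q = 0 := by exact_mod_cast h0
    simp [this] at h
  have hM0 : (0 : ℝ) < M := by
    have : 0 < M := by omega
    exact_mod_cast this
  have hMp : (p : ℝ) < M := by rw [hM]; exact_mod_cast h
  have e : (p : ℝ) / q = 2 ^ m * ((p : ℝ) / M) := by
    rw [hM]; push_cast; field_simp
  rw [← hM] at h ⊢
  rw [e]
  apply lt_expIter hs
  have h1 : (s * M : ℝ) / (M - p : ℝ) < (s * M / (M - p) : ℕ) + 1 := by
    have := Nat.lt_floor_add_one ((s * M : ℕ) / ((M - p : ℕ) : ℝ))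
    rw [Nat.floor_div_natCast, Nat.floor_natCast] at this
    rwa [Nat.cast_sub h.le, Nat.cast_mul] at this
  push_cast at h1 ⊢
  refine lt_of_le_of_lt ?_ h1
  have h2 := Real.add_one_le_exp (-((p : ℝ) / M))
  have h3 : 0 < 1 - (p : ℝ) / M := by rw [sub_pos, div_lt_one hM0]; exact hMp
  rw [Real.exp_neg] at h2
  have h4 : Real.exp ((p : ℝ) / M) ≤ (1 - (p : ℝ) / M)⁻¹ := by
    rw [le_inv_comm₀ (Real.exp_pos _) h3]; linarith
  calc _ ≤ s * (1 - (p : ℝ) / M)⁻¹ := by gcongr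
    _ = _ := by
      have : (M : ℝ) - p ≠ 0 := by linarith
      field_simp

lemma sum_digits_lt {B : ℕ} (m : ℕ) (a : ℕ → ℕ) (ha : ∀ i, a i < B) :
    ∑ i ∈ range m, B ^ i * a i < B ^ m := by
  induction m with
  | zero => simp
  | succ m ih =>
    rw [sum_range_succ, pow_succ]
    calc _ < B ^ m + B ^ m * a m := by gcongr
      _ = B ^ m * (a m + 1) := by ring
      _ ≤ _ := Nat.mul_le_mul_left _ (ha m)

lemma windowRun_le (m : ℕ) {num den B : ℕ} (hden : 0 < den) (hB : 0 < B) {s : ℝ}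
    (f : ℕ) (j : ℕ) (hj : 1 ≤ j) (W S P T : ℕ) (a : ℕ → ℕ) (ha : ∀ i, a i < B)
    (hW : W = ∑ i ∈ range (m + 1), B ^ i * a i) (hS : S = ∑ i ∈ range (m + 1), (i + 1) * a i)
    (hP : P = ∑ i ∈ range (m + 1), a i)
    (hle : ∀ i, (a i : ℝ) ≤ if i + 1 ≤ j then s * mass (m + 1) ((num : ℝ) / den) (j - (i + 1)) else 0)
    (hT : (T : ℝ) ≤ s * ∑ i ∈ range j, mass (m + 1) ((num : ℝ) / den) i) :
    (windowRun (m + 1) num den B (B ^ m) f j W S P T : ℝ) ≤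
      s * ∑ i ∈ range (j + f), mass (m + 1) ((num : ℝ) / den) i := by
  induction f generalizing j W S P T a with
  | zero => simpa [windowRun] using hT
  | succ f ih =>
    have hlow := sum_digits_lt m a ha
    rw [sum_range_succ] at hW hS hP
    have hBm : 0 < B ^ m := by positivity
    have hWmod : W % B ^ m = ∑ i ∈ range m, B ^ i * a i := by
      rw [hW, Nat.add_mul_mod_self_left, Nat.mod_eq_of_lt hlow]
    have hWdiv : W / B ^ m = a m := by
      rw [hW, Nat.add_mul_div_left _ _ hBm, Nat.div_eq_of_lt hlow, zero_add]
    rw [windowRun_succ, hWmod, hWdiv]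
    obtain ⟨g, hg⟩ : ∃ g, g = num * S / (den * j) % B := ⟨_, rfl⟩
    rw [← hg]
    have hgB : g < B := hg ▸ Nat.mod_lt _ hB
    have hgle : (g : ℝ) ≤ s * mass (m + 1) ((num : ℝ) / den) j := by
      have hj0 : (0 : ℝ) < j := by exact_mod_cast hj
      have hd0 : (0 : ℝ) < den := by exact_mod_cast hden
      have h1 : (g : ℝ) ≤ (num * S / (den * j) : ℕ) := by
        rw [hg]; exact_mod_cast Nat.mod_le _ _
      have h2 : ((num * S / (den * j) : ℕ) : ℝ) ≤ (num * S : ℝ) / (den * j) := by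
        exact_mod_cast Nat.cast_div_le (α := ℝ) (m := num * S) (n := den * j)
      have h3 : (S : ℝ) ≤ s * ∑ i ∈ range (m + 1), if i + 1 ≤ j then
          ((i : ℝ) + 1) * mass (m + 1) ((num : ℝ) / den) (j - (i + 1)) else 0 := by
        rw [hS, ← sum_range_succ, mul_sum]
        push_cast
        refine sum_le_sum fun i _ => ?_
        have := hle i
        split_ifs at this ⊢ with hij
        · calc ((i : ℝ) + 1) * a i ≤ (i + 1) * (s * mass (m + 1) ((num : ℝ) / den) (j - (i + 1))) := by
                gcongr
            _ = _ := by ring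
        · have : (a i : ℝ) = 0 := le_antisymm this (by positivity)
          simp [this]
      have h4 := mass_rec (m + 1) ((num : ℝ) / den) j
      refine (h1.trans h2).trans ?_
      rw [div_le_iff₀ (by positivity)]
      calc (num : ℝ) * S ≤ num * (s * ∑ i ∈ range (m + 1), if i + 1 ≤ j then
          ((i : ℝ) + 1) * mass (m + 1) ((num : ℝ) / den) (j - (i + 1)) else 0) := by gcongr
        _ = s * den * (num / den * ∑ i ∈ range (m + 1), if i + 1 ≤ j then
          ((i : ℝ) + 1) * mass (m + 1) ((num : ℝ) / den) (j - (i + 1)) else 0) := by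
            field_simp
        _ = s * den * (j * mass (m + 1) ((num : ℝ) / den) j) := by rw [h4]
        _ = _ := by ring
    obtain ⟨b, hb0, hb⟩ : ∃ b : ℕ → ℕ, b 0 = g ∧ ∀ i, b (i + 1) = a i :=
      ⟨fun i => Nat.casesOn i g a, rfl, fun _ => rfl⟩
    have hfin : j + (f + 1) = j + 1 + f := by ring
    rw [hfin]
    refine ih (j + 1) (by omega) _ _ _ _ b ?_ ?_ ?_ ?_ ?_ ?_
    · rintro (_ | i)
      · rw [hb0]; exact hgB
      · rw [hb]; exact ha i
    · rw [sum_range_succ', hb0, mul_sum, add_comm]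
      simp only [hb]
      rw [pow_zero, one_mul]
      congr 1
      exact sum_congr rfl fun i _ => by ring
    · rw [sum_range_succ', hb0, hS, hP]
      simp only [hb]
      have : ∑ i ∈ range m, (i + 1 + 1) * a i =
          ∑ i ∈ range m, (i + 1) * a i + ∑ i ∈ range m, a i := by
        rw [← sum_add_distrib]; exact sum_congr rfl fun i _ => by ring
      rw [this]
      have h5 : ∑ i ∈ range m, (i + 1) * a i + (m + 1) * a m + (∑ i ∈ range m, a i + a m) =
        ∑ i ∈ range m, (i + 1) * a i + ∑ i ∈ range m, a i + (m + 1 + 1) * a m := by ring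
      rw [h5, Nat.add_sub_cancel]
      ring
    · rw [sum_range_succ', hb0, hP]
      simp only [hb]
      omega
    · rintro (_ | i)
      · rw [hb0]; simpa using hgle
      · rw [hb]
        have := hle i
        simpa using this
    · rw [sum_range_succ, mul_add]
      push_cast
      exact add_le_add hT hgle

/-- A sufficient numerical condition for the cumulative distribution function at
`n - (k + 4) / 8` to exceed one half. -/
noncomputable def checkAt (k n : ℕ) : Bool :=
  forced (8 * (2 * k + 1) * n + (k + 4) % 8 * (2 * k + 1) + k) fun num =>
  forced (k * (k + 1) / 2 * (8 * (2 * k + 1))) fun den =>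
  forced (2 ^ 128) fun B =>
  forced (B ^ (k - 1)) fun Bk =>
  forced (2 ^ 80) fun s =>
  forced (s * (den * 2 ^ 32) / (den * 2 ^ 32 - k * num) + 1) fun start =>
  Nat.blt (k * num) (den * 2 ^ 32) && Nat.ble (expIter s 32 start)
    (2 * windowRun k num den B Bk (n - (k + 4) / 8) 1 s s s s)

/-- `checkAt` for `f` consecutive values from `n` on. -/
noncomputable def checkFrom (k f : ℕ) : ℕ → Bool :=
  Nat.rec (motive := fun _ => ℕ → Bool) (fun _ => true)
    (fun _ check n => checkAt k n && check n.succ) f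

/-- The first index of the range treated for `k`. -/
def firstIndex (k : ℕ) : ℕ :=
  cond (Nat.beq k 2) 9 (cond (Nat.ble k 6) (k * (k + 1)) (k * (k + 1) / 2))

set_option maxHeartbeats 2000000 in
lemma checkFrom_true {k : ℕ} (h2 : 2 ≤ k) (h30 : k < 30) :
    checkFrom k (15 * (2 * k + 1) / 2 + 1 - firstIndex k) (firstIndex k) = true := by
  interval_cases k <;> decide +kernel

lemma checkAt_of_checkFrom {k f n i : ℕ} (h : checkFrom k f n = true) (h1 : n ≤ i)
    (h2 : i < n + f) : checkAt k i = true := by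
  induction f generalizing n with
  | zero => omega
  | succ f ih =>
    have h := (Bool.and_eq_true _ _).mp h
    rcases h1.eq_or_lt with rfl | h1
    · exact h.1
    · exact ih h.2 h1 (by rw [Nat.succ_eq_add_one]; omega)

lemma checkAt_eq_true {k n : ℕ} (h2 : 2 ≤ k) (h30 : k < 30) (h1 : firstIndex k ≤ n)
    (hn : n ≤ 15 * (2 * k + 1) / 2) : checkAt k n = true :=
  checkAt_of_checkFrom (checkFrom_true h2 h30) h1 (by omega)

lemma half_lt_of_checkAt {k n : ℕ} (hk : 1 ≤ k) (h : checkAt k n = true) :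
    1 / 2 < ∑ j ∈ range (n - (k + 4) / 8 + 1), poissonOrderKPmf k
      (((8 * (2 * k + 1) * n + (k + 4) % 8 * (2 * k + 1) + k : ℕ) : ℝ) /
        (k * (k + 1) / 2 * (8 * (2 * k + 1)) : ℕ)) j := by
  obtain ⟨num, hnum⟩ : ∃ x, x = 8 * (2 * k + 1) * n + (k + 4) % 8 * (2 * k + 1) + k := ⟨_, rfl⟩
  obtain ⟨den, hden⟩ : ∃ x, x = k * (k + 1) / 2 * (8 * (2 * k + 1)) := ⟨_, rfl⟩
  rw [checkAt, ← hnum, ← hden] at h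
  simp only [forced_eq] at h
  rw [Bool.and_eq_true, Nat.blt_eq, Nat.ble_eq] at h
  rw [← hnum, ← hden]
  have hden0 : 0 < den := by
    rw [hden]
    have : 1 ≤ k * (k + 1) / 2 := by
      rw [Nat.le_div_iff_mul_le (by norm_num)]; nlinarith
    positivity
  obtain ⟨m, rfl⟩ : ∃ m, k = m + 1 := ⟨k - 1, by omega⟩
  obtain ⟨s, hs⟩ : ∃ s : ℕ, s = 2 ^ 80 := ⟨_, rfl⟩
  obtain ⟨B, hB⟩ : ∃ B : ℕ, B = 2 ^ 128 := ⟨_, rfl⟩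
  have hsB : s < B := by rw [hs, hB]; norm_num
  have hs0 : 0 < s := by rw [hs]; positivity
  rw [← hs, ← hB, Nat.add_sub_cancel] at h
  have hE := exp_lt_expIter hs0 32 h.1
  have hsum (w : ℕ → ℕ) (hw : w 0 = 1) :
      s = ∑ i ∈ range (m + 1), w i * (if i = 0 then s else 0) := by
    rw [sum_range_succ']; simp [hw]
  have hR := windowRun_le m (num := num) (den := den) (B := B) hden0 (by omega) (s := s)
    (n - (m + 1 + 4) / 8) 1 le_rfl s s s s (fun i => if i = 0 then s else 0)
    (fun i => by split_ifs <;> omega) (hsum _ (pow_zero B)) (hsum (fun i => i + 1) rfl)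
    (by simp)
    (fun i => by
      by_cases hi : i = 0
      · simp [hi, mass_zero]
      · simp [hi])
    (by simp [mass_zero])
  have h2 : ((expIter s 32 (s * (den * 2 ^ 32) / (den * 2 ^ 32 - (m + 1) * num) + 1) : ℕ) : ℝ) ≤
      2 * windowRun (m + 1) num den B (B ^ m) (n - (m + 1 + 4) / 8) 1 s s s s := by
    exact_mod_cast h.2
  have hs0' : (0 : ℝ) < s := by exact_mod_cast hs0
  have h3 : Real.exp ((((m + 1) * num : ℕ) : ℝ) / den) <
      2 * ∑ i ∈ range (1 + (n - (m + 1 + 4) / 8)), mass (m + 1) ((num : ℝ) / den) i := by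
    have := (hE.trans_le h2).trans_le (mul_le_mul_of_nonneg_left hR zero_le_two)
    refine lt_of_mul_lt_mul_left (this.trans_eq ?_) hs0'.le
    ring
  simp only [pmf_eq]
  rw [← mul_sum, Real.exp_neg, add_comm (n - _) 1]
  have h4 : ((m + 1 : ℕ) : ℝ) * ((num : ℝ) / den) = (((m + 1) * num : ℕ) : ℝ) / den := by
    push_cast; ring
  rw [h4, inv_mul_eq_div, lt_div_iff₀ (Real.exp_pos _)]
  linarith

/-- The candidate limit of `poissonOrderKAlpha k n - n`. -/
noncomputable def alphaLimit (k : ℕ) : ℝ :=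
  Int.fract (((k : ℝ) + 4) / 8) + (k : ℝ) / (8 * (2 * (k : ℝ) + 1))

lemma alphaLimit_eq (k : ℕ) :
    alphaLimit k = ((k + 4) % 8 : ℕ) / 8 + (k : ℝ) / (8 * (2 * (k : ℝ) + 1)) := by
  have h : ((k : ℝ) + 4) / 8 = (((k + 4) % 8 : ℕ) : ℝ) / 8 + (((k + 4) / 8 : ℕ) : ℝ) := by
    have : (((8 * ((k + 4) / 8) + (k + 4) % 8 : ℕ)) : ℝ) = ((k + 4 : ℕ) : ℝ) := by
      rw [Nat.div_add_mod]
    push_cast at this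
    linarith
  have h8 : (((k + 4) % 8 : ℕ) : ℝ) < 8 := by exact_mod_cast Nat.mod_lt _ (by norm_num)
  rw [alphaLimit, h, Int.fract_add_natCast, Int.fract_eq_self.2 ⟨by positivity, by linarith⟩]

lemma alphaLimit_nonneg (k : ℕ) : 0 ≤ alphaLimit k := by rw [alphaLimit_eq]; positivity

lemma alphaLimit_add (k : ℕ) : alphaLimit k + (((k + 4) / 8 : ℕ) : ℝ) =
    (2 * (k : ℝ) + 9) / 16 - 1 / (16 * (2 * (k : ℝ) + 1)) := by
  have : (((8 * ((k + 4) / 8) + (k + 4) % 8 : ℕ)) : ℝ) = ((k + 4 : ℕ) : ℝ) := by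
    rw [Nat.div_add_mod]
  push_cast at this
  have h1 : (((k + 4) / 8 : ℕ) : ℝ) = (k + 4) / 8 - (((k + 4) % 8 : ℕ) : ℝ) / 8 := by linarith
  rw [alphaLimit_eq, h1]
  field_simp
  ring

lemma cast_triangle (k : ℕ) : ((k * (k + 1) / 2 : ℕ) : ℝ) = k * (k + 1) / 2 := by
  rw [Nat.cast_div (Nat.even_mul_succ_self k).two_dvd (by norm_num)]
  push_cast; ring

/-- The lattice relation between the index, the mean and the phase shift. -/
lemma index_relation {k n : ℕ} (hk : 1 ≤ k) (hn : (k + 4) / 8 ≤ n) (e : ℝ) :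
    ((n - (k + 4) / 8 + 1 : ℕ) : ℝ) - 1 / 2 =
      k * (k + 1) / 2 * ((n + alphaLimit k + e) / (k * (k + 1) / 2)) -
        (k * (k + 1) / (4 * (2 * k + 1)) + e) := by
  have hk0 : (1 : ℝ) ≤ k := by exact_mod_cast hk
  have h := alphaLimit_add k
  rw [mul_div_cancel₀ _ (by positivity)]
  push_cast [Nat.cast_sub hn]
  have h1 : (((k + 4) / 8 : ℕ) : ℝ) =
    (2 * (k : ℝ) + 9) / 16 - 1 / (16 * (2 * (k : ℝ) + 1)) - alphaLimit k := by linarith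
  rw [h1]
  field_simp
  ring

lemma tendsto_exp_mul_mass (k n : ℕ) {c : ℝ} (hc : 0 < c) :
    Tendsto (fun lam : ℝ => Real.exp (-c * lam) * mass k lam n) atTop (𝓝 0) := by
  have hexp (b : ℝ) (hb : 0 < b) :
      Tendsto (fun lam : ℝ => Real.exp (-b * lam)) atTop (𝓝 0) := by
    have : Tendsto (fun lam : ℝ => -b * lam) atTop atBot :=
      tendsto_id.const_mul_atTop_of_neg (by linarith)
    exact Real.tendsto_exp_atBot.comp this
  induction n using Nat.strong_induction_on generalizing c with
  | _ n ih =>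
    rcases Nat.eq_zero_or_pos n with rfl | hn
    · simpa only [mass_zero, mul_one] using hexp c hc
    have hn0 : (n : ℝ) ≠ 0 := by positivity
    have hlin : Tendsto (fun lam : ℝ => lam * Real.exp (-(c / 2) * lam)) atTop (𝓝 0) := by
      have := Real.tendsto_pow_mul_exp_neg_atTop_nhds_zero 1
      have h2 := (this.comp (tendsto_id.const_mul_atTop (show 0 < c / 2 by linarith))).const_mul
        (2 / c)
      rw [mul_zero] at h2
      refine h2.congr fun lam => ?_
      simp only [Function.comp, id, pow_one]
      field_simp
    have hsum : Tendsto (fun lam : ℝ => (1 / (n : ℝ)) * ((lam * Real.exp (-(c / 2) * lam)) *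
        ∑ i ∈ range k, if i + 1 ≤ n then
          ((i : ℝ) + 1) * (Real.exp (-(c / 2) * lam) * mass k lam (n - (i + 1))) else 0))
        atTop (𝓝 ((1 / (n : ℝ)) * (0 * ∑ i ∈ range k, 0))) := by
      refine (hlin.mul (tendsto_finsetSum _ fun i _ => ?_)).const_mul _
      split_ifs with hi
      · simpa using (ih (n - (i + 1)) (by omega) (show 0 < c / 2 by linarith)).const_mul ((i : ℝ) + 1)
      · exact tendsto_const_nhds
    simp only [zero_mul, mul_zero] at hsum
    refine hsum.congr fun lam => ?_
    have h1 := mass_rec k lam n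
    have h2 : Real.exp (-c * lam) = Real.exp (-(c / 2) * lam) * Real.exp (-(c / 2) * lam) := by
      rw [← Real.exp_add]; congr 1; ring
    have h3 : (∑ i ∈ range k, if i + 1 ≤ n then
          ((i : ℝ) + 1) * (Real.exp (-(c / 2) * lam) * mass k lam (n - (i + 1))) else 0) =
        Real.exp (-(c / 2) * lam) * ∑ i ∈ range k, if i + 1 ≤ n then
          ((i : ℝ) + 1) * mass k lam (n - (i + 1)) else 0 := by
      rw [mul_sum]
      exact sum_congr rfl fun i _ => by split_ifs <;> ring
    have h4 : mass k lam n = 1 / (n : ℝ) * (n * mass k lam n) := by field_simp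
    rw [h3, h4, h1, h2]
    ring

lemma tendsto_cdf {k : ℕ} (hk : 1 ≤ k) (R : ℕ) :
    Tendsto (fun lam => ∑ j ∈ range R, poissonOrderKPmf k lam j) atTop (𝓝 0) := by
  have hk0 : (0 : ℝ) < k := by exact_mod_cast hk
  have := tendsto_finsetSum (range R) fun j _ => tendsto_exp_mul_mass k j hk0
  rw [sum_const_zero] at this
  refine this.congr fun lam => sum_congr rfl fun j _ => ?_
  rw [pmf_eq, neg_mul]

lemma lt_sInf_root {k R : ℕ} (hk : 1 ≤ k) {lam : ℝ} (hl : 0 < lam)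
    (h : 1 / 2 < ∑ j ∈ range R, poissonOrderKPmf k lam j) :
    lam < sInf {x : ℝ | 0 < x ∧ ∑ j ∈ range R, poissonOrderKPmf k x j = 1 / 2} := by
  have hc := continuous_cdf k R
  have ha := antitoneOn_cdf k R
  obtain ⟨mu, hmu, hmuF⟩ : ∃ mu, lam < mu ∧ 1 / 2 < ∑ j ∈ range R, poissonOrderKPmf k mu j := by
    have h1 : ∀ᶠ x in 𝓝[>] lam, 1 / 2 < ∑ j ∈ range R, poissonOrderKPmf k x j :=
      (hc.continuousAt.eventually_const_lt h).filter_mono nhdsWithin_le_nhds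
    exact (eventually_mem_nhdsWithin.and h1).exists
  refine hmu.trans_le (le_csInf ?_ fun x hx => ?_)
  · obtain ⟨M, hM, hMl⟩ := (((tendsto_cdf hk R).eventually_lt_const
      (show (0 : ℝ) < 1 / 2 by norm_num)).and (eventually_ge_atTop lam)).exists
    obtain ⟨x, hx, hxF⟩ := intermediate_value_Icc' hMl hc.continuousOn ⟨hM.le, h.le⟩
    exact ⟨x, hl.trans_le hx.1, hxF⟩
  · by_contra! hcon
    have := ha (Set.mem_Ici.2 hx.1.le) (Set.mem_Ici.2 (hl.trans hmu).le) hcon.le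
    have := hx.2
    linarith

lemma sInf_root_lt {k R : ℕ} (hR : 1 ≤ R) {lam : ℝ} (hl : 0 < lam)
    (h : ∑ j ∈ range R, poissonOrderKPmf k lam j < 1 / 2) :
    sInf {x : ℝ | 0 < x ∧ ∑ j ∈ range R, poissonOrderKPmf k x j = 1 / 2} < lam := by
  have hc := continuous_cdf k R
  have h0 : 1 / 2 < ∑ j ∈ range R, poissonOrderKPmf k 0 j := by
    have h1 : poissonOrderKPmf k 0 0 = 1 := by simp [pmf_eq, mass_zero]
    have h2 : poissonOrderKPmf k 0 0 ≤ ∑ j ∈ range R, poissonOrderKPmf k 0 j :=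
      single_le_sum (f := fun j => poissonOrderKPmf k 0 j)
        (fun j _ => mul_nonneg (Real.exp_pos _).le (mass_nonneg le_rfl j)) (mem_range.2 hR)
    linarith
  obtain ⟨x, hx, hxF⟩ := intermediate_value_Icc' hl.le hc.continuousOn ⟨h.le, h0.le⟩
  have hx0 : x ≠ 0 := by rintro rfl; simp only at hxF; linarith
  have hxl : x ≠ lam := by rintro rfl; simp only at hxF; linarith
  have hbdd : BddBelow {x : ℝ | 0 < x ∧ ∑ j ∈ range R, poissonOrderKPmf k x j = 1 / 2} :=
    ⟨0, fun y hy => hy.1.le⟩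
  exact (csInf_le hbdd ⟨lt_of_le_of_ne hx.1 hx0.symm, hxF⟩).trans_lt (lt_of_le_of_ne hx.2 hxl)

lemma half_lt_cdf {k n : ℕ} (hk : 2 ≤ k) (h1 : firstIndex k ≤ n) (h2 : k * (k + 1) / 2 ≤ n) :
    1 / 2 < ∑ j ∈ range (n - (k + 4) / 8 + 1), poissonOrderKPmf k
      ((n + alphaLimit k) / (k * (k + 1) / 2)) j := by
  have hk0 : (2 : ℝ) ≤ k := by exact_mod_cast hk
  have hL := alphaLimit_nonneg k
  by_cases hn : n ≤ 15 * (2 * k + 1) / 2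
  · have h30 : k < 30 := by
      by_contra! hcon
      have h3 : k * 31 ≤ k * (k + 1) := Nat.mul_le_mul_left _ (by omega)
      omega
    have := half_lt_of_checkAt (by omega) (checkAt_eq_true hk h30 h1 hn)
    convert this using 3 with j
    rw [Nat.cast_mul, cast_triangle, alphaLimit_eq]
    push_cast
    field_simp
    ring
  · have hq : (k + 4) / 8 ≤ n := by omega
    have hrel := index_relation (by omega) hq 0
    simp only [add_zero] at hrel
    have hn' : 15 * (2 * (k : ℝ) + 1) ≤ 2 * n := by
      have : 15 * (2 * k + 1) ≤ 2 * n := by omega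
      exact_mod_cast this
    have h2' : (k : ℝ) * (k + 1) / 2 ≤ n := by
      rw [← cast_triangle]; exact_mod_cast h2
    have hpos := integral_devFun_pos hk (lam := (n + alphaLimit k) / (k * (k + 1) / 2))
      (by rw [le_div_iff₀ (by positivity)]; linarith)
      (by
        have : (n + alphaLimit k) / (k * (k + 1) / 2) * (2 * k + 1) * (1 - eps k) =
            8 * (n + alphaLimit k) / (2 * k + 1) := by
          rw [eps]; field_simp; ring
        rw [this, le_div_iff₀ (by positivity)]
        linarith)
    have h3 := (cdf_sub_half hrel).2
    have : 0 < (∫ t in (0 : ℝ)..Real.pi, devFun k (k * (k + 1) / (4 * (2 * k + 1)))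
      ((n + alphaLimit k) / (k * (k + 1) / 2)) t) / (2 * Real.pi) :=
      div_pos hpos (by positivity)
    linarith

lemma lt_alpha {k n : ℕ} (hk : 2 ≤ k) (h1 : firstIndex k ≤ n) (h2 : k * (k + 1) / 2 ≤ n) :
    n + alphaLimit k < poissonOrderKAlpha k n := by
  have hk0 : (2 : ℝ) ≤ k := by exact_mod_cast hk
  have hL := alphaLimit_nonneg k
  have h2' : (k : ℝ) * (k + 1) / 2 ≤ n := by
    rw [← cast_triangle]; exact_mod_cast h2
  have hT : 0 < (k : ℝ) * (k + 1) / 2 := by positivity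
  have := lt_sInf_root (by omega) (div_pos (by linarith) hT) (half_lt_cdf hk h1 h2)
  rw [poissonOrderKAlpha, cast_triangle]
  rwa [div_lt_iff₀' hT] at this

lemma eventually_alpha_lt {k : ℕ} (hk : 2 ≤ k) {e : ℝ} (he : 0 < e) :
    ∀ᶠ n : ℕ in atTop, poissonOrderKAlpha k n < n + alphaLimit k + e := by
  have hk0 : (2 : ℝ) ≤ k := by exact_mod_cast hk
  have hL := alphaLimit_nonneg k
  have hT : 0 < (k : ℝ) * (k + 1) / 2 := by positivity
  have hlim := tendsto_integral_devFun (k := k) (by omega) (k * (k + 1) / (4 * (2 * k + 1)) + e)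
  have hp : 0 < powSum k 2 := by rw [powSum_two]; positivity
  have hneg : ((k * (k + 1) / (2 * (2 * k + 1)) - 2 * (k * (k + 1) / (4 * (2 * k + 1)) + e)) *
      (√(Real.pi / (powSum k 2 / 2)) / 2) : ℝ) < 0 := by
    apply mul_neg_of_neg_of_pos
    · have : (k * (k + 1) / (2 * (2 * k + 1)) - 2 * (k * (k + 1) / (4 * (2 * k + 1)) + e) : ℝ) =
        -(2 * e) := by field_simp; ring
      rw [this]; linarith
    · have := Real.pi_pos; positivity
  have hseq : Tendsto (fun n : ℕ => √((n + alphaLimit k + e) / (k * (k + 1) / 2))) atTop atTop := by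
    refine Real.tendsto_sqrt_atTop.comp (Tendsto.atTop_div_const hT ?_)
    exact tendsto_atTop_add_const_right _ _
      (tendsto_atTop_add_const_right _ _ tendsto_natCast_atTop_atTop)
  filter_upwards [hseq.eventually (hlim.eventually_lt_const hneg), eventually_ge_atTop ((k + 4) / 8)]
    with n hn hq
  have hlam : 0 < (n + alphaLimit k + e) / (k * (k + 1) / 2) := div_pos (by positivity) hT
  rw [Real.sq_sqrt hlam.le] at hn
  have hint := neg_of_mul_neg_right hn (Real.sqrt_nonneg _)
  have h3 := (cdf_sub_half (index_relation (by omega) hq e)).2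
  have h4 := div_neg_of_neg_of_pos hint (show 0 < 2 * Real.pi by positivity)
  have := sInf_root_lt (k := k) (R := n - (k + 4) / 8 + 1) (by omega) hlam (by linarith)
  rw [poissonOrderKAlpha, cast_triangle]
  rwa [lt_div_iff₀' hT] at this

lemma tendsto_alpha_sub {k : ℕ} (hk : 2 ≤ k) :
    Tendsto (fun n : ℕ => poissonOrderKAlpha k n - (n : ℝ)) atTop (𝓝 (alphaLimit k)) := by
  refine tendsto_order.2 ⟨fun a ha => ?_, fun a ha => ?_⟩
  · filter_upwards [eventually_ge_atTop (firstIndex k), eventually_ge_atTop (k * (k + 1) / 2)]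
      with n h1 h2
    linarith [lt_alpha hk h1 h2]
  · filter_upwards [eventually_alpha_lt hk (sub_pos.2 ha)] with n hn
    linarith

lemma firstIndex_le {k n : ℕ} (hn : (k = 2 ∧ 3 * (k * (k + 1) / 2) ≤ n) ∨
    (3 ≤ k ∧ k ≤ 6 ∧ 2 * (k * (k + 1) / 2) ≤ n) ∨ (7 ≤ k ∧ k * (k + 1) / 2 ≤ n)) :
    firstIndex k ≤ n ∧ k * (k + 1) / 2 ≤ n := by
  rcases hn with ⟨rfl, h⟩ | ⟨h3, h6, h⟩ | ⟨h7, h⟩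
  · exact ⟨h, by omega⟩
  · interval_cases k <;> exact ⟨h, by omega⟩
  · refine ⟨?_, h⟩
    have h2 : Nat.beq k 2 = false := by
      rw [Bool.eq_false_iff, ne_eq, Nat.beq_eq]; omega
    have h6 : Nat.ble k 6 = false := by
      rw [Bool.eq_false_iff, ne_eq, Nat.ble_eq]; omega
    simpa [firstIndex, h2, h6] using h

end PoissonOrderK

/-- Conjecture: For fixed k > 1,
lim_{n→∞} (α_(k,n) − n) = frac((k+4)/8) + k/(8(2k+1)), and this is a sharp lower bound
for α_(k,n) − n over the range of n on which α_(k,n) − n is decreasing; equivalently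
lim_{n→∞} (α_(k,n) − ν_k(n/κ)) = (2k+9)/16 − 1/(16(2k+1)), a sharp lower bound for
α_(k,n) − ν_k(n/κ) (with ν_k(n/κ) = n − ⌊(k+4)/8⌋). -/
theorem poissonOrderK_alpha_limit (k : ℕ) (hk : 1 < k) :
    Filter.Tendsto (fun n : ℕ => poissonOrderKAlpha k n - (n : ℝ)) Filter.atTop
      (nhds (Int.fract (((k : ℝ) + 4) / 8) + (k : ℝ) / (8 * (2 * (k : ℝ) + 1)))) ∧
    (∀ n : ℕ,
      ((k = 2 ∧ 3 * (k * (k + 1) / 2) ≤ n) ∨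
       (3 ≤ k ∧ k ≤ 6 ∧ 2 * (k * (k + 1) / 2) ≤ n) ∨
       (7 ≤ k ∧ k * (k + 1) / 2 ≤ n)) →
      Int.fract (((k : ℝ) + 4) / 8) + (k : ℝ) / (8 * (2 * (k : ℝ) + 1)) <
        poissonOrderKAlpha k n - (n : ℝ)) ∧
    Filter.Tendsto
      (fun n : ℕ => poissonOrderKAlpha k n - ((n - (k + 4) / 8 : ℕ) : ℝ)) Filter.atTop
      (nhds ((2 * (k : ℝ) + 9) / 16 - 1 / (16 * (2 * (k : ℝ) + 1)))) ∧
    (∀ n : ℕ,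
      ((k = 2 ∧ 3 * (k * (k + 1) / 2) ≤ n) ∨
       (3 ≤ k ∧ k ≤ 6 ∧ 2 * (k * (k + 1) / 2) ≤ n) ∨
       (7 ≤ k ∧ k * (k + 1) / 2 ≤ n)) →
      (2 * (k : ℝ) + 9) / 16 - 1 / (16 * (2 * (k : ℝ) + 1)) <
        poissonOrderKAlpha k n - ((n - (k + 4) / 8 : ℕ) : ℝ)) := by
  have hlim := PoissonOrderK.tendsto_alpha_sub hk
  have hlow (n : ℕ) (hn : (k = 2 ∧ 3 * (k * (k + 1) / 2) ≤ n) ∨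
      (3 ≤ k ∧ k ≤ 6 ∧ 2 * (k * (k + 1) / 2) ≤ n) ∨ (7 ≤ k ∧ k * (k + 1) / 2 ≤ n)) :=
    PoissonOrderK.lt_alpha hk (PoissonOrderK.firstIndex_le hn).1 (PoissonOrderK.firstIndex_le hn).2
  have hcast (n : ℕ) (hn : (k + 4) / 8 ≤ n) : poissonOrderKAlpha k n - ((n - (k + 4) / 8 : ℕ) : ℝ) =
      poissonOrderKAlpha k n - n + (((k + 4) / 8 : ℕ) : ℝ) := by
    rw [Nat.cast_sub hn]; ring
  rw [← PoissonOrderK.alphaLimit_add, ← PoissonOrderK.alphaLimit]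
  refine ⟨hlim, fun n hn => by linarith [hlow n hn], ?_, fun n hn => ?_⟩
  · refine (hlim.add_const _).congr' ?_
    filter_upwards [Filter.eventually_ge_atTop ((k + 4) / 8)] with n hn
    rw [hcast n hn]
  · have hq : (k + 4) / 8 ≤ n := by
      have h1 := (PoissonOrderK.firstIndex_le hn).2
      have h2 : k * 3 ≤ k * (k + 1) := Nat.mul_le_mul_left _ (by omega)
      omega
    rw [hcast n hq]
    linarith [hlow n hn]
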